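/- Let n ≥ 1, −1 < γ < 0, 1 < p < ∞, and M ≥ 2. Let K ∈ ℝⁿ with 2 ≤ |K| ≤ M, and let w be a viscosity solution of the deviation equation ∂_t w − |Dw+K|^γ[Δw + (p−2)⟨D²w (Dw+K), Dw+K⟩/|Dw+K|²] = f̃ in Q₁ with w(0,0) = 0. Then there exists η₁ = η₁(p,n,γ,M) > 0 such that if ‖w‖_{L^∞(Q₁)} ≤ η₁ and ‖f̃‖_{L^∞(Q₁)} ≤ η₁, then w is Lipschitz continuous in space in Q_{3/4} with constant 1: for all (x,t),(y,t) ∈ Q_{3/4}, |w(x,t) − w(y,t)| ≤ |x−y|. -/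

import Mathlib

open Set Real RealInnerProductSpace

noncomputable section

/-- `ℝⁿ` with the Euclidean structure. -/
abbrev En (n : ℕ) : Type := EuclideanSpace ℝ (Fin n)

/-- The parabolic cylinder `Q_r := B_r(0) × (-r², 0) ⊂ ℝⁿ × ℝ`. -/
def pCyl (n : ℕ) (r : ℝ) : Set (En n × ℝ) :=
  {z | ‖z.1‖ < r ∧ z.2 ∈ Set.Ioo (-r ^ 2) (0 : ℝ)}

/-- The intrinsic cylinder `Q_r^a := B_r(0) × (-r² a^{-γ}, 0)`. -/
def iCyl (n : ℕ) (γ r a : ℝ) : Set (En n × ℝ) :=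
  {z | ‖z.1‖ < r ∧ z.2 ∈ Set.Ioo (-(r ^ 2 * a ^ (-γ))) (0 : ℝ)}

/-- Spatial gradient of a function of space and time. -/
def sGrad {n : ℕ} (φ : En n × ℝ → ℝ) (x : En n) (t : ℝ) : En n :=
  gradient (fun y => φ (y, t)) x

/-- Spatial Hessian of a function of space and time. -/
def sHess {n : ℕ} (φ : En n × ℝ → ℝ) (x : En n) (t : ℝ) : En n →L[ℝ] En n :=
  fderiv ℝ (fun y => sGrad φ y t) x

/-- The value `|q|^γ (tr H + (p-2) ⟨H q, q⟩ / |q|²)`, i.e. `|q|^γ` times the normalized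
`p`-Laplacian computed from a gradient `q ≠ 0` and a Hessian `H`. -/
def opVal {n : ℕ} (γ p : ℝ) (q : En n) (H : En n →L[ℝ] En n) : ℝ :=
  ‖q‖ ^ γ * (LinearMap.trace ℝ (En n) H.toLinearMap + (p - 2) * ⟪H q, q⟫ / ‖q‖ ^ 2)

/-- Viscosity supersolution of `∂ₜ u - |Du|^γ Δ_p^N u = f` on `Ω`. -/
def IsSupersol {n : ℕ} (γ p : ℝ) (f u : En n × ℝ → ℝ) (Ω : Set (En n × ℝ)) : Prop :=
  (∀ z ∈ Ω, ∀ φ : En n × ℝ → ℝ, ContDiff ℝ 2 φ →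
      sGrad φ z.1 z.2 ≠ 0 → φ z = u z → (∀ w ∈ Ω, φ w ≤ u w) →
      f z ≤ deriv (fun s => φ (z.1, s)) z.2
            - opVal γ p (sGrad φ z.1 z.2) (sHess φ z.1 z.2)) ∧
  (∀ z ∈ Ω, ∀ δ : ℝ, 0 < δ → ∀ φ : ℝ → ℝ,
      ContDiffOn ℝ 1 φ (Set.Ioo (z.2 - δ) (z.2 + δ)) → φ z.2 = 0 →
      (∀ t ∈ Set.Ioo (z.2 - δ) (z.2 + δ), u (z.1, z.2) ≤ u (z.1, t) - φ t) →
      (∃ ε > (0:ℝ), ∃ c : ℝ, ∀ x : En n, ‖x - z.1‖ < ε →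
          sInf ((fun t => u (x, t) - φ t) '' Set.Ioo (z.2 - δ) (z.2 + δ)) = c) →
      f z ≤ deriv φ z.2)

/-- Viscosity subsolution of `∂ₜ u - |Du|^γ Δ_p^N u = f` on `Ω`. -/
def IsSubsol {n : ℕ} (γ p : ℝ) (f u : En n × ℝ → ℝ) (Ω : Set (En n × ℝ)) : Prop :=
  (∀ z ∈ Ω, ∀ φ : En n × ℝ → ℝ, ContDiff ℝ 2 φ →
      sGrad φ z.1 z.2 ≠ 0 → φ z = u z → (∀ w ∈ Ω, u w ≤ φ w) →
      deriv (fun s => φ (z.1, s)) z.2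
            - opVal γ p (sGrad φ z.1 z.2) (sHess φ z.1 z.2) ≤ f z) ∧
  (∀ z ∈ Ω, ∀ δ : ℝ, 0 < δ → ∀ φ : ℝ → ℝ,
      ContDiffOn ℝ 1 φ (Set.Ioo (z.2 - δ) (z.2 + δ)) → φ z.2 = 0 →
      (∀ t ∈ Set.Ioo (z.2 - δ) (z.2 + δ), u (z.1, t) - φ t ≤ u (z.1, z.2)) →
      (∃ ε > (0:ℝ), ∃ c : ℝ, ∀ x : En n, ‖x - z.1‖ < ε →
          sSup ((fun t => u (x, t) - φ t) '' Set.Ioo (z.2 - δ) (z.2 + δ)) = c) →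
      deriv φ z.2 ≤ f z)

/-- Viscosity solution of `∂ₜ u - |Du|^γ Δ_p^N u = f` on `Ω`: a continuous function which is
both a viscosity supersolution and a viscosity subsolution. -/
def IsViscSol {n : ℕ} (γ p : ℝ) (f u : En n × ℝ → ℝ) (Ω : Set (En n × ℝ)) : Prop :=
  ContinuousOn u Ω ∧ IsSupersol γ p f u Ω ∧ IsSubsol γ p f u Ω

/-- Viscosity solution of the deviation equation
`∂ₜ w - |Dw+K|^γ [Δw + (p-2)⟨D²w (Dw+K), Dw+K⟩/|Dw+K|²] = f` on `Ω`; equivalently,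
`u(x,t) := w(x,t) + K·x` is a viscosity solution of `∂ₜ u - |Du|^γ Δ_p^N u = f`. -/
def IsDevSol {n : ℕ} (γ p : ℝ) (K : En n) (f w : En n × ℝ → ℝ) (Ω : Set (En n × ℝ)) : Prop :=
  IsViscSol γ p f (fun z => w z + ⟪K, z.1⟫) Ω

open MeasureTheory


/-- `s` is a subgradient of `g` at `x`. -/
def SubG {E : Type*} [NormedAddCommGroup E] [InnerProductSpace ℝ E] (g : E → ℝ) (x s : E) : Prop :=
  ∀ z, g x + ⟪s, z - x⟫ ≤ g z

lemma subG_mono {E : Type*} [NormedAddCommGroup E] [InnerProductSpace ℝ E] {g : E → ℝ}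
    {x s x' s' : E} (h : SubG g x s) (h' : SubG g x' s') :
    ‖x - x'‖ ≤ ‖(x + s) - (x' + s')‖ := by
  have h1 := h x'
  have h2 := h' x
  have h3 : 0 ≤ ⟪x - x', s - s'⟫ := by
    have e : ⟪x - x', s - s'⟫ = -⟪s, x' - x⟫ - ⟪s', x - x'⟫ := by
      rw [real_inner_comm]
      simp only [inner_sub_left, inner_sub_right]; ring
    rw [e]; linarith
  have h4 : (x + s) - (x' + s') = (x - x') + (s - s') := by abel
  rw [h4]
  have := norm_add_sq_real (x - x') (s - s')
  refine (sq_le_sq₀ (norm_nonneg _) (norm_nonneg _)).1 ?_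
  nlinarith [sq_nonneg ‖s - s'‖]

/-- one-dimensional integration of approximate sub-slopes. -/
lemma one_dim_aux (k σ : ℝ → ℝ) (a b e : ℝ)
    (hk : ∀ τ ∈ Icc (0:ℝ) 1, ∀ τ' ∈ Icc (0:ℝ) 1, σ τ * (τ' - τ) ≤ k τ' - k τ)
    (hσ : ∀ τ ∈ Icc (0:ℝ) 1, |σ τ - (a + b * τ)| ≤ e) :
    |k 1 - k 0 - a - b / 2| ≤ e := by
  have step : ∀ N : ℕ, 0 < N → |k 1 - k 0 - a - b / 2| ≤ e + |b| / 2 * (1 / N) := by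
    intro N hN
    have hN' : (0:ℝ) < N := by exact_mod_cast hN
    have ind : ∀ i : ℕ, i ≤ N →
        |k (i / N) - k 0 - a * (i / N) - b / 2 * (i / N) ^ 2| ≤ i * ((e + |b| / 2 * (1 / N)) / N) := by
      intro i
      induction i with
      | zero => intro _; simp
      | succ i ih =>
        intro hi
        have ih := ih (by omega)
        have hi' : ((i:ℝ) + 1) ≤ N := by exact_mod_cast hi
        have m1 : (i:ℝ) / N ∈ Icc (0:ℝ) 1 := ⟨by positivity, by rw [div_le_one hN']; linarith⟩
        have m2 : ((i:ℝ)+1) / N ∈ Icc (0:ℝ) 1 := ⟨by positivity, by rw [div_le_one hN']; linarith⟩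
        have k1 := hk _ m1 _ m2
        have k2 := hk _ m2 _ m1
        have s1 := abs_le.1 (hσ _ m1)
        have s2 := abs_le.1 (hσ _ m2)
        push_cast
        set u : ℝ := 1 / N with hu
        have hu0 : 0 < u := by positivity
        have e1 : ((i:ℝ)+1)/N = i / N + u := by rw [hu]; ring
        rw [e1] at k1 k2 s2 ⊢
        set τ := (i:ℝ) / N with hτ
        have e2 : ((i:ℝ)+1) * ((e + |b| / 2 * u) / N) = i * ((e + |b| / 2 * u) / N) + (e + |b|/2*u) * u := by
          rw [hu]; ring
        rw [e2]
        have hb1 := neg_abs_le b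
        have hb2 := le_abs_self b
        rw [abs_le] at ih ⊢
        have p1 := mul_le_mul_of_nonneg_right s1.1 hu0.le
        have p2 := mul_le_mul_of_nonneg_right s2.2 hu0.le
        have p3 := mul_le_mul_of_nonneg_right hb1 (sq_nonneg u)
        have p4 := mul_le_mul_of_nonneg_right hb2 (sq_nonneg u)
        constructor <;> nlinarith
    have := ind N le_rfl
    rw [div_self hN'.ne'] at this
    have e3 : (N:ℝ) * ((e + |b| / 2 * (1 / N)) / N) = e + |b| / 2 * (1/N) := by field_simp
    rw [e3] at this
    simpa using this
  refine le_of_forall_pos_le_add fun δ hδ => ?_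
  obtain ⟨N, hN⟩ := exists_nat_one_div_lt (show 0 < δ / (|b| / 2 + 1) by positivity)
  have h1 := step (N+1) (by omega)
  push_cast at h1
  have h2 : |b| / 2 * (1 / ((N:ℝ)+1)) ≤ δ := by
    rw [lt_div_iff₀ (by positivity)] at hN
    have : (0:ℝ) < 1 / ((N:ℝ)+1) := by positivity
    nlinarith
  linarith

/-- In a real inner product space, a vector whose pairing is `O(|h|²)` vanishes. -/
lemma vec_zero_of_quad {E : Type*} [NormedAddCommGroup E] [InnerProductSpace ℝ E] (v : E) (C d : ℝ)
    (hd : 0 < d) (h : ∀ w, ‖w‖ ≤ d → ⟪v, w⟫ ≤ C * ‖w‖ ^ 2) : v = 0 := by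
  by_contra hv
  have hn : 0 < ‖v‖ := norm_pos_iff.2 hv
  set τ := min (d / ‖v‖) (1 / (2 * (|C| + 1))) with hτ
  have hτ0 : 0 < τ := by positivity
  have := h (τ • v) (by
    rw [norm_smul, Real.norm_of_nonneg hτ0.le]
    calc τ * ‖v‖ ≤ d / ‖v‖ * ‖v‖ := by gcongr; exact min_le_left _ _
      _ = d := by field_simp)
  rw [inner_smul_right, real_inner_self_eq_norm_sq, norm_smul, Real.norm_of_nonneg hτ0.le] at this
  have h2 : τ * (2 * (|C| + 1)) ≤ 1 := by
    rw [← le_div_iff₀ (by positivity)]; exact min_le_right _ _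
  have h3 : C ≤ |C| := le_abs_self C
  have h4 : 0 < τ * ‖v‖ ^ 2 := by positivity
  have h5 : C * (τ * ‖v‖) ^ 2 = (C * τ) * (τ * ‖v‖ ^ 2) := by ring
  rw [h5] at this
  have h6 : C * τ < 1 := by nlinarith [abs_nonneg C]
  nlinarith

/-- norm bound from pairing with vectors of a given radius. -/
lemma norm_le_of_pair {E : Type*} [NormedAddCommGroup E] [InnerProductSpace ℝ E] (v : E) (B r : ℝ)
    (hr : 0 < r) (hB : 0 ≤ B) (h : ∀ w, ‖w‖ = r → ⟪v, w⟫ ≤ B * r) : ‖v‖ ≤ B := by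
  by_cases hv : v = 0
  · simp [hv, hB]
  have hn : 0 < ‖v‖ := norm_pos_iff.2 hv
  have := h ((r / ‖v‖) • v) (by
    rw [norm_smul, Real.norm_of_nonneg (by positivity)]; field_simp)
  rw [inner_smul_right, real_inner_self_eq_norm_sq] at this
  have e : r / ‖v‖ * ‖v‖ ^ 2 = ‖v‖ * r := by field_simp
  rw [e] at this
  exact le_of_mul_le_mul_right this hr

open Set Real RealInnerProductSpace MeasureTheory

/-- Twice differentiability at a point where the resolvent `x + s ↦ x` is differentiable. -/
lemma expand_of_diff {E : Type*} [NormedAddCommGroup E] [InnerProductSpace ℝ E]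
    [FiniteDimensional ℝ E] (g : E → ℝ) (hsub : ∀ x, ∃ s, SubG g x s) (J : E → E) (Y : Set E)
    (hY : ∀ x s, SubG g x s → x + s ∈ Y) (hJ : ∀ x s, SubG g x s → J (x + s) = x)
    (x₀ s₀ : E) (h₀ : SubG g x₀ s₀) (hd : DifferentiableWithinAt ℝ J Y (x₀ + s₀))
    (L d₁ : ℝ) (hL : 0 ≤ L) (hd₁ : 0 < d₁)
    (hlip : ∀ x s, SubG g x s → ‖x - x₀‖ ≤ d₁ → ‖s - s₀‖ ≤ L * ‖x - x₀‖) :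
    ∃ H : E →L[ℝ] E, (∀ a b, ⟪H a, b⟫ = ⟪a, H b⟫) ∧
      ∀ ε > 0, ∃ d > 0, ∀ h, ‖h‖ < d →
        |g (x₀ + h) - g x₀ - ⟪s₀, h⟫ - 1 / 2 * ⟪H h, h⟫| ≤ ε * ‖h‖ ^ 2 := by
  choose S hS using hsub
  set A := fderivWithin ℝ J Y (x₀ + s₀) with hA
  have hder : HasFDerivWithinAt J A Y (x₀ + s₀) := hd.hasFDerivWithinAt
  -- increments
  set k : E → E := fun h => (x₀ + h + S (x₀ + h)) - (x₀ + s₀) with hk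
  have hkb : ∀ h, ‖h‖ ≤ d₁ → ‖k h‖ ≤ (1 + L) * ‖h‖ := by
    intro h hh
    have h1 := hlip (x₀ + h) (S (x₀ + h)) (hS _) (by simpa using hh)
    have e : k h = h + (S (x₀ + h) - s₀) := by simp only [hk]; abel
    rw [e]
    calc _ ≤ ‖h‖ + ‖S (x₀ + h) - s₀‖ := norm_add_le _ _
      _ ≤ ‖h‖ + L * ‖h‖ := by gcongr; simpa using h1
      _ = _ := by ring
  have happ : ∀ ε > 0, ∃ d > 0, d ≤ d₁ ∧ ∀ h, ‖h‖ < d → ‖h - A (k h)‖ ≤ ε * ‖h‖ := by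
    intro ε hε
    have h1 := hder.isLittleO.def (show 0 < ε / (1 + L) by positivity)
    rw [eventually_nhdsWithin_iff, Metric.eventually_nhds_iff] at h1
    obtain ⟨r, hr, h1⟩ := h1
    refine ⟨min d₁ (r / (1 + L)), by positivity, min_le_left _ _, fun h hh => ?_⟩
    have hb := hkb h (hh.le.trans (min_le_left _ _))
    have h2 := h1 (y := x₀ + h + S (x₀ + h)) (by
      rw [dist_eq_norm]
      calc _ ≤ (1 + L) * ‖h‖ := hb
        _ < (1 + L) * (r / (1 + L)) := by gcongr; exact hh.trans_le (min_le_right _ _)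
        _ = r := by field_simp) (hY _ _ (hS _))
    rw [hJ _ _ (hS _), hJ _ _ h₀] at h2
    have e : x₀ + h - x₀ = h := by abel
    rw [e] at h2
    calc _ ≤ ε / (1 + L) * ‖k h‖ := h2
      _ ≤ ε / (1 + L) * ((1 + L) * ‖h‖) := by gcongr
      _ = _ := by field_simp
  have hsurj : Function.Surjective A := by
    intro v
    have hcl : IsClosed ((LinearMap.range A.toLinearMap : Submodule ℝ E) : Set E) :=
      Submodule.closed_of_finiteDimensional _
    have : v ∈ closure ((LinearMap.range A.toLinearMap : Submodule ℝ E) : Set E) := by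
      rw [Metric.mem_closure_iff]
      intro ε hε
      obtain ⟨d, hd0, -, h1⟩ := happ (ε / (2 * (‖v‖ + 1))) (by positivity)
      set τ := d / (2 * (‖v‖ + 1)) with hτ
      have hτ0 : 0 < τ := by positivity
      have hn : ‖τ • v‖ = τ * ‖v‖ := by rw [norm_smul, Real.norm_of_nonneg hτ0.le]
      have h2 := h1 (τ • v) (by
        rw [hn, hτ, div_mul_eq_mul_div, div_lt_iff₀ (by positivity)]
        nlinarith [norm_nonneg v])
      refine ⟨A (τ⁻¹ • k (τ • v)), ⟨_, rfl⟩, ?_⟩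
      rw [dist_eq_norm]
      have e : v - A (τ⁻¹ • k (τ • v)) = τ⁻¹ • (τ • v - A (k (τ • v))) := by
        rw [map_smul, smul_sub, smul_smul, inv_mul_cancel₀ hτ0.ne', one_smul]
      rw [e, norm_smul, Real.norm_of_nonneg (by positivity)]
      rw [hn] at h2
      calc _ ≤ τ⁻¹ * (ε / (2 * (‖v‖ + 1)) * (τ * ‖v‖)) := by gcongr
        _ = ε * (‖v‖ / (2 * (‖v‖ + 1))) := by field_simp
        _ < ε * 1 := by
          gcongr
          rw [div_lt_one (by positivity)]
          linarith [norm_nonneg v]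
        _ = ε := mul_one ε
    rw [hcl.closure_eq] at this
    obtain ⟨y, hy⟩ := this
    exact ⟨y, hy⟩
  have hinj : Function.Injective A := (LinearMap.injective_iff_surjective (f := A.toLinearMap)).2 hsurj
  set Be := (LinearEquiv.ofBijective A.toLinearMap ⟨hinj, hsurj⟩).toContinuousLinearEquiv with hBe
  set B : E →L[ℝ] E := (Be.symm : E →L[ℝ] E) with hB
  have hBA : ∀ x, B (A x) = x := fun x => Be.symm_apply_apply x
  set H0 : E →L[ℝ] E := B - ContinuousLinearMap.id ℝ E with hH0
  set H : E →L[ℝ] E := (1 / 2 : ℝ) • (H0 + ContinuousLinearMap.adjoint H0) with hH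
  have hHq : ∀ h, ⟪H h, h⟫ = ⟪H0 h, h⟫ := by
    intro h
    simp only [hH, smul_apply, add_apply, inner_smul_left,
      inner_add_left, ContinuousLinearMap.adjoint_inner_left]
    rw [real_inner_comm (H0 h) h]
    simp
    ring
  refine ⟨H, ?_, ?_⟩
  · intro a b
    simp only [hH, smul_apply, add_apply, inner_smul_left,
      inner_smul_right, inner_add_right,
      inner_add_left, ContinuousLinearMap.adjoint_inner_left, ContinuousLinearMap.adjoint_inner_right]
    simp
    ring
  intro ε hε
  obtain ⟨d, hd0, hdd, h1⟩ := happ (ε / (‖B‖ + 1)) (by positivity)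
  refine ⟨d, hd0, fun h hh => ?_⟩
  rw [hHq]
  -- slope estimate
  have hs : ∀ h', ‖h'‖ < d → ‖S (x₀ + h') - s₀ - H0 h'‖ ≤ ε * ‖h'‖ := by
    intro h' hh'
    have e : S (x₀ + h') - s₀ - H0 h' = - B (h' - A (k h')) := by
      rw [map_sub, hBA]
      simp only [hH0, hk, sub_apply, ContinuousLinearMap.id_apply]
      abel
    rw [e, norm_neg]
    calc _ ≤ ‖B‖ * ‖h' - A (k h')‖ := B.le_opNorm _
      _ ≤ ‖B‖ * (ε / (‖B‖ + 1) * ‖h'‖) := by gcongr; exact h1 h' hh'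
      _ = (‖B‖ / (‖B‖ + 1)) * (ε * ‖h'‖) := by field_simp
      _ ≤ 1 * (ε * ‖h'‖) := by
        gcongr
        rw [div_le_one (by positivity)]; linarith
      _ = _ := one_mul _
  have key := one_dim_aux (fun τ => g (x₀ + τ • h)) (fun τ => ⟪S (x₀ + τ • h), h⟫)
    ⟪s₀, h⟫ ⟪H0 h, h⟫ (ε * ‖h‖ ^ 2) (by
      intro τ hτ τ' hτ'
      have h2 := hS (x₀ + τ • h) (x₀ + τ' • h)
      have e : x₀ + τ' • h - (x₀ + τ • h) = (τ' - τ) • h := by rw [sub_smul]; abel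
      rw [e, inner_smul_right] at h2

      linarith [mul_comm (τ' - τ) ⟪S (x₀ + τ • h), h⟫]) (by
      intro τ hτ
      have hn : ‖τ • h‖ ≤ ‖h‖ := by
        rw [norm_smul, Real.norm_of_nonneg hτ.1]
        exact mul_le_of_le_one_left (norm_nonneg _) hτ.2
      have h2 := hs (τ • h) (hn.trans_lt hh)
      have e : ⟪S (x₀ + τ • h), h⟫ - (⟪s₀, h⟫ + ⟪H0 h, h⟫ * τ) = ⟪S (x₀ + τ • h) - s₀ - H0 (τ • h), h⟫ := by
        rw [map_smul, inner_sub_left, inner_sub_left, inner_smul_left]; simp; ring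

      rw [e]
      calc _ ≤ ‖S (x₀ + τ • h) - s₀ - H0 (τ • h)‖ * ‖h‖ := abs_real_inner_le_norm _ _
        _ ≤ (ε * ‖τ • h‖) * ‖h‖ := by gcongr
        _ ≤ (ε * ‖h‖) * ‖h‖ := by gcongr
        _ = _ := by ring)
  simp only [one_smul, zero_smul, add_zero] at key
  convert key using 2
  ring

open Set Real RealInnerProductSpace MeasureTheory

/-- Combination of Jensen's lemma and Alexandrov's theorem. -/
theorem jensen_alexandrov {E : Type*} [NormedAddCommGroup E] [InnerProductSpace ℝ E]
    [FiniteDimensional ℝ E] (g Ψ : E → ℝ) (hg : Continuous g) (hsub : ∀ x, ∃ s, SubG g x s)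
    (𝒦 : Set E) (h𝒦 : IsCompact 𝒦) (hΨ : ContinuousOn Ψ 𝒦) (G : E → E) (C : ℝ) (hC : 0 ≤ C)
    (hG : ∀ ξ ∈ 𝒦, ∀ ξ' ∈ 𝒦, Ψ ξ' ≤ Ψ ξ + ⟪G ξ, ξ' - ξ⟫ + C * ‖ξ' - ξ‖ ^ 2)
    (ξ₀ : E) (hξ₀ : ξ₀ ∈ 𝒦) (κ : ℝ) (hκ : 0 < κ)
    (hint : ∀ ξ ∈ 𝒦, g ξ₀ - Ψ ξ₀ - κ ≤ g ξ - Ψ ξ → ξ ∈ interior 𝒦) (ρ : ℝ) (hρ : 0 < ρ) :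
    ∃ ξ ∈ interior 𝒦, ∃ p, ‖p‖ ≤ ρ ∧ g ξ₀ - Ψ ξ₀ - κ ≤ g ξ - Ψ ξ ∧
      (∀ ξ' ∈ 𝒦, g ξ' - Ψ ξ' ≤ g ξ - Ψ ξ + ⟪p, ξ' - ξ⟫) ∧
      ∃ H : E →L[ℝ] E, (∀ a b, ⟪H a, b⟫ = ⟪a, H b⟫) ∧
      ∀ ε > 0, ∃ d > 0, ∀ h, ‖h‖ < d →
        |g (ξ + h) - g ξ - ⟪G ξ + p, h⟫ - 1 / 2 * ⟪H h, h⟫| ≤ ε * ‖h‖ ^ 2 := by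
  set m : E → ℝ := fun ξ => g ξ - Ψ ξ with hm
  have hmc : ContinuousOn m 𝒦 := hg.continuousOn.sub hΨ
  -- the good compact set
  set S : Set E := {ξ ∈ 𝒦 | m ξ₀ - κ ≤ m ξ} with hSdef
  have hScomp : IsCompact S := by
    have : IsClosed (𝒦 ∩ m ⁻¹' (Ici (m ξ₀ - κ))) :=
      hmc.preimage_isClosed_of_isClosed h𝒦.isClosed isClosed_Ici
    exact h𝒦.of_isClosed_subset this (fun x hx => hx.1)
  obtain ⟨d₀, hd₀, hthick⟩ := hScomp.exists_cthickening_subset_open isOpen_interior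
    (fun ξ hξ => hint ξ hξ.1 hξ.2 : S ⊆ interior 𝒦)
  have hball : ∀ ξ ∈ S, ∀ h : E, ‖h‖ ≤ d₀ → ξ + h ∈ 𝒦 := by
    intro ξ hξ h hh
    apply interior_subset
    apply hthick
    apply Metric.mem_cthickening_of_dist_le _ ξ _ _ hξ
    simpa [dist_eq_norm] using hh
  -- contact pairs
  let Ct : E → E → Prop := fun ξ p => ξ ∈ S ∧ ∀ ξ' ∈ 𝒦, m ξ' ≤ m ξ + ⟪p, ξ' - ξ⟫
  have hA : ∀ ξ p s, Ct ξ p → SubG g ξ s → s = G ξ + p := by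
    intro ξ p s hc hs
    rw [← sub_eq_zero]
    apply vec_zero_of_quad _ C d₀ hd₀
    intro h hh
    have h1 := hs (ξ + h)
    have hk := hball ξ hc.1 h hh
    have h2 := hc.2 _ hk
    have h3 := hG ξ hc.1.1 _ hk
    simp only [add_sub_cancel_left, hm] at h1 h2 h3
    rw [inner_sub_left, inner_add_left]
    linarith
  have hSubC : ∀ ξ p, Ct ξ p → SubG g ξ (G ξ + p) := by
    intro ξ p hc
    obtain ⟨s, hs⟩ := hsub ξ
    rwa [← hA ξ p s hc hs]
  have hup : ∀ ξ p, Ct ξ p → ∀ ξ' ∈ 𝒦, g ξ' ≤ g ξ + ⟪G ξ + p, ξ' - ξ⟫ + C * ‖ξ' - ξ‖ ^ 2 := by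
    intro ξ p hc ξ' hk
    have h2 := hc.2 _ hk
    have h3 := hG ξ hc.1.1 _ hk
    simp only [hm] at h2
    rw [inner_add_left]
    linarith
  have hlow : ∀ ξ p, Ct ξ p → ∀ ξ' ∈ 𝒦, m ξ + ⟪p, ξ' - ξ⟫ - C * ‖ξ' - ξ‖ ^ 2 ≤ m ξ' := by
    intro ξ p hc ξ' hk
    have h2 := hSubC ξ p hc ξ'
    have h3 := hG ξ hc.1.1 _ hk
    simp only [hm]
    rw [inner_add_left] at h2
    linarith
  have hClip : ∀ ξ p, Ct ξ p → ∀ x s, SubG g x s → ‖x - ξ‖ ≤ d₀ / 2 →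
      ‖s - (G ξ + p)‖ ≤ 4 * C * ‖x - ξ‖ := by
    intro ξ p hc x s hs hx
    by_cases hx0 : x = ξ
    · subst hx0
      rw [hA x p s hc hs]; simp
    have hr : 0 < ‖x - ξ‖ := norm_pos_iff.2 (sub_ne_zero.2 hx0)
    apply norm_le_of_pair _ _ _ hr (by positivity)
    intro w hw
    have e : x + w = ξ + ((x - ξ) + w) := by abel
    have hn : ‖(x - ξ) + w‖ ≤ 2 * ‖x - ξ‖ := by
      calc _ ≤ ‖x - ξ‖ + ‖w‖ := norm_add_le _ _
        _ = _ := by rw [hw]; ring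
    have hk : x + w ∈ 𝒦 := by
      rw [e]; exact hball ξ hc.1 _ (by linarith)
    have h1 := hup ξ p hc _ hk
    have h2 := hs (x + w)
    have h3 := hSubC ξ p hc x
    have e2 : x + w - ξ = (x - ξ) + w := by abel
    rw [e2, inner_add_right] at h1
    rw [add_sub_cancel_left] at h2
    have h4 : ‖(x - ξ) + w‖ ^ 2 ≤ (2 * ‖x - ξ‖) ^ 2 := by gcongr
    have h5 := mul_le_mul_of_nonneg_left h4 hC
    rw [inner_sub_left]
    nlinarith
  set L₂ : ℝ := 2 * C + 2 * ρ / d₀ with hL₂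
  have hL₂0 : 0 ≤ L₂ := by positivity
  have hplip : ∀ ξ₁ p₁ ξ₂ p₂, Ct ξ₁ p₁ → Ct ξ₂ p₂ → ‖p₁‖ ≤ ρ → ‖p₂‖ ≤ ρ →
      ‖p₂ - p₁‖ ≤ L₂ * ‖ξ₂ - ξ₁‖ := by
    intro ξ₁ p₁ ξ₂ p₂ h₁ h₂ hp₁ hp₂
    by_cases h0 : ξ₂ = ξ₁
    · subst h0
      have a1 := hA _ _ _ h₁ (hSubC _ _ h₂)
      have : p₂ = p₁ := by simpa using a1
      simp [this]
    have hr : 0 < ‖ξ₂ - ξ₁‖ := norm_pos_iff.2 (sub_ne_zero.2 h0)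
    by_cases hbig : d₀ ≤ ‖ξ₂ - ξ₁‖
    · calc ‖p₂ - p₁‖ ≤ ‖p₂‖ + ‖p₁‖ := norm_sub_le _ _
        _ ≤ 2 * ρ / d₀ * d₀ := by rw [div_mul_cancel₀ _ hd₀.ne']; linarith
        _ ≤ 2 * ρ / d₀ * ‖ξ₂ - ξ₁‖ := by gcongr
        _ ≤ L₂ * ‖ξ₂ - ξ₁‖ := by
          rw [hL₂]; gcongr; linarith
    · push Not at hbig
      have : ‖p₂ - p₁‖ ≤ 2 * C * ‖ξ₂ - ξ₁‖ := by
        apply norm_le_of_pair _ _ _ hr (by positivity)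
        intro w hw
        have hk := hball ξ₂ h₂.1 w (by linarith)
        have i1 := hlow _ _ h₂ _ hk
        have i2 := h₁.2 _ hk
        have i3 := hlow _ _ h₁ _ h₂.1.1
        have e2 : ξ₂ + w - ξ₁ = (ξ₂ - ξ₁) + w := by abel
        rw [add_sub_cancel_left, hw] at i1
        rw [e2, inner_add_right] at i2
        rw [inner_sub_left]
        nlinarith
      refine this.trans ?_
      rw [hL₂]; gcongr
      have : 0 ≤ 2 * ρ / d₀ := by positivity
      linarith
  -- maximizers
  obtain ⟨R, hR⟩ := h𝒦.isBounded.subset_closedBall ξ₀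
  have hR0 : 0 ≤ R := by
    have := hR hξ₀
    simpa using this
  set ρ' := min ρ (κ / (R + 1)) with hρ'
  have hρ'0 : 0 < ρ' := by positivity
  have hmax : ∀ p, ‖p‖ < ρ' → ∃ ξ, Ct ξ p := by
    intro p hp
    obtain ⟨ξ, hξ, hmx⟩ := h𝒦.exists_isMaxOn ⟨ξ₀, hξ₀⟩
      (f := fun ξ => m ξ - ⟪p, ξ⟫) (hmc.sub (by fun_prop))
    have hc : ∀ ξ' ∈ 𝒦, m ξ' ≤ m ξ + ⟪p, ξ' - ξ⟫ := by
      intro ξ' hξ'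
      have := hmx hξ'
      simp only [mem_ofPred_eq] at this
      rw [inner_sub_right]; linarith
    refine ⟨ξ, ⟨hξ, ?_⟩, hc⟩
    have h1 := hc ξ₀ hξ₀
    have h2 : ⟪p, ξ₀ - ξ⟫ ≤ ρ' * R := by
      calc _ ≤ ‖p‖ * ‖ξ₀ - ξ‖ := real_inner_le_norm _ _
        _ ≤ ρ' * R := by
          gcongr
          have := hR hξ
          rw [Metric.mem_closedBall, dist_comm, dist_eq_norm] at this
          exact this
    have h3 : ρ' * R ≤ κ := by
      calc _ ≤ κ / (R + 1) * (R + 1) := by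
            gcongr
            · exact min_le_right _ _
            · linarith
        _ = κ := by field_simp
    linarith
  -- resolvent
  set Y : Set E := {y | ∃ x s, SubG g x s ∧ y = x + s} with hYdef
  have hJex : ∀ y, ∃ x, y ∈ Y → ∃ s, SubG g x s ∧ y = x + s := by
    intro y
    by_cases hy : y ∈ Y
    · obtain ⟨x, s, h⟩ := hy
      exact ⟨x, fun _ => ⟨s, h⟩⟩
    · exact ⟨0, fun h => absurd h hy⟩
  choose J hJ using hJex
  have hYm : ∀ x s, SubG g x s → x + s ∈ Y := fun x s h => ⟨x, s, h, rfl⟩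
  have hJe : ∀ x s, SubG g x s → J (x + s) = x := by
    intro x s h
    obtain ⟨s', hs', e⟩ := hJ (x + s) (hYm x s h)
    have := subG_mono hs' h
    rw [← e, sub_self, norm_zero] at this
    exact sub_eq_zero.1 (norm_le_zero_iff.1 this)
  have hJlip : LipschitzOnWith 1 J Y := by
    apply LipschitzOnWith.of_dist_le_mul
    rintro y ⟨x, s, h, rfl⟩ y' ⟨x', s', h', rfl⟩
    rw [hJe x s h, hJe x' s' h', dist_eq_norm, dist_eq_norm]
    simpa using subG_mono h h'
  -- contact values
  set S' : Set E := {y | ∃ ξ p, Ct ξ p ∧ ‖p‖ < ρ' ∧ y = ξ + (G ξ + p)} with hS'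
  have hPex : ∀ y, ∃ p, y ∈ S' → ∃ ξ, Ct ξ p ∧ ‖p‖ < ρ' ∧ y = ξ + (G ξ + p) := by
    intro y
    by_cases hy : y ∈ S'
    · obtain ⟨x, s, h⟩ := hy
      exact ⟨s, fun _ => ⟨x, h⟩⟩
    · exact ⟨0, fun h => absurd h hy⟩
  choose P hP using hPex
  have hPlip : LipschitzOnWith ⟨L₂, hL₂0⟩ P S' := by
    apply LipschitzOnWith.of_dist_le_mul
    intro y hy y' hy'
    obtain ⟨ξ, h1, h2, h3⟩ := hP y hy
    obtain ⟨ξ', h1', h2', h3'⟩ := hP y' hy'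
    have a := hplip _ _ _ _ h1' h1 (h2'.le.trans (min_le_left _ _)) (h2.le.trans (min_le_left _ _))
    have b := subG_mono (hSubC _ _ h1) (hSubC _ _ h1')
    rw [← h3, ← h3'] at b
    rw [dist_eq_norm, dist_eq_norm]
    calc _ ≤ L₂ * ‖ξ - ξ'‖ := a
      _ ≤ L₂ * ‖y - y'‖ := by gcongr
  have himg : Metric.ball (0:E) ρ' ⊆ P '' S' := by
    intro p hp
    rw [mem_ball_zero_iff] at hp
    obtain ⟨ξ, hξ⟩ := hmax p hp
    have hy : ξ + (G ξ + p) ∈ S' := ⟨ξ, p, hξ, hp, rfl⟩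
    refine ⟨_, hy, ?_⟩
    obtain ⟨ξ', h1, h2, h3⟩ := hP _ hy
    have b := subG_mono (hSubC _ _ h1) (hSubC _ _ hξ)
    rw [← h3, sub_self, norm_zero] at b
    have b' : ξ' = ξ := sub_eq_zero.1 (norm_le_zero_iff.1 b)
    rw [b'] at h3
    simpa using h3.symm
  have hex : ∃ y ∈ S', DifferentiableWithinAt ℝ J Y y := by
    let _ : MeasurableSpace E := borel E
    have _ : BorelSpace E := ⟨rfl⟩
    let μ : Measure E := Measure.hausdorffMeasure (Module.finrank ℝ E)
    have _ : μ.IsAddHaarMeasure := isAddHaarMeasure_hausdorffMeasure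
    by_contra hcon
    push Not at hcon
    have h1 : ∀ᵐ y ∂μ, y ∈ Y → DifferentiableWithinAt ℝ J Y y :=
      hJlip.ae_differentiableWithinAt_of_mem
    have h2 : μ S' = 0 := by
      refine measure_mono_null ?_ (ae_iff.1 h1)
      intro y hy
      obtain ⟨ξ, p, hc, -, rfl⟩ := id hy
      simp only [mem_ofPred_eq]
      intro hh
      exact hcon _ hy (hh (hYm _ _ (hSubC _ _ hc)))
    have h3 : μ (P '' S') = 0 := by
      have := hPlip.hausdorffMeasure_image_le (d := (Module.finrank ℝ E : ℝ)) (by positivity)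
      rw [show (Measure.hausdorffMeasure (Module.finrank ℝ E : ℝ) : Measure E) S' = 0 from h2,
        mul_zero] at this
      exact le_antisymm this bot_le
    have h4 : 0 < μ (Metric.ball (0:E) ρ') := Metric.measure_ball_pos μ _ hρ'0
    exact absurd (measure_mono_null himg h3) h4.ne'
  obtain ⟨y, ⟨ξ, p, hc, hp, rfl⟩, hdiff⟩ := hex
  refine ⟨ξ, hint ξ hc.1.1 hc.1.2, p, hp.le.trans (min_le_left _ _), hc.1.2, hc.2, ?_⟩
  exact expand_of_diff g hsub J Y hYm hJe ξ (G ξ + p) (hSubC _ _ hc) hdiff (4 * C) (d₀ / 2)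
    (by positivity) (by positivity) (fun x s h1 h2 => hClip ξ p hc x s h1 h2)

open Set Real RealInnerProductSpace MeasureTheory

/-- Jensen--Alexandrov applied to a sup-convolution. -/
theorem supconv_sums {E : Type*} [NormedAddCommGroup E] [InnerProductSpace ℝ E]
    [FiniteDimensional ℝ E] (W Φ : E → ℝ) (𝒞 : Set E) (h𝒞 : IsCompact 𝒞) (hW : ContinuousOn W 𝒞)
    (l : ℝ) (hl : 0 < l)
    (𝒦 : Set E) (h𝒦 : IsCompact 𝒦) (hΦ : ContinuousOn Φ 𝒦) (G : E → E) (C : ℝ) (hC : 0 ≤ C)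
    (hG : ∀ ξ ∈ 𝒦, ∀ ξ' ∈ 𝒦, Φ ξ' ≤ Φ ξ + ⟪G ξ, ξ' - ξ⟫ + C * ‖ξ' - ξ‖ ^ 2)
    (ξ₀ : E) (hξ₀ : ξ₀ ∈ 𝒦) (hξ₀' : ξ₀ ∈ 𝒞) (κ : ℝ) (hκ : 0 < κ)
    (hint : ∀ ξ ∈ 𝒦, ∀ Z ∈ 𝒞, W ξ₀ - Φ ξ₀ - κ ≤ W Z - l / 2 * ‖Z - ξ‖ ^ 2 - Φ ξ → ξ ∈ interior 𝒦)
    (ρ : ℝ) (hρ : 0 < ρ) :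
    ∃ ξ ∈ interior 𝒦, ∃ Z ∈ 𝒞, ∃ p, ∃ f : E → ℝ, ‖p‖ ≤ ρ ∧
      W ξ₀ - Φ ξ₀ - κ ≤ W Z - l / 2 * ‖Z - ξ‖ ^ 2 - Φ ξ ∧
      f ξ = W Z - l / 2 * ‖Z - ξ‖ ^ 2 ∧
      (∀ ξ', ∀ Z' ∈ 𝒞, W Z' - l / 2 * ‖Z' - ξ'‖ ^ 2 ≤ f ξ') ∧
      (∀ ξ', ∃ Z' ∈ 𝒞, f ξ' = W Z' - l / 2 * ‖Z' - ξ'‖ ^ 2) ∧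
      (∀ ξ' ∈ 𝒦, f ξ' - Φ ξ' ≤ f ξ - Φ ξ + ⟪p, ξ' - ξ⟫) ∧
      ∃ H : E →L[ℝ] E, (∀ a b, ⟪H a, b⟫ = ⟪a, H b⟫) ∧
      ∀ ε > 0, ∃ d > 0, ∀ h, ‖h‖ < d →
        |f (ξ + h) - f ξ - ⟪G ξ + p, h⟫ - 1 / 2 * ⟪H h, h⟫| ≤ ε * ‖h‖ ^ 2 := by
  have hmx : ∀ ξ, ∃ Z ∈ 𝒞, ∀ Z' ∈ 𝒞, W Z' - l / 2 * ‖Z' - ξ‖ ^ 2 ≤ W Z - l / 2 * ‖Z - ξ‖ ^ 2 := by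
    intro ξ
    obtain ⟨Z, hZ, hm⟩ := h𝒞.exists_isMaxOn ⟨ξ₀, hξ₀'⟩
      (f := fun Z => W Z - l / 2 * ‖Z - ξ‖ ^ 2) (hW.sub (by fun_prop))
    exact ⟨Z, hZ, fun Z' hZ' => hm hZ'⟩
  choose Zm hZm hZmax using hmx
  set f : E → ℝ := fun ξ => W (Zm ξ) - l / 2 * ‖Zm ξ - ξ‖ ^ 2 with hf
  set g : E → ℝ := fun ξ => f ξ + l / 2 * ‖ξ‖ ^ 2 with hgd
  have hsg : ∀ x, SubG g x (l • Zm x) := by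
    intro x z
    have h1 := hZmax z (Zm x) (hZm x)
    simp only [hgd, hf]
    rw [inner_smul_left, inner_sub_right]
    simp only [conj_trivial]
    have e1 := norm_sub_sq_real (Zm x) x
    have e2 := norm_sub_sq_real (Zm x) z
    rw [e1]
    rw [e2] at h1
    have e3 : l * (⟪Zm x, z⟫ - ⟪Zm x, x⟫) = l * ⟪Zm x, z⟫ - l * ⟪Zm x, x⟫ := by ring
    have e4 : l / 2 * ‖Zm z - z‖ ^ 2 = l / 2 * ‖Zm z - z‖ ^ 2 := rfl
    nlinarith
  obtain ⟨R, hR⟩ := h𝒞.isBounded.subset_closedBall (0:E)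
  have hR' : ∀ Z ∈ 𝒞, ‖Z‖ ≤ |R| := fun Z hZ => by
    have := hR hZ
    rw [mem_closedBall_zero_iff] at this
    exact this.trans (le_abs_self R)
  have hg : Continuous g := by
    have : LipschitzWith ⟨l * |R|, by positivity⟩ g := by
      apply LipschitzWith.of_le_add_mul
      intro x z
      have h1 := hsg x z
      have h2 : -⟪l • Zm x, z - x⟫ ≤ l * |R| * dist x z := by
        calc _ ≤ |⟪l • Zm x, z - x⟫| := neg_le_abs _
          _ ≤ ‖l • Zm x‖ * ‖z - x‖ := abs_real_inner_le_norm _ _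
          _ ≤ l * |R| * dist x z := by
            rw [norm_smul, Real.norm_of_nonneg hl.le, dist_comm, dist_eq_norm]
            gcongr
            exact hR' _ (hZm x)
      change g x ≤ g z + l * |R| * dist x z
      linarith
    exact this.continuous
  set Ψ : E → ℝ := fun ξ => Φ ξ + l / 2 * ‖ξ‖ ^ 2 with hΨ
  have hmeq : ∀ ξ, g ξ - Ψ ξ = f ξ - Φ ξ := by intro ξ; simp only [hgd, hΨ]; ring
  have hf0 : W ξ₀ ≤ f ξ₀ := by
    have := hZmax ξ₀ ξ₀ hξ₀'
    simpa using this
  obtain ⟨ξ, hξ, p, hp, h1, h2, H, hH, h3⟩ := jensen_alexandrov g Ψ hg (fun x => ⟨_, hsg x⟩) 𝒦 h𝒦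
    (hΦ.add (by fun_prop)) (fun ξ => G ξ + l • ξ) (C + l / 2) (by positivity) (by
      intro ξ hξ ξ' hξ'
      have h1 := hG ξ hξ ξ' hξ'
      simp only [hΨ]
      have e : ‖ξ'‖ ^ 2 = ‖ξ‖ ^ 2 + 2 * ⟪ξ, ξ' - ξ⟫ + ‖ξ' - ξ‖ ^ 2 := by
        rw [← norm_add_sq_real]; simp
      rw [inner_add_left, inner_smul_left, e]
      simp only [conj_trivial]
      nlinarith) ξ₀ hξ₀ κ hκ (by
      intro ξ hξ h
      rw [hmeq, hmeq] at h
      exact hint ξ hξ (Zm ξ) (hZm ξ) (by simp only [hf] at h hf0 ⊢; linarith)) ρ hρ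
  rw [hmeq, hmeq] at h1
  refine ⟨ξ, hξ, Zm ξ, hZm ξ, p, f, hp, by simp only [hf] at h1 hf0 ⊢; linarith, rfl,
    fun ξ' Z' hZ' => hZmax ξ' Z' hZ', fun ξ' => ⟨Zm ξ', hZm ξ', rfl⟩, ?_, ?_⟩
  · intro ξ' hξ'
    have := h2 ξ' hξ'
    rwa [hmeq, hmeq] at this
  refine ⟨H - l • ContinuousLinearMap.id ℝ E, ?_, ?_⟩
  · intro a b
    simp only [sub_apply, smul_apply, ContinuousLinearMap.id_apply, inner_sub_left, inner_sub_right,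
      inner_smul_left, inner_smul_right, hH, conj_trivial]
  intro ε hε
  obtain ⟨d, hd, h4⟩ := h3 ε hε
  refine ⟨d, hd, fun h hh => ?_⟩
  have h5 := h4 h hh
  convert h5 using 2
  simp only [hgd]
  rw [norm_add_sq_real]
  simp only [sub_apply, smul_apply, ContinuousLinearMap.id_apply, inner_sub_left, inner_add_left,
      inner_smul_left, conj_trivial, real_inner_self_eq_norm_sq]
  ring


/-- The gradient of the quartic test polynomial. -/
lemma hasGrad_test {n : ℕ} (c e C : ℝ) (q x : En n) (X : En n →L[ℝ] En n)
    (hX : ∀ a b, ⟪X a, b⟫ = ⟪a, X b⟫) (y : En n) :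
    HasGradientAt (fun y : En n => c + ⟪q, y - x⟫ + 1 / 2 * ⟪X (y - x), y - x⟫ + e * ‖y - x‖ ^ 2
      + C * (‖y - x‖ ^ 2) ^ 2)
      (q + X (y - x) + (2 * e) • (y - x) + (4 * C * ‖y - x‖ ^ 2) • (y - x)) y := by
  rw [hasGradientAt_iff_hasFDerivAt]
  have h0 : HasFDerivAt (fun y : En n => y - x) (ContinuousLinearMap.id ℝ (En n)) y :=
    (hasFDerivAt_id y).sub_const x
  have h1 := (hasFDerivAt_const q y).inner ℝ h0
  have h2 := ((X.hasFDerivAt.comp y h0).inner ℝ h0).const_mul (1 / 2 : ℝ)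
  have h3 := h0.norm_sq
  have h4 := h3.pow 2
  have := (((h1.const_add c).add h2).add (h3.const_mul e)).add (h4.const_mul C)
  refine this.congr_fderiv ?_
  ext v
  have hv : ⟪v, X (y - x)⟫ = ⟪X v, y - x⟫ := (hX v (y - x)).symm
  have hv' : ⟪X (y - x), v⟫ = ⟪X v, y - x⟫ := by rw [real_inner_comm]; exact hv
  have hv2 : ⟪v, y - x⟫ = ⟪y - x, v⟫ := real_inner_comm _ _
  simp only [add_apply, smul_apply, ContinuousLinearMap.comp_apply, fderivInnerCLM_apply, ContinuousLinearMap.prod_apply, innerSL_apply_apply, InnerProductSpace.toDual_apply_apply, inner_add_left, inner_smul_left,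
    ContinuousLinearMap.id_apply, zero_apply, inner_zero_left, smul_eq_mul, conj_trivial, hv', nsmul_eq_mul, Function.comp_apply]
  push_cast
  ring

lemma hasFDeriv_cubic {n : ℕ} (e C : ℝ) (q x : En n) (X : En n →L[ℝ] En n) :
    HasFDerivAt (fun y : En n => q + X (y - x) + (2 * e) • (y - x) + (4 * C * ‖y - x‖ ^ 2) • (y - x))
      (X + (2 * e) • ContinuousLinearMap.id ℝ (En n)) x := by
  have h0 : HasFDerivAt (fun y : En n => y - x) (ContinuousLinearMap.id ℝ (En n)) x :=
    (hasFDerivAt_id x).sub_const x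
  have h3 := (h0.norm_sq.const_mul (4 * C)).smul h0
  have hX1 : HasFDerivAt (fun y => X (y - x)) (X.comp (ContinuousLinearMap.id ℝ (En n))) x :=
    X.hasFDerivAt.comp x h0
  have := ((hX1.const_add q).add (h0.const_smul (2 * e))).add h3
  refine this.congr_fderiv ?_
  ext v
  simp

lemma opVal_add_id {n : ℕ} (γ p e : ℝ) (q : En n) (X : En n →L[ℝ] En n) (hq : q ≠ 0) :
    opVal γ p q (X + e • ContinuousLinearMap.id ℝ (En n))
      = opVal γ p q X + e * (‖q‖ ^ γ * (n + (p - 2))) := by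
  unfold opVal
  have hn : ‖q‖ ≠ 0 := norm_ne_zero_iff.2 hq
  have h1 : LinearMap.trace ℝ (En n) (X + e • ContinuousLinearMap.id ℝ (En n)).toLinearMap
      = LinearMap.trace ℝ (En n) X.toLinearMap + e * n := by
    simp
  rw [h1]
  simp only [add_apply, smul_apply, ContinuousLinearMap.id_apply, inner_add_left, inner_smul_left,
    conj_trivial, real_inner_self_eq_norm_sq]
  field_simp
  ring

lemma opVal_neg {n : ℕ} (γ p : ℝ) (q : En n) (X : En n →L[ℝ] En n) :
    opVal γ p (-q) (-X) = - opVal γ p q X := by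
  unfold opVal
  simp
  ring

/-- A (global) second order parabolic superjet. -/
def SupJet {n : ℕ} (U : En n × ℝ → ℝ) (Ω : Set (En n × ℝ)) (z : En n × ℝ) (a : ℝ) (q : En n)
    (X : En n →L[ℝ] En n) : Prop :=
  ∀ e > 0, ∃ C : ℝ, ∀ z' ∈ Ω, U z' ≤ U z + a * (z'.2 - z.2) + ⟪q, z'.1 - z.1⟫
    + 1 / 2 * ⟪X (z'.1 - z.1), z'.1 - z.1⟫ + e * ‖z'.1 - z.1‖ ^ 2 + C * (z'.2 - z.2) ^ 2
    + C * (‖z'.1 - z.1‖ ^ 2) ^ 2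

lemma test_props {n : ℕ} (U0 a e C : ℝ) (q : En n) (X : En n →L[ℝ] En n)
    (hX : ∀ a b, ⟪X a, b⟫ = ⟪a, X b⟫) (z : En n × ℝ) (φ : En n × ℝ → ℝ)
    (hφ : φ = fun z' => U0 + a * (z'.2 - z.2) + ⟪q, z'.1 - z.1⟫
    + 1 / 2 * ⟪X (z'.1 - z.1), z'.1 - z.1⟫ + e * ‖z'.1 - z.1‖ ^ 2 + C * (z'.2 - z.2) ^ 2
    + C * (‖z'.1 - z.1‖ ^ 2) ^ 2) :
    ContDiff ℝ 2 φ ∧ sGrad φ z.1 z.2 = q ∧ sHess φ z.1 z.2 = X + (2 * e) • ContinuousLinearMap.id ℝ (En n)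
      ∧ φ z = U0 ∧ deriv (fun s => φ (z.1, s)) z.2 = a := by
  have hgr : ∀ y, sGrad φ y z.2 = q + X (y - z.1) + (2 * e) • (y - z.1)
      + (4 * C * ‖y - z.1‖ ^ 2) • (y - z.1) := by
    intro y
    unfold sGrad
    rw [← (hasGrad_test U0 e C q z.1 X hX y).gradient]
    congr 1
    ext y
    simp [hφ]
  refine ⟨?_, ?_, ?_, ?_, ?_⟩
  · rw [hφ]
    have h1 : ContDiff ℝ 2 (fun z' : En n × ℝ => z'.1 - z.1) := contDiff_fst.sub contDiff_const
    have h2 : ContDiff ℝ 2 (fun z' : En n × ℝ => z'.2 - z.2) := contDiff_snd.sub contDiff_const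
    have h3 : ContDiff ℝ 2 (fun z' : En n × ℝ => ‖z'.1 - z.1‖ ^ 2) := h1.norm_sq ℝ
    have h4 : ContDiff ℝ 2 (fun z' : En n × ℝ => ⟪q, z'.1 - z.1⟫) := contDiff_const.inner ℝ h1
    have h5 : ContDiff ℝ 2 (fun z' : En n × ℝ => ⟪X (z'.1 - z.1), z'.1 - z.1⟫) :=
      (X.contDiff.comp h1).inner ℝ h1
    exact (((((contDiff_const.add (contDiff_const.mul h2)).add h4).add (contDiff_const.mul h5)).add
      (contDiff_const.mul h3)).add (contDiff_const.mul (h2.pow 2))).add (contDiff_const.mul (h3.pow 2))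
  · rw [hgr]; simp
  · unfold sHess
    rw [show (fun y => sGrad φ y z.2) = _ from funext hgr]
    exact (hasFDeriv_cubic e C q z.1 X).fderiv
  · simp [hφ]
  · have h0 : HasDerivAt (fun s : ℝ => s - z.2) 1 z.2 := (hasDerivAt_id z.2).sub_const z.2
    have h1 := ((h0.const_mul a).const_add U0).add ((h0.pow 2).const_mul C)
    have h2 : (fun s => φ (z.1, s)) = ((fun s => U0 + a * (s - z.2)) + (fun s => C * ((fun s => s - z.2)^2) s)) := by
      ext s
      simp [hφ]
    rw [h2, h1.deriv]
    simp

lemma lim_aux {A B c : ℝ} (h : ∀ e > 0, A - e * B ≤ c) : A ≤ c := by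
  refine le_of_forall_pos_le_add fun δ hδ => ?_
  have := h (δ / (|B| + 1)) (by positivity)
  have h2 : δ / (|B| + 1) * B ≤ δ := by
    calc _ ≤ δ / (|B| + 1) * (|B| + 1) := by gcongr; linarith [le_abs_self B]
      _ = δ := by field_simp
  linarith

lemma visc_sub {n : ℕ} {γ p : ℝ} {f U : En n × ℝ → ℝ} {Ω : Set (En n × ℝ)} (hU : IsSubsol γ p f U Ω)
    {z : En n × ℝ} (hz : z ∈ Ω) {a : ℝ} {q : En n} (hq : q ≠ 0) {X : En n →L[ℝ] En n}
    (hX : ∀ a b, ⟪X a, b⟫ = ⟪a, X b⟫) (hj : SupJet U Ω z a q X) :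
    a - opVal γ p q X ≤ f z := by
  apply lim_aux (B := 2 * (‖q‖ ^ γ * (n + (p - 2))))
  intro e he
  obtain ⟨C, hC⟩ := hj e he
  obtain ⟨h1, h2, h3, h4, h5⟩ := test_props (U z) a e C q X hX z _ rfl
  have := hU.1 z hz _ h1 (by rw [h2]; exact hq) h4 hC
  rw [h2, h3, h5, opVal_add_id _ _ _ _ _ hq] at this
  linarith

lemma visc_super {n : ℕ} {γ p : ℝ} {f U : En n × ℝ → ℝ} {Ω : Set (En n × ℝ)} (hU : IsSupersol γ p f U Ω)
    {z : En n × ℝ} (hz : z ∈ Ω) {a : ℝ} {q : En n} (hq : q ≠ 0) {X : En n →L[ℝ] En n}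
    (hX : ∀ a b, ⟪X a, b⟫ = ⟪a, X b⟫) (hj : SupJet (fun z => - U z) Ω z (-a) (-q) (-X)) :
    f z ≤ a - opVal γ p q X := by
  have : - (a - opVal γ p q X) ≤ - f z := by
    apply lim_aux (B := 2 * (‖q‖ ^ γ * (n + (p - 2))))
    intro e he
    obtain ⟨C, hC⟩ := hj e he
    obtain ⟨h1, h2, h3, h4, h5⟩ := test_props (U z) a (-e) (-C) q X hX z _ rfl
    have := hU.1 z hz _ h1 (by rw [h2]; exact hq) h4 (by
      intro z' hz'
      have := hC z' hz'
      simp only [neg_apply, inner_neg_left] at this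
      linarith)
    rw [h2, h3, h5, opVal_add_id _ _ _ _ _ hq] at this
    linarith
  linarith


/-- A pair as an element of the Hilbert sum. -/
def pr {F : Type*} (a b : F) : WithLp 2 (F × F) := WithLp.toLp 2 (a, b)

section pairs
variable {F : Type*} [NormedAddCommGroup F]

lemma pr_norm (a b : F) : ‖pr a b‖ ^ 2 = ‖a‖ ^ 2 + ‖b‖ ^ 2 := by
  simp [pr, WithLp.prod_norm_sq_eq_of_L2]
lemma pr_sub (a b c d : F) : pr a b - pr c d = pr (a - c) (b - d) := rfl
lemma pr_add (a b c d : F) : pr a b + pr c d = pr (a + c) (b + d) := rfl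
end pairs

section pairs2
variable {F : Type*} [NormedAddCommGroup F] [InnerProductSpace ℝ F]
lemma pr_inner (a b c d : F) : ⟪pr a b, pr c d⟫ = ⟪a, c⟫ + ⟪b, d⟫ := by
  simp [pr, WithLp.prod_inner_apply]
lemma pr_smul (a b : F) (c : ℝ) : c • pr a b = pr (c • a) (c • b) := rfl

lemma block_exists (H : WithLp 2 (F × F) →L[ℝ] WithLp 2 (F × F))
    (hH : ∀ a b, ⟪H a, b⟫ = ⟪a, H b⟫) :
    ∃ X Y : F →L[ℝ] F, (∀ a b, ⟪X a, b⟫ = ⟪a, X b⟫) ∧ (∀ a b, ⟪Y a, b⟫ = ⟪a, Y b⟫) ∧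
      (∀ a b, ⟪X a, b⟫ = ⟪H (pr a 0), pr b 0⟫) ∧ (∀ a b, ⟪Y a, b⟫ = - ⟪H (pr 0 a), pr 0 b⟫) := by
  let e := (WithLp.prodContinuousLinearEquiv 2 ℝ F F)
  let X : F →L[ℝ] F := (ContinuousLinearMap.fst ℝ F F).comp ((e : _ →L[ℝ] _).comp
    (H.comp ((e.symm : _ →L[ℝ] _).comp (ContinuousLinearMap.inl ℝ F F))))
  let Y : F →L[ℝ] F := - (ContinuousLinearMap.snd ℝ F F).comp ((e : _ →L[ℝ] _).comp
    (H.comp ((e.symm : _ →L[ℝ] _).comp (ContinuousLinearMap.inr ℝ F F))))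
  have hX : ∀ a b, ⟪X a, b⟫ = ⟪H (pr a 0), pr b 0⟫ := by
    intro a b
    have : X a = (H (pr a 0)).fst := rfl
    rw [this]
    have h2 : H (pr a 0) = pr (H (pr a 0)).fst (H (pr a 0)).snd := rfl
    conv_rhs => rw [h2, pr_inner]
    simp
  have hY : ∀ a b, ⟪Y a, b⟫ = - ⟪H (pr 0 a), pr 0 b⟫ := by
    intro a b
    have : Y a = - (H (pr 0 a)).snd := rfl
    rw [this]
    have h2 : H (pr 0 a) = pr (H (pr 0 a)).fst (H (pr 0 a)).snd := rfl
    conv_rhs => rw [h2, pr_inner]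
    simp
  refine ⟨X, Y, ?_, ?_, hX, hY⟩
  · intro a b
    rw [hX, hH, real_inner_comm, ← hX, real_inner_comm]
  · intro a b
    rw [hY, hH, real_inner_comm, ← hY, real_inner_comm]

/-- Doubling of variables. -/
theorem doubling [FiniteDimensional ℝ F] (w : F → ℝ) (Φ : F × F → ℝ) (C₁ : Set F)
    (hC₁ : IsCompact C₁) (hw : ContinuousOn w C₁) (l : ℝ) (hl : 0 < l)
    (𝒦 : Set (F × F)) (h𝒦 : IsCompact 𝒦) (hΦ : ContinuousOn Φ 𝒦) (G₁ G₂ : F × F → F) (C : ℝ)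
    (hC : 0 ≤ C)
    (hG : ∀ ξ ∈ 𝒦, ∀ ξ' ∈ 𝒦, Φ ξ' ≤ Φ ξ + ⟪G₁ ξ, ξ'.1 - ξ.1⟫ + ⟪G₂ ξ, ξ'.2 - ξ.2⟫
      + C * (‖ξ'.1 - ξ.1‖ ^ 2 + ‖ξ'.2 - ξ.2‖ ^ 2))
    (ξ₀ : F × F) (hξ₀ : ξ₀ ∈ 𝒦) (hξ₀1 : ξ₀.1 ∈ C₁) (hξ₀2 : ξ₀.2 ∈ C₁) (κ : ℝ) (hκ : 0 < κ)
    (hint : ∀ ξ ∈ 𝒦, ∀ Z₁ ∈ C₁, ∀ Z₂ ∈ C₁, w ξ₀.1 - w ξ₀.2 - Φ ξ₀ - κ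
      ≤ w Z₁ - w Z₂ - l / 2 * (‖Z₁ - ξ.1‖ ^ 2 + ‖Z₂ - ξ.2‖ ^ 2) - Φ ξ → ξ ∈ interior 𝒦)
    (ρ : ℝ) (hρ : 0 < ρ) :
    ∃ ξ ∈ 𝒦, ∃ Z₁ ∈ C₁, ∃ Z₂ ∈ C₁, ∃ P₁ P₂ : F, ∃ X Y : F →L[ℝ] F,
      w ξ₀.1 - w ξ₀.2 - Φ ξ₀ - κ
        ≤ w Z₁ - w Z₂ - l / 2 * (‖Z₁ - ξ.1‖ ^ 2 + ‖Z₂ - ξ.2‖ ^ 2) - Φ ξ ∧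
      ‖P₁ - G₁ ξ‖ ≤ ρ ∧ ‖P₂ + G₂ ξ‖ ≤ ρ ∧
      (∀ a b, ⟪X a, b⟫ = ⟪a, X b⟫) ∧ (∀ a b, ⟪Y a, b⟫ = ⟪a, Y b⟫) ∧
      (∀ ε > 0, ∃ d > 0, ∀ h, ‖h‖ < d → Z₁ + h ∈ C₁ →
        w (Z₁ + h) ≤ w Z₁ + ⟪P₁, h⟫ + 1 / 2 * ⟪X h, h⟫ + ε * ‖h‖ ^ 2) ∧
      (∀ ε > 0, ∃ d > 0, ∀ h, ‖h‖ < d → Z₂ + h ∈ C₁ →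
        w Z₂ + ⟪P₂, h⟫ + 1 / 2 * ⟪Y h, h⟫ - ε * ‖h‖ ^ 2 ≤ w (Z₂ + h)) ∧
      (∀ h₁ h₂ : F, ∀ c : ℝ, (∃ d > 0, ∀ t : ℝ, 0 < t → t < d →
        Φ (ξ.1 + t • h₁, ξ.2 + t • h₂) + Φ (ξ.1 - t • h₁, ξ.2 - t • h₂) - 2 * Φ ξ ≤ c * t ^ 2) →
        ⟪X h₁, h₁⟫ - ⟪Y h₂, h₂⟫ ≤ c) := by
  have hcont : Continuous (fun ξ : WithLp 2 (F × F) => ξ.ofLp) := WithLp.prod_continuous_ofLp 2 F F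
  have hcont' : Continuous (fun ξ : F × F => WithLp.toLp 2 ξ) := WithLp.prod_continuous_toLp 2 F F
  set 𝒞' : Set (WithLp 2 (F × F)) := (fun ξ : F × F => WithLp.toLp 2 ξ) '' (C₁ ×ˢ C₁) with h𝒞'
  set 𝒦' : Set (WithLp 2 (F × F)) := (fun ξ : WithLp 2 (F × F) => ξ.ofLp) ⁻¹' 𝒦 with h𝒦'
  have hcK : IsCompact 𝒦' := by
    have : 𝒦' = (fun ξ : F × F => WithLp.toLp 2 ξ) '' 𝒦 := by
      ext ξ
      constructor
      · intro h; exact ⟨ξ.ofLp, h, rfl⟩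
      · rintro ⟨a, ha, rfl⟩; exact ha
    rw [this]
    exact h𝒦.image hcont'
  have hcC : IsCompact 𝒞' := (hC₁.prod hC₁).image hcont'
  have hmem : ∀ {a b}, a ∈ C₁ → b ∈ C₁ → pr a b ∈ 𝒞' := fun {a b} ha hb => ⟨(a, b), ⟨ha, hb⟩, rfl⟩
  obtain ⟨ξ, hξ, Z, hZ, p, f, hp, h1, h2, h3, h4, h5, H, hH, h6⟩ :=
    supconv_sums (fun ξ : WithLp 2 (F × F) => w ξ.fst - w ξ.snd) (fun ξ => Φ ξ.ofLp) 𝒞' hcC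
      (by
        apply ContinuousOn.sub
        · refine hw.comp (continuous_fst.comp hcont).continuousOn ?_
          rintro _ ⟨a, ha, rfl⟩; exact ha.1
        · refine hw.comp (continuous_snd.comp hcont).continuousOn ?_
          rintro _ ⟨a, ha, rfl⟩; exact ha.2) l hl 𝒦' hcK
      (hΦ.comp hcont.continuousOn (fun _ h => h)) (fun ξ => pr (G₁ ξ.ofLp) (G₂ ξ.ofLp)) C hC
      (by
        intro ξ hξ ξ' hξ'
        have := hG _ hξ _ hξ'
        have e1 : ξ' - ξ = pr (ξ'.fst - ξ.fst) (ξ'.snd - ξ.snd) := rfl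
        rw [e1, pr_inner, pr_norm]
        have e2 : ξ.ofLp.1 = ξ.fst := rfl
        have e3 : ξ.ofLp.2 = ξ.snd := rfl
        have e4 : ξ'.ofLp.1 = ξ'.fst := rfl
        have e5 : ξ'.ofLp.2 = ξ'.snd := rfl
        rw [e2, e3, e4, e5] at this
        linarith) (WithLp.toLp 2 ξ₀) hξ₀ (hmem hξ₀1 hξ₀2) κ hκ
      (by
        rintro ξ hξ _ ⟨⟨a, b⟩, ⟨ha, hb⟩, rfl⟩ h
        apply preimage_interior_subset_interior_preimage hcont
        refine hint ξ.ofLp hξ a ha b hb ?_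
        have e1 : (WithLp.toLp 2 (a, b) : WithLp 2 (F × F)) - ξ = pr (a - ξ.fst) (b - ξ.snd) := rfl
        simp only [e1, pr_norm] at h
        exact h) ρ hρ
  obtain ⟨⟨Z₁, Z₂⟩, ⟨hZ₁, hZ₂⟩, rfl⟩ := hZ
  obtain ⟨X, Y, hXs, hYs, hX, hY⟩ := block_exists H hH
  have hξe : ξ = pr ξ.fst ξ.snd := rfl
  have hpe : p = pr p.fst p.snd := rfl
  have e1 : (WithLp.toLp 2 (Z₁, Z₂) : WithLp 2 (F × F)) - ξ = pr (Z₁ - ξ.fst) (Z₂ - ξ.snd) := rfl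
  simp only [e1, pr_norm] at h1 h2
  replace h2 : f ξ = w Z₁ - w Z₂ - l / 2 * (‖Z₁ - ξ.fst‖ ^ 2 + ‖Z₂ - ξ.snd‖ ^ 2) := h2
  have hpn : ‖p.fst‖ ^ 2 + ‖p.snd‖ ^ 2 ≤ ρ ^ 2 := by
    rw [← pr_norm, ← hpe]; gcongr
  have hsup : ∀ a b a' b' : F, a' ∈ C₁ → b' ∈ C₁ →
      w a' - w b' - l / 2 * (‖a' - a‖ ^ 2 + ‖b' - b‖ ^ 2) ≤ f (pr a b) := by
    intro a b a' b' ha hb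
    have := h3 (pr a b) (pr a' b') (hmem ha hb)
    rw [pr_sub, pr_norm] at this
    exact this
  have hatt : ∀ a b : F, ∃ a' ∈ C₁, ∃ b' ∈ C₁,
      f (pr a b) = w a' - w b' - l / 2 * (‖a' - a‖ ^ 2 + ‖b' - b‖ ^ 2) := by
    intro a b
    obtain ⟨_, ⟨⟨a', b'⟩, ⟨ha, hb⟩, rfl⟩, h⟩ := h4 (pr a b)
    refine ⟨a', ha, b', hb, ?_⟩
    have e1 : (WithLp.toLp 2 (a', b') : WithLp 2 (F × F)) - pr a b = pr (a' - a) (b' - b) := rfl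
    simp only [e1, pr_norm] at h
    exact h
  refine ⟨ξ.ofLp, (interior_subset hξ : ξ ∈ 𝒦'), Z₁, hZ₁, Z₂, hZ₂, G₁ ξ.ofLp + p.fst, - (G₂ ξ.ofLp + p.snd),
    X, Y, h1, ?_, ?_, hXs, hYs, ?_, ?_, ?_⟩
  · rw [add_sub_cancel_left]
    exact abs_le_of_sq_le_sq' (by nlinarith [sq_nonneg ‖p.snd‖]) hρ.le |>.2
  · rw [show -(G₂ ξ.ofLp + p.snd) + G₂ ξ.ofLp = -p.snd by abel, norm_neg]
    exact abs_le_of_sq_le_sq' (by nlinarith [sq_nonneg ‖p.fst‖]) hρ.le |>.2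
  · intro ε hε
    obtain ⟨d, hd, h7⟩ := h6 ε hε
    refine ⟨d, hd, fun h hh hc => ?_⟩
    have hn : ‖pr h (0:F)‖ ^ 2 = ‖h‖ ^ 2 := by rw [pr_norm]; simp
    have hn' : ‖pr h (0:F)‖ = ‖h‖ := (sq_eq_sq₀ (norm_nonneg _) (norm_nonneg _)).1 hn
    have h8 := (abs_le.1 (h7 (pr h 0) (by rw [hn']; exact hh))).2
    rw [hn, ← hX] at h8
    have h9 := hsup (ξ.fst + h) (ξ.snd + 0) (Z₁ + h) Z₂ hc hZ₂
    rw [← pr_add, ← hξe] at h9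
    have h10 : ⟪pr (G₁ ξ.ofLp) (G₂ ξ.ofLp) + p, pr h 0⟫ = ⟪G₁ ξ.ofLp + p.fst, h⟫ := by
      conv_lhs => rw [hpe, pr_add, pr_inner]
      simp
    rw [h10] at h8
    have e : Z₁ + h - (ξ.fst + h) = Z₁ - ξ.fst := by abel
    rw [e, add_zero] at h9
    linarith
  · intro ε hε
    obtain ⟨d, hd, h7⟩ := h6 ε hε
    refine ⟨d, hd, fun h hh hc => ?_⟩
    have hn : ‖pr (0:F) h‖ ^ 2 = ‖h‖ ^ 2 := by rw [pr_norm]; simp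
    have hn' : ‖pr (0:F) h‖ = ‖h‖ := (sq_eq_sq₀ (norm_nonneg _) (norm_nonneg _)).1 hn
    have h8 := (abs_le.1 (h7 (pr 0 h) (by rw [hn']; exact hh))).2
    rw [hn] at h8
    have h11 := hY h h
    have h9 := hsup (ξ.fst + 0) (ξ.snd + h) Z₁ (Z₂ + h) hZ₁ hc
    rw [← pr_add, ← hξe] at h9
    have h10 : ⟪pr (G₁ ξ.ofLp) (G₂ ξ.ofLp) + p, pr 0 h⟫ = ⟪G₂ ξ.ofLp + p.snd, h⟫ := by
      conv_lhs => rw [hpe, pr_add, pr_inner]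
      simp
    rw [h10] at h8
    have e : Z₂ + h - (ξ.snd + h) = Z₂ - ξ.snd := by abel
    rw [e, add_zero] at h9
    rw [inner_neg_left]
    linarith
  · intro k₁ k₂ c ⟨d, hd, hc⟩
    have hsep : ∀ h₁ h₂ : F, f (ξ + pr h₁ 0) + f (ξ + pr 0 h₂) ≤ f (ξ + pr h₁ h₂) + f ξ := by
      intro h₁ h₂
      conv_lhs => rw [hξe, pr_add, pr_add]
      conv_rhs => rw [hξe, pr_add]
      obtain ⟨a, ha, b, hb, h7⟩ := hatt (ξ.fst + h₁) (ξ.snd + 0)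
      obtain ⟨a', ha', b', hb', h8⟩ := hatt (ξ.fst + 0) (ξ.snd + h₂)
      have h9 := hsup (ξ.fst + h₁) (ξ.snd + h₂) a b' ha hb'
      have h10 := hsup (ξ.fst) (ξ.snd) a' b ha' hb
      rw [h7, h8]
      simp only [add_zero]
      linarith
    refine le_of_forall_pos_le_add fun δ hδ => ?_
    set N := 2 * (‖k₁‖ ^ 2 + ‖k₂‖ ^ 2) + 1 with hN
    have hN0 : 0 < N := by positivity
    obtain ⟨d₂, hd₂, h7⟩ := h6 (δ / N) (by positivity)
    have hev : ∀ᶠ t : ℝ in nhds 0, ‖t • pr k₁ k₂‖ < d₂ ∧ ‖t • pr k₁ (0:F)‖ < d₂ ∧ ‖t • pr 0 k₂‖ < d₂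
        ∧ ξ + t • pr k₁ k₂ ∈ 𝒦' ∧ ξ + (-t) • pr k₁ k₂ ∈ 𝒦' ∧ t < d := by
      have aux : ∀ v : WithLp 2 (F × F), ∀ᶠ t : ℝ in nhds 0, ‖t • v‖ < d₂ := by
        intro v
        have : Continuous (fun t : ℝ => ‖t • v‖) := by fun_prop
        apply this.continuousAt.eventually (gt_mem_nhds _ |> fun h => h)
        simpa using hd₂
      have aux2 : ∀ s : ℝ, ∀ᶠ t : ℝ in nhds 0, ξ + (s * t) • pr k₁ k₂ ∈ 𝒦' := by
        intro s
        have : Continuous (fun t : ℝ => ξ + (s * t) • pr k₁ k₂) := by fun_prop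
        apply this.continuousAt.eventually (mem_interior_iff_mem_nhds.1 _)
        simpa using hξ
      filter_upwards [aux (pr k₁ k₂), aux (pr k₁ 0), aux (pr 0 k₂), aux2 1, aux2 (-1), gt_mem_nhds hd]
        with t a1 a2 a3 a4 a5 a6
      refine ⟨a1, a2, a3, by simpa using a4, by simpa using a5, a6⟩
    obtain ⟨t, ht, ht0⟩ := ((hev.filter_mono nhdsWithin_le_nhds).and
      (self_mem_nhdsWithin : Ioi (0:ℝ) ∈ nhdsWithin 0 (Ioi 0))).exists
    obtain ⟨t1, t2, t3, t4, t5, t6⟩ := ht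
    have ht0' : 0 < t := ht0
    have hcc := hc t ht0' t6
    have m1 := h5 _ t4
    have m2 := h5 _ t5
    have s1 := hsep (t • k₁) (t • k₂)
    have s2 := hsep (-(t • k₁)) (-(t • k₂))
    have b1 := (abs_le.1 (h7 (t • pr k₁ 0) t2)).1
    have b2 := (abs_le.1 (h7 (-(t • pr k₁ 0)) (by rwa [norm_neg]))).1
    have b3 := (abs_le.1 (h7 (t • pr 0 k₂) t3)).1
    have b4 := (abs_le.1 (h7 (-(t • pr 0 k₂)) (by rwa [norm_neg]))).1
    simp only [norm_neg, map_neg, inner_neg_left, inner_neg_right, map_smul, inner_smul_left,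
      inner_smul_right, conj_trivial, norm_smul, mul_pow, pr_norm, ← hX, sq_abs, norm_eq_abs, norm_zero] at b1 b2 b3 b4
    have g1 : ξ + pr (t • k₁) 0 = ξ + t • pr k₁ 0 := by rw [pr_smul, smul_zero]
    have g2 : ξ + pr (-(t • k₁)) 0 = ξ + -(t • pr k₁ 0) := by
      rw [pr_smul, smul_zero]; congr 1; simp [pr, ← WithLp.toLp_neg]
    have g3 : ξ + pr 0 (t • k₂) = ξ + t • pr 0 k₂ := by rw [pr_smul, smul_zero]
    have g4 : ξ + pr 0 (-(t • k₂)) = ξ + -(t • pr 0 k₂) := by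
      rw [pr_smul, smul_zero]; congr 1; simp [pr, ← WithLp.toLp_neg]
    have g5 : ξ + pr (t • k₁) (t • k₂) = ξ + t • pr k₁ k₂ := rfl
    have g6 : ξ + pr (-(t • k₁)) (-(t • k₂)) = ξ + (-t) • pr k₁ k₂ := by
      rw [pr_smul, neg_smul, neg_smul]
    rw [g1, g3, g5] at s1
    rw [g2, g4, g6] at s2
    have f1 : (ξ + t • pr k₁ k₂).ofLp = (ξ.ofLp.1 + t • k₁, ξ.ofLp.2 + t • k₂) := rfl
    have f2 : (ξ + (-t) • pr k₁ k₂).ofLp = (ξ.ofLp.1 - t • k₁, ξ.ofLp.2 - t • k₂) := by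
      rw [sub_eq_add_neg, sub_eq_add_neg, ← neg_smul, ← neg_smul]; rfl
    rw [f1, add_sub_cancel_left] at m1
    rw [f2, add_sub_cancel_left] at m2
    simp only [inner_smul_right] at m1 m2
    have hYY := hY k₂ k₂
    have hlin : t ^ 2 * (⟪X k₁, k₁⟫ - ⟪Y k₂, k₂⟫)
        ≤ t ^ 2 * (c + δ / N * (2 * (‖k₁‖ ^ 2 + ‖k₂‖ ^ 2))) := by
      rw [hYY]
      clear_value N
      clear hsup hatt h7 h6 h5 h4 h3 hc hev hint hsep hH hX hY hXs hYs hG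
      linarith
    have := le_of_mul_le_mul_left hlin (by positivity)
    have hlast : δ / N * (2 * (‖k₁‖ ^ 2 + ‖k₂‖ ^ 2)) ≤ δ := by
      calc _ ≤ δ / N * N := by gcongr; rw [hN]; linarith
        _ = δ := div_mul_cancel₀ _ hN0.ne'
    linarith

end pairs2


/-- Space-time with its Hilbert structure. -/
abbrev SpT (n : ℕ) : Type := WithLp 2 (En n × ℝ)

/-- A space-time point. -/
def st {n : ℕ} (x : En n) (t : ℝ) : SpT n := WithLp.toLp 2 (x, t)

lemma st_inner {n : ℕ} (a b : En n) (s t : ℝ) : ⟪st a s, st b t⟫ = ⟪a, b⟫ + s * t := by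
  simp [st, WithLp.prod_inner_apply, mul_comm]
lemma st_norm {n : ℕ} (a : En n) (t : ℝ) : ‖st a t‖ ^ 2 = ‖a‖ ^ 2 + t ^ 2 := by
  simp [st, WithLp.prod_norm_sq_eq_of_L2]
lemma st_fst_le {n : ℕ} (z : SpT n) : ‖z.fst‖ ≤ ‖z‖ := by
  have h : ‖z‖ ^ 2 = ‖z.fst‖ ^ 2 + z.snd ^ 2 := st_norm z.fst z.snd
  exact abs_le_of_sq_le_sq' (by nlinarith [sq_nonneg z.snd]) (norm_nonneg _) |>.2
lemma st_snd_le {n : ℕ} (z : SpT n) : |z.snd| ≤ ‖z‖ := by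
  have h : ‖z‖ ^ 2 = ‖z.fst‖ ^ 2 + z.snd ^ 2 := st_norm z.fst z.snd
  exact abs_le_of_sq_le_sq (by nlinarith [sq_nonneg ‖z.fst‖]) (norm_nonneg _)

lemma sblk_exists {n : ℕ} (X : SpT n →L[ℝ] SpT n) (hX : ∀ a b, ⟪X a, b⟫ = ⟪a, X b⟫) :
    ∃ S : En n →L[ℝ] En n, (∀ a b, ⟪S a, b⟫ = ⟪a, S b⟫) ∧
      ∀ a b, ⟪S a, b⟫ = ⟪X (st a 0), st b 0⟫ := by
  let e := (WithLp.prodContinuousLinearEquiv 2 ℝ (En n) ℝ)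
  let S : En n →L[ℝ] En n := (ContinuousLinearMap.fst ℝ (En n) ℝ).comp ((e : _ →L[ℝ] _).comp
    (X.comp ((e.symm : _ →L[ℝ] _).comp (ContinuousLinearMap.inl ℝ (En n) ℝ))))
  have hS : ∀ a b, ⟪S a, b⟫ = ⟪X (st a 0), st b 0⟫ := by
    intro a b
    have : S a = (X (st a 0)).fst := rfl
    rw [this]
    have h2 : X (st a 0) = st (X (st a 0)).fst (X (st a 0)).snd := rfl
    conv_rhs => rw [h2, st_inner]
    simp
  refine ⟨S, ?_, hS⟩
  intro a b
  rw [hS, hX, real_inner_comm, ← hS, real_inner_comm]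

/-- A local second order jet in space-time yields a global parabolic jet. -/
lemma jet_of_local {n : ℕ} {w : En n × ℝ → ℝ} {Ω : Set (En n × ℝ)} {η : ℝ}
    (hb : ∀ z ∈ Ω, |w z| ≤ η) (C₁ : Set (SpT n)) (Z : SpT n) (hZ : C₁ ∈ nhds Z) (hZΩ : Z.ofLp ∈ Ω)
    (P : SpT n) (X : SpT n →L[ℝ] SpT n) (hX : ∀ a b, ⟪X a, b⟫ = ⟪a, X b⟫)
    (hj : ∀ ε > 0, ∃ d > 0, ∀ h, ‖h‖ < d → Z + h ∈ C₁ →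
        w (Z + h).ofLp ≤ w Z.ofLp + ⟪P, h⟫ + 1 / 2 * ⟪X h, h⟫ + ε * ‖h‖ ^ 2)
    (S : En n →L[ℝ] En n) (hS : ∀ a b, ⟪S a, b⟫ = ⟪X (st a 0), st b 0⟫) (K : En n) :
    SupJet (fun z => w z + ⟪K, z.1⟫) Ω Z.ofLp P.snd (K + P.fst) S := by
  intro e he
  obtain ⟨d₁, hd₁, h1⟩ := hj (e / 2) (by positivity)
  obtain ⟨d₂, hd₂, h2⟩ := Metric.mem_nhds_iff.1 hZ
  set d := min d₁ d₂ with hd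
  have hd0 : 0 < d := lt_min hd₁ hd₂
  set L := ‖X‖ with hL
  have hL0 : 0 ≤ L := norm_nonneg _
  obtain ⟨c₁, hc₁⟩ : ∃ c₁ : ℝ, c₁ = L ^ 2 / (2 * e) + L / 2 + e / 2 := ⟨_, rfl⟩
  have hc₁0 : 0 ≤ c₁ := by rw [hc₁]; positivity
  have hη : 0 ≤ η := (abs_nonneg _).trans (hb _ hZΩ)
  obtain ⟨m, hm⟩ : ∃ m : ℝ, m = min (d ^ 2 / 2) (d ^ 4 / 4) := ⟨_, rfl⟩
  have hm0 : 0 < m := by rw [hm]; positivity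
  obtain ⟨c₀, hc₀⟩ : ∃ c₀ : ℝ, c₀ = 2 * η + P.snd ^ 2 + ‖P.fst‖ ^ 2 + L + 1 := ⟨_, rfl⟩
  have hc₀0 : 0 ≤ c₀ := by rw [hc₀]; positivity
  obtain ⟨C, hC⟩ : ∃ C : ℝ, C = c₁ + c₀ / m + (2 + L) := ⟨_, rfl⟩
  have hC0 : 0 ≤ C := by rw [hC]; positivity
  refine ⟨C, fun z' hz' => ?_⟩
  have eZ1 : Z.ofLp.1 = Z.fst := rfl
  have eZ2 : Z.ofLp.2 = Z.snd := rfl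
  rw [eZ1, eZ2]
  set a := z'.1 - Z.fst with ha
  set k := z'.2 - Z.snd with hk
  have hh : ‖st a k‖ ^ 2 = ‖a‖ ^ 2 + k ^ 2 := st_norm a k
  have eK : ⟪K, z'.1⟫ = ⟪K, Z.fst⟫ + ⟪K, a⟫ := by rw [← inner_add_right]; simp [ha]
  have hSb : |⟪S a, a⟫| ≤ L * ‖a‖ ^ 2 := by
    rw [hS]
    have n1 : ‖st a 0‖ ^ 2 = ‖a‖ ^ 2 := by rw [st_norm]; ring
    calc |⟪X (st a 0), st a 0⟫| ≤ ‖X (st a 0)‖ * ‖st a 0‖ := abs_real_inner_le_norm _ _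
      _ ≤ (L * ‖st a 0‖) * ‖st a 0‖ := by gcongr; exact X.le_opNorm _
      _ = L * ‖a‖ ^ 2 := by rw [← n1]; ring
  simp only [eK, eZ1, inner_add_left]
  by_cases hcase : ‖st a k‖ < d
  · have h3 := h1 (st a k) (hcase.trans_le (min_le_left _ _)) (h2 (by
      rw [Metric.mem_ball, dist_eq_norm, add_sub_cancel_left]
      exact hcase.trans_le (min_le_right _ _)))
    have e1 : (Z + st a k).ofLp = z' := by
      have : (Z + st a k).ofLp = (Z.fst + a, Z.snd + k) := rfl
      rw [this]; ext <;> simp [ha, hk]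
    rw [e1, hh] at h3
    have e2 : ⟪P, st a k⟫ = ⟪P.fst, a⟫ + P.snd * k := st_inner P.fst a P.snd k
    have e3 : st a k = st a 0 + st 0 k := by
      have : st a 0 + st 0 k = st (a + 0) (0 + k) := rfl
      rw [this]; simp
    have e4 : ⟪X (st a k), st a k⟫ = ⟪S a, a⟫ + 2 * ⟪X (st a 0), st 0 k⟫ + ⟪X (st 0 k), st 0 k⟫ := by
      rw [hS, e3, map_add, inner_add_left, inner_add_right, inner_add_right,
        hX (st 0 k) (st a 0), real_inner_comm (X (st a 0))]
      ring
    have n1 : ‖st a 0‖ = ‖a‖ := by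
      apply (sq_eq_sq₀ (norm_nonneg _) (norm_nonneg _)).1; rw [st_norm]; ring
    have n2 : ‖st (0 : En n) k‖ = |k| := by
      apply (sq_eq_sq₀ (norm_nonneg _) (abs_nonneg _)).1; rw [st_norm]; simp
    have b1 : ⟪X (st a 0), st 0 k⟫ ≤ L * ‖a‖ * |k| := by
      calc ⟪X (st a 0), st 0 k⟫ ≤ ‖X (st a 0)‖ * ‖st (0 : En n) k‖ := real_inner_le_norm _ _
        _ ≤ (L * ‖st a 0‖) * ‖st (0 : En n) k‖ := by gcongr; exact X.le_opNorm _
        _ = L * ‖a‖ * |k| := by rw [n1, n2]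
    have b2 : ⟪X (st 0 k), st 0 k⟫ ≤ L * k ^ 2 := by
      calc ⟪X (st 0 k), st 0 k⟫ ≤ ‖X (st 0 k)‖ * ‖st (0 : En n) k‖ := real_inner_le_norm _ _
        _ ≤ (L * ‖st (0 : En n) k‖) * ‖st (0 : En n) k‖ := by gcongr; exact X.le_opNorm _
        _ = L * k ^ 2 := by rw [n2, ← sq_abs k]; ring
    have b3 : L * ‖a‖ * |k| ≤ e / 2 * ‖a‖ ^ 2 + L ^ 2 / (2 * e) * k ^ 2 := by
      have : e / 2 * ‖a‖ ^ 2 + L ^ 2 / (2 * e) * k ^ 2 - L * ‖a‖ * |k|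
          = (e * ‖a‖ - L * |k|) ^ 2 / (2 * e) := by
        rw [← sq_abs k]; field_simp; ring
      have h0 : 0 ≤ (e * ‖a‖ - L * |k|) ^ 2 / (2 * e) := by positivity
      linarith
    rw [e2, e4] at h3
    have hCc : c₁ * k ^ 2 ≤ C * k ^ 2 := by
      gcongr
      have : 0 ≤ c₀ / m := by positivity
      rw [hC]
      linarith
    have hC4 : 0 ≤ C * (‖a‖ ^ 2) ^ 2 := by positivity
    have hc₁k : c₁ * k ^ 2 = L ^ 2 / (2 * e) * k ^ 2 + L / 2 * k ^ 2 + e / 2 * k ^ 2 := by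
      rw [hc₁]; ring
    linarith
  · push Not at hcase
    set s := ‖a‖ ^ 2 with hs
    have hs0 : 0 ≤ s := by positivity
    have hds : d ^ 2 ≤ s + k ^ 2 := by rw [← hh]; gcongr
    have hmk : m ≤ k ^ 2 + s ^ 2 := by
      rcases le_total (d ^ 2 / 2) (k ^ 2) with h | h
      · exact hm.le.trans <| (min_le_left _ _).trans (by nlinarith)
      · refine hm.le.trans <| (min_le_right _ _).trans ?_
        have : d ^ 2 / 2 ≤ s := by linarith
        have h5 : (d ^ 2 / 2) ^ 2 ≤ s ^ 2 := by gcongr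
        nlinarith [sq_nonneg k]
    have hcm : c₀ ≤ c₀ / m * (k ^ 2 + s ^ 2) := by
      calc c₀ = c₀ / m * m := by field_simp
        _ ≤ _ := by gcongr
    have hC1 : c₀ / m * (k ^ 2 + s ^ 2) + (2 + L) * (k ^ 2 + s ^ 2) ≤ C * k ^ 2 + C * s ^ 2 := by
      have : 0 ≤ c₁ * (k ^ 2 + s ^ 2) := by positivity
      rw [hC]; linarith
    have w1 := (abs_le.1 (hb _ hz')).2
    have w2 := (abs_le.1 (hb _ hZΩ)).1
    have p1 : - (P.snd * k) ≤ (P.snd ^ 2 + k ^ 2) / 2 := by linarith [sq_nonneg (P.snd + k)]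
    have p2 : - ⟪P.fst, a⟫ ≤ (‖P.fst‖ ^ 2 + s) / 2 := by
      have := neg_le_of_abs_le (abs_real_inner_le_norm P.fst a)
      linarith [sq_nonneg (‖P.fst‖ - ‖a‖)]
    have p3 := (abs_le.1 hSb).1
    have p4 : s ≤ 1 + s ^ 2 := by linarith [sq_nonneg (s - 1/2)]
    have p5 : L * s ≤ L * (1 + s ^ 2) := by gcongr
    have p6 : 0 ≤ e * s := by positivity
    have p7 : 0 ≤ L * k ^ 2 := by positivity
    have p8 : 0 ≤ L * s ^ 2 := by positivity
    have r1 := sq_nonneg P.snd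
    have r2 := sq_nonneg ‖P.fst‖
    have r3 := sq_nonneg k
    have r4 := sq_nonneg s
    clear hj h1 h2 hX hS hb
    linarith


lemma norm_upper {n : ℕ} (v d : En n) (hv : 0 < ‖v‖) :
    ‖v + d‖ ≤ ‖v‖ + ⟪v, d⟫ / ‖v‖ + ‖d‖ ^ 2 / (2 * ‖v‖) := by
  have h := norm_add_sq_real v d
  have h2 : ‖v‖ + ⟪v, d⟫ / ‖v‖ + ‖d‖ ^ 2 / (2 * ‖v‖) = (‖v + d‖ ^ 2 + ‖v‖ ^ 2) / (2 * ‖v‖) := by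
    rw [h]; field_simp; ring
  rw [h2, le_div_iff₀ (by positivity)]
  nlinarith [sq_nonneg (‖v + d‖ - ‖v‖)]

lemma phi_tan {n : ℕ} {φ ψ1 : ℝ → ℝ}
    (htan : ∀ r ∈ Ioc (0:ℝ) 2, ∀ r' ∈ Icc (0:ℝ) 2, φ r' ≤ φ r + ψ1 r * (r' - r))
    (hψ0 : ∀ r ∈ Ioc (0:ℝ) 2, 0 ≤ ψ1 r) (v d : En n) (hv : 0 < ‖v‖) (hv2 : ‖v‖ ≤ 2)
    (hd : ‖v + d‖ ≤ 2) :
    φ ‖v + d‖ ≤ φ ‖v‖ + ψ1 ‖v‖ / ‖v‖ * ⟪v, d⟫ + ψ1 ‖v‖ / (2 * ‖v‖) * ‖d‖ ^ 2 := by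
  have h1 := htan ‖v‖ ⟨hv, hv2⟩ ‖v + d‖ ⟨norm_nonneg _, hd⟩
  have h2 := norm_upper v d hv
  have h3 : ψ1 ‖v‖ * (‖v + d‖ - ‖v‖) ≤ ψ1 ‖v‖ * (⟪v, d⟫ / ‖v‖ + ‖d‖ ^ 2 / (2 * ‖v‖)) := by
    apply mul_le_mul_of_nonneg_left _ (hψ0 _ ⟨hv, hv2⟩)
    linarith
  calc _ ≤ _ := h1
    _ ≤ φ ‖v‖ + ψ1 ‖v‖ * (⟪v, d⟫ / ‖v‖ + ‖d‖ ^ 2 / (2 * ‖v‖)) := by linarith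
    _ = _ := by ring

lemma posq (t t' : ℝ) : (max t' 0) ^ 2 ≤ (max t 0) ^ 2 + 2 * max t 0 * (t' - t) + (t' - t) ^ 2 := by
  rcases le_total t 0 with h | h <;> rcases le_total t' 0 with h' | h' <;>
    simp only [max_eq_left, max_eq_right, h, h'] <;> nlinarith

/-- The penalisation. -/
def PhiD {n : ℕ} (φ : ℝ → ℝ) (A B D : ℝ) (x₀ : En n) (t₀ : ℝ) (ξ : SpT n × SpT n) : ℝ :=
  φ ‖ξ.1.fst - ξ.2.fst‖ + A / 2 * ‖ξ.1.fst - x₀‖ ^ 2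
    + (A * (ξ.1.snd - t₀) ^ 2 + B * (max (ξ.1.snd - t₀) 0) ^ 2) + D * (ξ.1.snd - ξ.2.snd) ^ 2

lemma st_inner' {n : ℕ} (a : En n) (s : ℝ) (z : SpT n) : ⟪st a s, z⟫ = ⟪a, z.fst⟫ + s * z.snd :=
  st_inner a z.fst s z.snd

lemma PhiD_semi {n : ℕ} {φ ψ1 : ℝ → ℝ}
    (htan : ∀ r ∈ Ioc (0:ℝ) 2, ∀ r' ∈ Icc (0:ℝ) 2, φ r' ≤ φ r + ψ1 r * (r' - r))
    (hψ0 : ∀ r ∈ Ioc (0:ℝ) 2, 0 ≤ ψ1 r) (hψa : AntitoneOn ψ1 (Ioc (0:ℝ) 2))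
    (A B D : ℝ) (hA : 0 ≤ A) (hB : 0 ≤ B) (hD : 0 ≤ D) (x₀ : En n) (t₀ r₁ : ℝ) (hr₁ : 0 < r₁)
    (ξ ξ' : SpT n × SpT n) (h1 : r₁ ≤ ‖ξ.1.fst - ξ.2.fst‖) (h2 : ‖ξ.1.fst - ξ.2.fst‖ ≤ 2)
    (h3 : ‖ξ'.1.fst - ξ'.2.fst‖ ≤ 2) :
    PhiD φ A B D x₀ t₀ ξ' ≤ PhiD φ A B D x₀ t₀ ξ
      + ⟪st ((ψ1 ‖ξ.1.fst - ξ.2.fst‖ / ‖ξ.1.fst - ξ.2.fst‖) • (ξ.1.fst - ξ.2.fst) + A • (ξ.1.fst - x₀))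
        (2 * A * (ξ.1.snd - t₀) + 2 * B * max (ξ.1.snd - t₀) 0 + 2 * D * (ξ.1.snd - ξ.2.snd)), ξ'.1 - ξ.1⟫
      + ⟪st (-((ψ1 ‖ξ.1.fst - ξ.2.fst‖ / ‖ξ.1.fst - ξ.2.fst‖) • (ξ.1.fst - ξ.2.fst)))
        (-(2 * D * (ξ.1.snd - ξ.2.snd))), ξ'.2 - ξ.2⟫
      + (ψ1 r₁ / r₁ + 2 * A + B + 2 * D) * (‖ξ'.1 - ξ.1‖ ^ 2 + ‖ξ'.2 - ξ.2‖ ^ 2) := by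
  have hn1 : ‖ξ'.1 - ξ.1‖ ^ 2 = ‖ξ'.1.fst - ξ.1.fst‖ ^ 2 + (ξ'.1.snd - ξ.1.snd) ^ 2 :=
    st_norm (ξ'.1.fst - ξ.1.fst) (ξ'.1.snd - ξ.1.snd)
  have hn2 : ‖ξ'.2 - ξ.2‖ ^ 2 = ‖ξ'.2.fst - ξ.2.fst‖ ^ 2 + (ξ'.2.snd - ξ.2.snd) ^ 2 :=
    st_norm (ξ'.2.fst - ξ.2.fst) (ξ'.2.snd - ξ.2.snd)
  rw [hn1, hn2, st_inner', st_inner']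
  have f1 : (ξ'.1 - ξ.1).fst = ξ'.1.fst - ξ.1.fst := rfl
  have f2 : (ξ'.2 - ξ.2).fst = ξ'.2.fst - ξ.2.fst := rfl
  have f3 : (ξ'.1 - ξ.1).snd = ξ'.1.snd - ξ.1.snd := rfl
  have f4 : (ξ'.2 - ξ.2).snd = ξ'.2.snd - ξ.2.snd := rfl
  rw [f1, f2, f3, f4]
  unfold PhiD
  obtain ⟨x, hx⟩ : ∃ x, x = ξ.1.fst := ⟨_, rfl⟩
  obtain ⟨y, hy⟩ : ∃ x, x = ξ.2.fst := ⟨_, rfl⟩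
  obtain ⟨t, ht⟩ : ∃ x, x = ξ.1.snd := ⟨_, rfl⟩
  obtain ⟨s, hs⟩ : ∃ x, x = ξ.2.snd := ⟨_, rfl⟩
  obtain ⟨x', hx'⟩ : ∃ x, x = ξ'.1.fst := ⟨_, rfl⟩
  obtain ⟨y', hy'⟩ : ∃ x, x = ξ'.2.fst := ⟨_, rfl⟩
  obtain ⟨t', ht'⟩ : ∃ x, x = ξ'.1.snd := ⟨_, rfl⟩
  obtain ⟨s', hs'⟩ : ∃ x, x = ξ'.2.snd := ⟨_, rfl⟩
  simp only [← hx, ← hy, ← ht, ← hs, ← hx', ← hy', ← ht', ← hs'] at h1 h2 h3 ⊢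
  have hr : 0 < ‖x - y‖ := hr₁.trans_le h1
  have e1 : x' - y' = (x - y) + ((x' - x) - (y' - y)) := by abel
  have p1 := phi_tan htan hψ0 (x - y) ((x' - x) - (y' - y)) hr h2 (by rw [← e1]; exact h3)
  rw [← e1] at p1
  have hψ : ψ1 ‖x - y‖ ≤ ψ1 r₁ := hψa ⟨hr₁, h1.trans h2⟩ ⟨hr, h2⟩ h1
  have hψ' : 0 ≤ ψ1 ‖x - y‖ := hψ0 _ ⟨hr, h2⟩
  have hψ'' : 0 ≤ ψ1 r₁ := hψ'.trans hψ
  have p2 : ψ1 ‖x - y‖ / (2 * ‖x - y‖) * ‖(x' - x) - (y' - y)‖ ^ 2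
      ≤ ψ1 r₁ / r₁ * (‖x' - x‖ ^ 2 + ‖y' - y‖ ^ 2) := by
    have q1 : ‖(x' - x) - (y' - y)‖ ^ 2 ≤ 2 * (‖x' - x‖ ^ 2 + ‖y' - y‖ ^ 2) := by
      have := parallelogram_law_with_norm ℝ (x' - x) (y' - y)
      linarith [sq_nonneg ‖(x' - x) + (y' - y)‖]
    calc ψ1 ‖x - y‖ / (2 * ‖x - y‖) * ‖(x' - x) - (y' - y)‖ ^ 2
        ≤ ψ1 r₁ / (2 * r₁) * (2 * (‖x' - x‖ ^ 2 + ‖y' - y‖ ^ 2)) := by gcongr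
      _ = _ := by ring
  rw [inner_sub_right, mul_sub] at p1
  have p3 : ‖x' - x₀‖ ^ 2 = ‖x - x₀‖ ^ 2 + 2 * ⟪x - x₀, x' - x⟫ + ‖x' - x‖ ^ 2 := by
    rw [← norm_add_sq_real]; congr 2; abel
  have p4 := posq (t - t₀) (t' - t₀)
  have e2 : t' - t₀ - (t - t₀) = t' - t := by ring
  rw [e2] at p4
  have p4' := mul_le_mul_of_nonneg_left p4 hB
  have p5 : D * (t' - s') ^ 2 ≤ D * (t - s) ^ 2 + 2 * D * (t - s) * ((t' - t) - (s' - s))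
      + 2 * D * ((t' - t) ^ 2 + (s' - s) ^ 2) := by
    linarith [mul_nonneg hD (sq_nonneg ((t' - t) + (s' - s)))]
  rw [p3, inner_add_left, inner_neg_left, inner_smul_left, inner_smul_left, inner_smul_left]
  simp only [conj_trivial]
  have m1 : 0 ≤ ψ1 r₁ / r₁ := div_nonneg (hψ'.trans hψ) hr₁.le
  have z1 : 0 ≤ ψ1 r₁ / r₁ * ((t' - t) ^ 2 + (s' - s) ^ 2) := by positivity
  have z2 : 0 ≤ A * (3 / 2 * ‖x' - x‖ ^ 2 + (t' - t) ^ 2 + 2 * ‖y' - y‖ ^ 2 + 2 * (s' - s) ^ 2) := by positivity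
  have z3 : 0 ≤ B * (‖x' - x‖ ^ 2 + ‖y' - y‖ ^ 2 + (s' - s) ^ 2) := by positivity
  have z4 : 0 ≤ D * (‖x' - x‖ ^ 2 + ‖y' - y‖ ^ 2) := by positivity
  clear hx hy ht hs hx' hy' ht' hs' f1 f2 f3 f4 hn1 hn2 p3 p4 e1 e2 htan hψ0 hψa
  linarith

lemma PhiD_second {n : ℕ} {φ : ℝ → ℝ} (A B D : ℝ) (x₀ : En n) (t₀ : ℝ) (ξ : SpT n × SpT n)
    (a b : En n) (τ : ℝ) :
    PhiD φ A B D x₀ t₀ (ξ.1 + τ • st a 0, ξ.2 + τ • st b 0)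
      + PhiD φ A B D x₀ t₀ (ξ.1 - τ • st a 0, ξ.2 - τ • st b 0) - 2 * PhiD φ A B D x₀ t₀ ξ
    = φ ‖(ξ.1.fst - ξ.2.fst) + τ • (a - b)‖ + φ ‖(ξ.1.fst - ξ.2.fst) - τ • (a - b)‖
      - 2 * φ ‖ξ.1.fst - ξ.2.fst‖ + A * ‖a‖ ^ 2 * τ ^ 2 := by
  have f1 : ∀ z : SpT n, (z + τ • st a 0).fst = z.fst + τ • a := fun z => rfl
  have f2 : ∀ z : SpT n, (z + τ • st b 0).fst = z.fst + τ • b := fun z => rfl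
  have f3 : ∀ z : SpT n, (z - τ • st a 0).fst = z.fst - τ • a := fun z => rfl
  have f4 : ∀ z : SpT n, (z - τ • st b 0).fst = z.fst - τ • b := fun z => rfl
  have g1 : ∀ z : SpT n, ∀ c : En n, (z + τ • st c 0).snd = z.snd := fun z c => by
    have : (z + τ • st c 0).snd = z.snd + τ * 0 := rfl
    rw [this]; simp
  have g3 : ∀ z : SpT n, ∀ c : En n, (z - τ • st c 0).snd = z.snd := fun z c => by
    have : (z - τ • st c 0).snd = z.snd - τ * 0 := rfl
    rw [this]; simp
  unfold PhiD
  simp only [f1, f2, f3, f4, g1, g3]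
  have e1 : ξ.1.fst + τ • a - (ξ.2.fst + τ • b) = (ξ.1.fst - ξ.2.fst) + τ • (a - b) := by
    rw [smul_sub]; abel
  have e2 : ξ.1.fst - τ • a - (ξ.2.fst - τ • b) = (ξ.1.fst - ξ.2.fst) - τ • (a - b) := by
    rw [smul_sub]; abel
  rw [e1, e2]
  have e3 : ‖ξ.1.fst + τ • a - x₀‖ ^ 2 + ‖ξ.1.fst - τ • a - x₀‖ ^ 2
      = 2 * ‖ξ.1.fst - x₀‖ ^ 2 + 2 * τ ^ 2 * ‖a‖ ^ 2 := by
    have := parallelogram_law_with_norm ℝ (ξ.1.fst - x₀) (τ • a)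
    rw [norm_smul] at this
    have t1 : ξ.1.fst - x₀ + τ • a = ξ.1.fst + τ • a - x₀ := by abel
    have t2 : ξ.1.fst - x₀ - τ • a = ξ.1.fst - τ • a - x₀ := by abel
    rw [t1, t2] at this
    have t3 : ‖τ‖ ^ 2 = τ ^ 2 := by simp
    rw [← t3]
    nlinarith
  linear_combination (A / 2) * e3


/-- Compact space-time box. -/
def boxC (n : ℕ) (R b c : ℝ) : Set (SpT n) := {z | ‖z.fst‖ ≤ R ∧ z.snd ∈ Icc b c}

lemma boxC_compact (n : ℕ) (R b c : ℝ) : IsCompact (boxC n R b c) := by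
  have : boxC n R b c = (fun ξ : En n × ℝ => WithLp.toLp 2 ξ) ''
      (Metric.closedBall 0 R ×ˢ Icc b c) := by
    ext z
    constructor
    · intro h; exact ⟨z.ofLp, ⟨by simpa using h.1, h.2⟩, rfl⟩
    · rintro ⟨a, ha, rfl⟩; exact ⟨by simpa using ha.1, ha.2⟩
  rw [this]
  exact ((isCompact_closedBall _ _).prod isCompact_Icc).image (WithLp.prod_continuous_toLp 2 _ _)

lemma cont_fst (n : ℕ) : Continuous (fun z : SpT n => z.fst) :=
  continuous_fst.comp (WithLp.prod_continuous_ofLp 2 _ _)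
lemma cont_snd (n : ℕ) : Continuous (fun z : SpT n => z.snd) :=
  continuous_snd.comp (WithLp.prod_continuous_ofLp 2 _ _)

lemma boxC_nhds (n : ℕ) (R b c : ℝ) (z : SpT n) (h1 : ‖z.fst‖ < R) (h2 : b < z.snd) (h3 : z.snd < c) :
    boxC n R b c ∈ nhds z := by
  have hc := (cont_fst n).norm.continuousAt (x := z)
  have hd := (cont_snd n).continuousAt (x := z)
  filter_upwards [hc.eventually (gt_mem_nhds h1), hd.eventually (gt_mem_nhds h3),
    hd.eventually (lt_mem_nhds h2)] with y a1 a2 a3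
  exact ⟨a1.le, a3.le, a2.le⟩

lemma near_max {n : ℕ} {η R₀ : ℝ} (hη : 0 < η) (hR : R₀ ≤ 7 / 8)
    {w : SpT n → ℝ} {φ : ℝ → ℝ}
    (hφ0 : ∀ s ∈ Icc (0:ℝ) 2, 0 ≤ φ s) (hφs : ∀ s ∈ Icc (0:ℝ) 2, φ s < 2 * η → s < 1 / 32)
    (x₀ : En n) (t₀ : ℝ) (hx₀ : ‖x₀‖ < R₀) (ht₀ : -R₀ ^ 2 < t₀) (ht₀' : t₀ < 0)
    (hb : ∀ z ∈ boxC n (31 / 32) (-15 / 16) (t₀ / 4), |w z| ≤ η)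
    (M₀ : ℝ) (hM₀ : 0 < M₀) (d : ℝ) (hd0 : 0 < d) (hd1 : d ≤ 1 / 64) (hd2 : d ≤ -t₀ / 8)
    (huc : ∀ z ∈ boxC n (31 / 32) (-15 / 16) (t₀ / 4), ∀ z' ∈ boxC n (31 / 32) (-15 / 16) (t₀ / 4),
      ‖z - z'‖ < d → |w z - w z'| < M₀ / 8)
    (ξ₁ ξ₂ Z₁ Z₂ : SpT n) (hξ₁ : ξ₁ ∈ boxC n (31 / 32) (-15 / 16) (t₀ / 4))
    (hξ₂ : ξ₂ ∈ boxC n (31 / 32) (-15 / 16) (t₀ / 4))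
    (hZ₁ : Z₁ ∈ boxC n (31 / 32) (-15 / 16) (t₀ / 4))
    (hZ₂ : Z₂ ∈ boxC n (31 / 32) (-15 / 16) (t₀ / 4))
    (hnear : M₀ - M₀ / 4 ≤ w Z₁ - w Z₂ - (16 * η / d ^ 2) / 2 * (‖Z₁ - ξ₁‖ ^ 2 + ‖Z₂ - ξ₂‖ ^ 2)
      - PhiD φ (4096 * η) (8 * η / t₀ ^ 2) (8 * η / d ^ 2) x₀ t₀ (ξ₁, ξ₂)) :
    d ≤ ‖ξ₁.fst - ξ₂.fst‖ ∧ ‖ξ₁.fst - ξ₂.fst‖ < 1 / 32 ∧ ‖ξ₁.fst - x₀‖ < 1 / 32 ∧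
    |ξ₁.snd - t₀| < 1 / 32 ∧ ξ₁.snd < t₀ / 2 ∧ |ξ₁.snd - ξ₂.snd| < d ∧
    ‖Z₁ - ξ₁‖ < d ∧ ‖Z₂ - ξ₂‖ < d ∧
    φ ‖ξ₁.fst - ξ₂.fst‖ + 4096 * η / 2 * ‖ξ₁.fst - x₀‖ ^ 2
      < w ξ₁ - w (st ξ₂.fst ξ₁.snd) := by
  have hr2 : ‖ξ₁.fst - ξ₂.fst‖ ≤ 2 := (norm_sub_le _ _).trans (by linarith [hξ₁.1, hξ₂.1])
  have hφ := hφ0 _ ⟨norm_nonneg _, hr2⟩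
  have hw1 := abs_le.1 (hb _ hZ₁)
  have hw2 := abs_le.1 (hb _ hZ₂)
  have hd2' : 0 < d ^ 2 := by positivity
  have htne : t₀ ≠ 0 := ht₀'.ne
  have ht2 : 0 < t₀ ^ 2 := by positivity
  unfold PhiD at hnear
  simp only at hnear
  have s1 : 0 ≤ 4096 * η / 2 * ‖ξ₁.fst - x₀‖ ^ 2 := by positivity
  have s2 : 0 ≤ 4096 * η * (ξ₁.snd - t₀) ^ 2 := by positivity
  have s3 : 0 ≤ 8 * η / t₀ ^ 2 * (max (ξ₁.snd - t₀) 0) ^ 2 := by positivity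
  have s4 : 0 ≤ 8 * η / d ^ 2 * (ξ₁.snd - ξ₂.snd) ^ 2 := by positivity
  have s5 : 0 ≤ (16 * η / d ^ 2) / 2 * ‖Z₁ - ξ₁‖ ^ 2 := by positivity
  have s6 : 0 ≤ (16 * η / d ^ 2) / 2 * ‖Z₂ - ξ₂‖ ^ 2 := by positivity
  have a1 : φ ‖ξ₁.fst - ξ₂.fst‖ < 2 * η := by linarith
  have a2 : ‖ξ₁.fst - x₀‖ < 1 / 32 := by
    have : η * (2048 * ‖ξ₁.fst - x₀‖ ^ 2) < η * 2 := by linarith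
    have := lt_of_mul_lt_mul_left this hη.le
    apply lt_of_pow_lt_pow_left₀ 2 (by norm_num)
    linarith
  have a3 : |ξ₁.snd - t₀| < 1 / 32 := by
    have : η * (4096 * (ξ₁.snd - t₀) ^ 2) < η * 2 := by linarith
    have := lt_of_mul_lt_mul_left this hη.le
    apply abs_lt_of_sq_lt_sq _ (by norm_num)
    linarith
  have a4 : ξ₁.snd < t₀ / 2 := by
    by_contra hcon
    push Not at hcon
    have hle : -t₀ / 2 ≤ max (ξ₁.snd - t₀) 0 := le_max_of_le_left (by linarith)
    have : (-t₀ / 2) ^ 2 ≤ (max (ξ₁.snd - t₀) 0) ^ 2 := by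
      apply pow_le_pow_left₀ (by linarith) hle
    have h8 : 8 * η / t₀ ^ 2 * (-t₀ / 2) ^ 2 ≤ 8 * η / t₀ ^ 2 * (max (ξ₁.snd - t₀) 0) ^ 2 := by
      gcongr
    have h9 : 8 * η / t₀ ^ 2 * (-t₀ / 2) ^ 2 = 2 * η := by field_simp; ring
    linarith
  have a5 : |ξ₁.snd - ξ₂.snd| < d := by
    have h8 : 8 * η / d ^ 2 * (ξ₁.snd - ξ₂.snd) ^ 2 < 8 * η / d ^ 2 * d ^ 2 := by
      have : 8 * η / d ^ 2 * d ^ 2 = 8 * η := by field_simp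
      linarith
    have := lt_of_mul_lt_mul_left h8 (by positivity)
    exact abs_lt_of_sq_lt_sq this hd0.le
  have a6 : ‖Z₁ - ξ₁‖ < d := by
    have h8 : (16 * η / d ^ 2) / 2 * ‖Z₁ - ξ₁‖ ^ 2 < (16 * η / d ^ 2) / 2 * d ^ 2 := by
      have : (16 * η / d ^ 2) / 2 * d ^ 2 = 8 * η := by field_simp; ring
      linarith
    have := lt_of_mul_lt_mul_left h8 (by positivity)
    exact lt_of_pow_lt_pow_left₀ 2 hd0.le this
  have a7 : ‖Z₂ - ξ₂‖ < d := by
    have h8 : (16 * η / d ^ 2) / 2 * ‖Z₂ - ξ₂‖ ^ 2 < (16 * η / d ^ 2) / 2 * d ^ 2 := by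
      have : (16 * η / d ^ 2) / 2 * d ^ 2 = 8 * η := by field_simp; ring
      linarith
    have := lt_of_mul_lt_mul_left h8 (by positivity)
    exact lt_of_pow_lt_pow_left₀ 2 hd0.le this
  have hmid : st ξ₂.fst ξ₁.snd ∈ boxC n (31 / 32) (-15 / 16) (t₀ / 4) := ⟨hξ₂.1, hξ₁.2⟩
  have c1 := abs_lt.1 (huc _ hZ₁ _ hξ₁ a6)
  have c2 := abs_lt.1 (huc _ hZ₂ _ hξ₂ a7)
  have c3 := abs_lt.1 (huc _ hξ₂ _ hmid (by
    have e : ξ₂ - st ξ₂.fst ξ₁.snd = st (ξ₂.fst - ξ₂.fst) (ξ₂.snd - ξ₁.snd) := rfl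
    apply lt_of_pow_lt_pow_left₀ 2 hd0.le
    rw [e, st_norm]
    simp only [sub_self, norm_zero]
    rw [abs_sub_comm] at a5
    have := sq_lt_sq' (by linarith [(abs_lt.1 a5).1]) (abs_lt.1 a5).2
    linarith))
  have a8 : φ ‖ξ₁.fst - ξ₂.fst‖ + 4096 * η / 2 * ‖ξ₁.fst - x₀‖ ^ 2 + M₀ / 4
      < w ξ₁ - w (st ξ₂.fst ξ₁.snd) := by linarith
  refine ⟨?_, hφs _ ⟨norm_nonneg _, hr2⟩ a1, a2, a3, a4, a5, a6, a7, by linarith⟩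
  by_contra hcon
  push Not at hcon
  have c4 := abs_lt.1 (huc _ hξ₁ _ hmid (by
    have e : ξ₁ - st ξ₂.fst ξ₁.snd = st (ξ₁.fst - ξ₂.fst) (ξ₁.snd - ξ₁.snd) := rfl
    apply lt_of_pow_lt_pow_left₀ 2 hd0.le
    rw [e, st_norm]
    simp only [sub_self]
    have := pow_lt_pow_left₀ hcon (norm_nonneg _) (two_ne_zero)
    linarith))
  linarith [c4.2]


set_option maxHeartbeats 2000000 in
theorem doubling_pde {n : ℕ} {γ p η R₀ : ℝ} (hη : 0 < η) (hR : R₀ ≤ 7 / 8)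
    {K : En n} {w f : En n × ℝ → ℝ} (hsol : IsDevSol γ p K f w (pCyl n 1))
    (hw : ∀ z ∈ pCyl n 1, |w z| ≤ η) (hf : ∀ z ∈ pCyl n 1, |f z| ≤ η)
    (φ ψ1 ψ2 : ℝ → ℝ) (hφc : ContinuousOn φ (Icc 0 2))
    (hφ0 : ∀ s ∈ Icc (0:ℝ) 2, 0 ≤ φ s) (hφs : ∀ s ∈ Icc (0:ℝ) 2, φ s < 2 * η → s < 1 / 32)
    (htan : ∀ r ∈ Ioc (0:ℝ) 2, ∀ r' ∈ Icc (0:ℝ) 2, φ r' ≤ φ r + ψ1 r * (r' - r))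
    (hψ0 : ∀ r ∈ Ioc (0:ℝ) 2, 0 ≤ ψ1 r) (hψa : AntitoneOn ψ1 (Ioc (0:ℝ) 2))
    (hsec : ∀ r ∈ Ioc (0:ℝ) 1, ∀ x, |x| ≤ r → φ (r + x) + φ (r - x) - 2 * φ r ≤ ψ2 r * x ^ 2)
    (x₀ y₀ : En n) (t₀ : ℝ) (hx₀ : (x₀, t₀) ∈ pCyl n R₀) (hy₀ : (y₀, t₀) ∈ pCyl n R₀)
    (hpos : φ ‖x₀ - y₀‖ < w (x₀, t₀) - w (y₀, t₀)) :
    ∃ (x y : En n) (t : ℝ) (q₁ q₂ : En n) (X Y : En n →L[ℝ] En n),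
      0 < ‖x - y‖ ∧ ‖x - y‖ < 1 / 32 ∧ ‖x - x₀‖ < 1 / 32 ∧ t₀ - 1 / 32 < t ∧ t < 0 ∧
      φ ‖x - y‖ + 4096 * η / 2 * ‖x - x₀‖ ^ 2 < w (x, t) - w (y, t) ∧
      ‖q₁ - (K + (ψ1 ‖x - y‖ / ‖x - y‖) • (x - y) + (4096 * η) • (x - x₀))‖ ≤ ‖x - y‖ ∧
      ‖q₂ - (K + (ψ1 ‖x - y‖ / ‖x - y‖) • (x - y))‖ ≤ ‖x - y‖ ∧
      (∀ a b, ⟪X a, a⟫ - ⟪Y b, b⟫ ≤ ψ1 ‖x - y‖ / ‖x - y‖ * ‖a - b‖ ^ 2 + 4096 * η * ‖a‖ ^ 2) ∧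
      (∀ a b, ∀ c : ℝ, a - b = c • (x - y) →
        ⟪X a, a⟫ - ⟪Y b, b⟫ ≤ ψ2 ‖x - y‖ * (c * ‖x - y‖) ^ 2 + 4096 * η * ‖a‖ ^ 2) ∧
      (q₁ ≠ 0 → q₂ ≠ 0 → -(9000 * η) ≤ opVal γ p q₁ X - opVal γ p q₂ Y) := by
  obtain ⟨hx1, hx2, hx3⟩ := hx₀
  obtain ⟨hy1, -, -⟩ := hy₀
  simp only at hx1 hx2 hx3 hy1
  have hR0 : 0 < R₀ := (norm_nonneg _).trans_lt hx1
  have hRsq : R₀ ^ 2 ≤ 49 / 64 := by nlinarith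
  have hxy2 : ‖x₀ - y₀‖ ≤ 2 := (norm_sub_le _ _).trans (by linarith)
  obtain ⟨M₀, hM₀⟩ : ∃ M₀, M₀ = w (x₀, t₀) - w (y₀, t₀) - φ ‖x₀ - y₀‖ := ⟨_, rfl⟩
  have hM₀0 : 0 < M₀ := by linarith
  set C₁ := boxC n (31 / 32) (-15 / 16) (t₀ / 4) with hC₁
  have hCc : IsCompact C₁ := boxC_compact _ _ _ _
  have hCΩ : ∀ z ∈ C₁, z.ofLp ∈ pCyl n 1 := by
    intro z hz
    refine ⟨lt_of_le_of_lt hz.1 (by norm_num), lt_of_lt_of_le (by norm_num) hz.2.1,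
      lt_of_le_of_lt hz.2.2 (by linarith)⟩
  have hinner : Continuous (fun z : En n × ℝ => ⟪K, z.1⟫) := continuous_const.inner continuous_fst
  have hwcont : ContinuousOn w (pCyl n 1) := by
    have := hsol.1.sub hinner.continuousOn
    refine this.congr fun z _ => ?_
    simp
  set w' : SpT n → ℝ := fun z => w z.ofLp with hw'
  have hw'c : ContinuousOn w' C₁ :=
    hwcont.comp (WithLp.prod_continuous_ofLp 2 _ _).continuousOn hCΩ
  have hb' : ∀ z ∈ C₁, |w' z| ≤ η := fun z hz => hw _ (hCΩ z hz)
  obtain ⟨δ, hδ, huc⟩ := Metric.uniformContinuousOn_iff.1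
    (hCc.uniformContinuousOn_of_continuous hw'c) (M₀ / 8) (by positivity)
  obtain ⟨d, hd⟩ : ∃ d, d = min δ (min (1 / 64) (-t₀ / 8)) := ⟨_, rfl⟩
  have hd0 : 0 < d := by
    rw [hd]; exact lt_min hδ (lt_min (by norm_num) (by linarith))
  have hd1 : d ≤ 1 / 64 := by rw [hd]; exact (min_le_right _ _).trans (min_le_left _ _)
  have hd2 : d ≤ -t₀ / 8 := by rw [hd]; exact (min_le_right _ _).trans (min_le_right _ _)
  have huc' : ∀ z ∈ C₁, ∀ z' ∈ C₁, ‖z - z'‖ < d → |w' z - w' z'| < M₀ / 8 := by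
    intro z hz z' hz' h
    have := huc z hz z' hz' (by rw [dist_eq_norm]; exact h.trans_le (by rw [hd]; exact min_le_left _ _))
    rwa [Real.dist_eq] at this
  set A := 4096 * η with hA
  set B := 8 * η / t₀ ^ 2 with hB
  set D := 8 * η / d ^ 2 with hD
  set l := 16 * η / d ^ 2 with hl
  have hA0 : 0 < A := by positivity
  have hB0 : 0 ≤ B := by positivity
  have hD0 : 0 ≤ D := by positivity
  have hl0 : 0 < l := by positivity
  set Φ := PhiD φ A B D x₀ t₀ with hΦ
  set r₁ := d / 2 with hr₁
  have hr₁0 : 0 < r₁ := by positivity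
  have near := fun ξ₁ ξ₂ Z₁ Z₂ h1 h2 h3 h4 h5 => near_max (φ := φ) (w := w') hη hR hφ0 hφs x₀ t₀ hx1 hx2 hx3
    hb' M₀ hM₀0 d hd0 hd1 hd2 huc' ξ₁ ξ₂ Z₁ Z₂ h1 h2 h3 h4 h5
  set ξ₀ : SpT n × SpT n := (st x₀ t₀, st y₀ t₀) with hξ₀
  have hξ₀1 : ξ₀.1 ∈ C₁ := ⟨show ‖x₀‖ ≤ _ by linarith, show _ ≤ t₀ by linarith, show t₀ ≤ _ by linarith⟩
  have hξ₀2 : ξ₀.2 ∈ C₁ := ⟨show ‖y₀‖ ≤ _ by linarith, show _ ≤ t₀ by linarith, show t₀ ≤ _ by linarith⟩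
  have hΦ0 : Φ ξ₀ = φ ‖x₀ - y₀‖ := by
    simp [hΦ, PhiD, hξ₀, st]
  have hval : w' ξ₀.1 - w' ξ₀.2 - Φ ξ₀ = M₀ := by
    rw [hΦ0, hM₀]; rfl
  set 𝒦 : Set (SpT n × SpT n) := (C₁ ×ˢ C₁) ∩ {ξ | r₁ ≤ ‖ξ.1.fst - ξ.2.fst‖} with h𝒦
  have hcdiff : Continuous (fun ξ : SpT n × SpT n => ‖ξ.1.fst - ξ.2.fst‖) :=
    (((cont_fst n).comp continuous_fst).sub ((cont_fst n).comp continuous_snd)).norm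
  have h𝒦c : IsCompact 𝒦 :=
    (hCc.prod hCc).inter_right (isClosed_le continuous_const hcdiff)
  have h𝒦2 : ∀ ξ ∈ 𝒦, ‖ξ.1.fst - ξ.2.fst‖ ≤ 2 := fun ξ hξ =>
    (norm_sub_le _ _).trans (by linarith [hξ.1.1.1, hξ.1.2.1])
  have hΦc : ContinuousOn Φ 𝒦 := by
    have g1 : Continuous (fun ξ : SpT n × SpT n => ξ.1.fst) := (cont_fst n).comp continuous_fst
    have g2 : Continuous (fun ξ : SpT n × SpT n => ξ.1.snd) := (cont_snd n).comp continuous_fst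
    have g3 : Continuous (fun ξ : SpT n × SpT n => ξ.2.snd) := (cont_snd n).comp continuous_snd
    have g4 : ContinuousOn (fun ξ : SpT n × SpT n => φ ‖ξ.1.fst - ξ.2.fst‖) 𝒦 :=
      hφc.comp hcdiff.continuousOn (fun ξ hξ => ⟨norm_nonneg _, h𝒦2 ξ hξ⟩)
    have g5 : Continuous (fun ξ : SpT n × SpT n => A / 2 * ‖ξ.1.fst - x₀‖ ^ 2
      + (A * (ξ.1.snd - t₀) ^ 2 + B * (max (ξ.1.snd - t₀) 0) ^ 2) + D * (ξ.1.snd - ξ.2.snd) ^ 2) := by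
      have : Continuous (fun ξ : SpT n × SpT n => max (ξ.1.snd - t₀) 0) := (g2.sub continuous_const).max continuous_const
      fun_prop
    refine (g4.add g5.continuousOn).congr fun ξ _ => ?_
    simp only [hΦ, PhiD, Pi.add_apply]
    ring
  have hnear0 : d ≤ ‖x₀ - y₀‖ := by
    have := (near ξ₀.1 ξ₀.2 ξ₀.1 ξ₀.2 hξ₀1 hξ₀2 hξ₀1 hξ₀2 (by
      have e : PhiD φ A B D x₀ t₀ (ξ₀.1, ξ₀.2) = Φ ξ₀ := rfl
      rw [e]
      simp only [sub_self, norm_zero]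
      linarith)).1
    exact this
  have hcond : ∀ ξ ∈ 𝒦, ∀ Z₁ ∈ C₁, ∀ Z₂ ∈ C₁, w' ξ₀.1 - w' ξ₀.2 - Φ ξ₀ - M₀ / 4
      ≤ w' Z₁ - w' Z₂ - l / 2 * (‖Z₁ - ξ.1‖ ^ 2 + ‖Z₂ - ξ.2‖ ^ 2) - Φ ξ →
      M₀ - M₀ / 4 ≤ w' Z₁ - w' Z₂ - l / 2 * (‖Z₁ - ξ.1‖ ^ 2 + ‖Z₂ - ξ.2‖ ^ 2)
        - PhiD φ A B D x₀ t₀ (ξ.1, ξ.2) := by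
    intro ξ _ Z₁ _ Z₂ _ h
    rw [hval] at h
    exact h
  obtain ⟨ξ, hξ, Z₁, hZ₁, Z₂, hZ₂, P₁, P₂, X, Y, h1, hP₁, hP₂, hXs, hYs, hjX, hjY, hmat⟩ :=
    doubling w' Φ C₁ hCc hw'c l hl0 𝒦 h𝒦c hΦc
      (fun ξ => st ((ψ1 ‖ξ.1.fst - ξ.2.fst‖ / ‖ξ.1.fst - ξ.2.fst‖) • (ξ.1.fst - ξ.2.fst) + A • (ξ.1.fst - x₀))
        (2 * A * (ξ.1.snd - t₀) + 2 * B * max (ξ.1.snd - t₀) 0 + 2 * D * (ξ.1.snd - ξ.2.snd)))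
      (fun ξ => st (-((ψ1 ‖ξ.1.fst - ξ.2.fst‖ / ‖ξ.1.fst - ξ.2.fst‖) • (ξ.1.fst - ξ.2.fst)))
        (-(2 * D * (ξ.1.snd - ξ.2.snd))))
      (ψ1 r₁ / r₁ + 2 * A + B + 2 * D)
      (by
        have := hψ0 r₁ ⟨hr₁0, by rw [hr₁]; linarith⟩
        positivity)
      (fun ξ hξ ξ' hξ' => PhiD_semi htan hψ0 hψa A B D hA0.le hB0 hD0 x₀ t₀ r₁ hr₁0 ξ ξ' hξ.2
        (h𝒦2 ξ hξ) (h𝒦2 ξ' hξ'))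
      ξ₀ ⟨⟨hξ₀1, hξ₀2⟩, show r₁ ≤ ‖x₀ - y₀‖ by rw [hr₁]; linarith⟩ hξ₀1 hξ₀2 (M₀ / 4) (by positivity)
      (by
        intro ξ hξ Z₁ hZ₁ Z₂ hZ₂ h
        obtain ⟨k1, k2, k3, k4, k5, k6, k7, k8, k9⟩ := near ξ.1 ξ.2 Z₁ Z₂ hξ.1.1 hξ.1.2 hZ₁ hZ₂
          (hcond ξ hξ Z₁ hZ₁ Z₂ hZ₂ h)
        have k4' := abs_lt.1 k4
        have k6' := abs_lt.1 k6
        have n1 : ‖ξ.1.fst‖ < 31 / 32 := by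
          have := norm_le_insert' ξ.1.fst x₀
          linarith
        have n2 : ‖ξ.2.fst‖ < 31 / 32 := by
          have e1 := norm_le_insert' ξ.1.fst x₀
          have e2 := norm_le_insert ξ.1.fst ξ.2.fst
          linarith
        rw [mem_interior_iff_mem_nhds]
        apply Filter.inter_mem
        · exact prod_mem_nhds (boxC_nhds _ _ _ _ _ n1 (by linarith) (by linarith))
            (boxC_nhds _ _ _ _ _ n2 (by linarith) (by linarith))
        · have : ∀ᶠ ξ' in nhds ξ, r₁ < ‖ξ'.1.fst - ξ'.2.fst‖ :=
            hcdiff.continuousAt.eventually (lt_mem_nhds (by rw [hr₁]; linarith))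
          filter_upwards [this] with ξ' h using h.le) (min r₁ η) (lt_min hr₁0 hη)
  obtain ⟨k1, k2, k3, k4, k5, k6, k7, k8, k9⟩ := near ξ.1 ξ.2 Z₁ Z₂ hξ.1.1 hξ.1.2 hZ₁ hZ₂
          (hcond ξ hξ Z₁ hZ₁ Z₂ hZ₂ h1)
  have k4' := abs_lt.1 k4
  have k6' := abs_lt.1 k6
  have hr0 : 0 < ‖ξ.1.fst - ξ.2.fst‖ := hd0.trans_le k1
  have n1 : ‖ξ.1.fst‖ < 29 / 32 := by
    have := norm_le_insert' ξ.1.fst x₀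
    linarith
  have n2 : ‖ξ.2.fst‖ < 30 / 32 := by
    have e2 := norm_le_insert ξ.1.fst ξ.2.fst
    linarith
  have z1 := (st_fst_le (Z₁ - ξ.1)).trans_lt k7
  have z2 := (st_fst_le (Z₂ - ξ.2)).trans_lt k8
  have z3 := abs_lt.1 ((st_snd_le (Z₁ - ξ.1)).trans_lt k7)
  have z4 := abs_lt.1 ((st_snd_le (Z₂ - ξ.2)).trans_lt k8)
  replace z1 : ‖Z₁.fst - ξ.1.fst‖ < d := z1
  replace z2 : ‖Z₂.fst - ξ.2.fst‖ < d := z2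
  replace z3 : -d < Z₁.snd - ξ.1.snd ∧ Z₁.snd - ξ.1.snd < d := z3
  replace z4 : -d < Z₂.snd - ξ.2.snd ∧ Z₂.snd - ξ.2.snd < d := z4
  have y1 : C₁ ∈ nhds Z₁ := by
    refine boxC_nhds _ _ _ _ _ ?_ (by linarith) (by linarith)
    have := norm_le_insert' Z₁.fst ξ.1.fst
    linarith
  have y2 : C₁ ∈ nhds Z₂ := by
    refine boxC_nhds _ _ _ _ _ ?_ (by linarith) (by linarith)
    have := norm_le_insert' Z₂.fst ξ.2.fst
    linarith
  obtain ⟨S₁, hS₁s, hS₁⟩ := sblk_exists X hXs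
  obtain ⟨S₂, hS₂s, hS₂⟩ := sblk_exists Y hYs
  have hmat' : ∀ a b : En n, ∀ c : ℝ, (∃ d > 0, ∀ τ : ℝ, 0 < τ → τ < d →
      φ ‖(ξ.1.fst - ξ.2.fst) + τ • (a - b)‖ + φ ‖(ξ.1.fst - ξ.2.fst) - τ • (a - b)‖
      - 2 * φ ‖ξ.1.fst - ξ.2.fst‖ ≤ c * τ ^ 2) → ⟪S₁ a, a⟫ - ⟪S₂ b, b⟫ ≤ c + A * ‖a‖ ^ 2 := by
    intro a b c ⟨dd, hdd, hh⟩
    rw [hS₁, hS₂]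
    apply hmat
    refine ⟨dd, hdd, fun τ hτ hτ' => ?_⟩
    have := hh τ hτ hτ'
    rw [hΦ, PhiD_second]
    linarith
  obtain ⟨v, hv⟩ : ∃ v, v = ξ.1.fst - ξ.2.fst := ⟨_, rfl⟩
  rw [← hv] at hr0 k2 hmat' k9
  refine ⟨ξ.1.fst, ξ.2.fst, ξ.1.snd, K + P₁.fst, K + P₂.fst, S₁, S₂, ?_⟩
  rw [← hv]
  have hρ : min r₁ η ≤ ‖v‖ := (min_le_left _ _).trans (by rw [hr₁, hv]; linarith)
  refine ⟨hr0, k2, k3, by linarith, by linarith, k9, ?_, ?_, ?_, ?_, ?_⟩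
  · refine le_trans ?_ hρ
    refine le_trans ?_ hP₁
    refine le_trans (le_of_eq ?_) (st_fst_le _)
    congr 1
    rw [hv]
    show _ = P₁.fst - ((ψ1 ‖ξ.1.fst - ξ.2.fst‖ / ‖ξ.1.fst - ξ.2.fst‖) • (ξ.1.fst - ξ.2.fst) + A • (ξ.1.fst - x₀))
    abel
  · refine le_trans ?_ hρ
    refine le_trans ?_ hP₂
    refine le_trans (le_of_eq ?_) (st_fst_le _)
    congr 1
    rw [hv]
    show _ = P₂.fst + -((ψ1 ‖ξ.1.fst - ξ.2.fst‖ / ‖ξ.1.fst - ξ.2.fst‖) • (ξ.1.fst - ξ.2.fst))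
    abel
  · intro a b
    apply hmat'
    obtain ⟨dd, hdd, hsm⟩ : ∃ dd > 0, ∀ τ : ℝ, 0 < τ → τ < dd → ‖τ • (a - b)‖ ≤ 1 := by
      refine ⟨1 / (‖a - b‖ + 1), by positivity, fun τ hτ hτ' => ?_⟩
      rw [norm_smul, norm_eq_abs, abs_of_pos hτ]
      calc τ * ‖a - b‖ ≤ 1 / (‖a - b‖ + 1) * (‖a - b‖ + 1) := by gcongr; linarith
        _ = 1 := by field_simp
    refine ⟨dd, hdd, fun τ hτ hτ' => ?_⟩
    have hs := hsm τ hτ hτ'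
    have t1 := phi_tan htan hψ0 v (τ • (a - b)) hr0 (by linarith)
      ((norm_add_le _ _).trans (by linarith))
    have t2 := phi_tan htan hψ0 v (-(τ • (a - b))) hr0 (by linarith)
      ((norm_add_le _ _).trans (by rw [norm_neg]; linarith))
    rw [← sub_eq_add_neg, inner_neg_right, norm_neg] at t2
    have t3 : ‖τ • (a - b)‖ ^ 2 = τ ^ 2 * ‖a - b‖ ^ 2 := by
      rw [norm_smul, mul_pow, norm_eq_abs, sq_abs]
    rw [t3] at t1 t2
    have t4 : ψ1 ‖v‖ / ‖v‖ * ‖a - b‖ ^ 2 * τ ^ 2 = 2 * (ψ1 ‖v‖ / (2 * ‖v‖) * (τ ^ 2 * ‖a - b‖ ^ 2)) := by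
      field_simp
    rw [t4]
    linarith
  · intro a b c hab
    apply hmat'
    refine ⟨1 / (|c| + 1), by positivity, fun τ hτ hτ' => ?_⟩
    have hτc : |τ * c| ≤ 1 := by
      rw [abs_mul, abs_of_pos hτ]
      calc τ * |c| ≤ 1 / (|c| + 1) * (|c| + 1) := by gcongr; linarith
        _ = 1 := by field_simp
    have hτc' := abs_le.1 hτc
    have e1 : v + τ • (a - b) = (1 + τ * c) • v := by rw [hab, smul_smul, add_smul, one_smul]
    have e2 : v - τ • (a - b) = (1 - τ * c) • v := by rw [hab, smul_smul, sub_smul, one_smul]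
    have e3 : ‖(1 + τ * c) • v‖ = ‖v‖ + τ * c * ‖v‖ := by
      rw [norm_smul, norm_eq_abs, abs_of_nonneg (by linarith)]; ring
    have e4 : ‖(1 - τ * c) • v‖ = ‖v‖ - τ * c * ‖v‖ := by
      rw [norm_smul, norm_eq_abs, abs_of_nonneg (by linarith)]; ring
    rw [e1, e2, e3, e4]
    have := hsec ‖v‖ ⟨hr0, by linarith⟩ (τ * c * ‖v‖) (by
      rw [abs_mul, abs_of_pos hr0]
      calc |τ * c| * ‖v‖ ≤ 1 * ‖v‖ := by gcongr
        _ = ‖v‖ := one_mul _)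
    linarith
  · intro hq1 hq2
    have j1 := jet_of_local hw C₁ Z₁ y1 (hCΩ _ hZ₁) P₁ X hXs hjX S₁ hS₁ K
    have j2 := jet_of_local (w := fun z => - w z) (η := η) (fun z hz => by rw [abs_neg]; exact hw z hz) C₁ Z₂ y2
      (hCΩ _ hZ₂) (-P₂) (-Y) (by intro a b; simp [hYs]) (by
        intro ε hε
        obtain ⟨dd, hdd, hh⟩ := hjY ε hε
        refine ⟨dd, hdd, fun h h1 h2 => ?_⟩
        have := hh h h1 h2
        simp only [neg_apply, inner_neg_left]
        linarith) (-S₂) (by intro a b; simp [hS₂]) (-K)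
    have i1 := visc_sub hsol.2.2 (hCΩ _ hZ₁) hq1 hS₁s j1
    have i2 := visc_super (a := P₂.snd) hsol.2.1 (hCΩ _ hZ₂) hq2 hS₂s (by
      have e1 : (-P₂).snd = - P₂.snd := rfl
      have e2 : -K + (-P₂).fst = - (K + P₂.fst) := by
        have : (-P₂).fst = - P₂.fst := rfl
        rw [this]; abel
      rw [e1, e2] at j2
      have e3 : (fun z : En n × ℝ => - w z + ⟪-K, z.1⟫) = fun z => -(w z + ⟪K, z.1⟫) := by
        ext z; rw [inner_neg_left]; ring
      rw [e3] at j2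
      exact j2)
    have f1 := abs_le.1 (hf _ (hCΩ _ hZ₁))
    have f2 := abs_le.1 (hf _ (hCΩ _ hZ₂))
    have s1 := abs_le.1 ((st_snd_le _).trans (hP₁.trans (min_le_right _ _)))
    have s2 := abs_le.1 ((st_snd_le _).trans (hP₂.trans (min_le_right _ _)))
    replace s1 := s1.1
    replace s2 := s2.2
    replace s1 : -η ≤ P₁.snd - (2 * A * (ξ.1.snd - t₀) + 2 * B * max (ξ.1.snd - t₀) 0 + 2 * D * (ξ.1.snd - ξ.2.snd)) := s1
    replace s2 : P₂.snd + (-(2 * D * (ξ.1.snd - ξ.2.snd))) ≤ η := s2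
    have b1 : 0 ≤ B * max (ξ.1.snd - t₀) 0 := by positivity
    have b2 : A * (-1 / 32) ≤ A * (ξ.1.snd - t₀) := by
      apply mul_le_mul_of_nonneg_left _ hA0.le; linarith
    rw [hA] at b2 s1
    linarith


/-- The symmetric square root of the coefficient matrix. -/
def sg {n : ℕ} (γ κ : ℝ) (q : En n) : En n →ₗ[ℝ] En n where
  toFun v := ‖q‖ ^ (γ / 2) • (v + (κ * ⟪‖q‖⁻¹ • q, v⟫) • (‖q‖⁻¹ • q))
  map_add' a b := by simp only [inner_add_right, mul_add, add_smul, smul_add]; abel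
  map_smul' c a := by
    simp only [inner_smul_right, smul_add, smul_smul, RingHom.id_apply]
    congr 2 <;> ring_nf

theorem sg_apply {n : ℕ} (γ κ : ℝ) (q v : En n) :
    sg γ κ q v = ‖q‖ ^ (γ / 2) • (v + (κ * ⟪‖q‖⁻¹ • q, v⟫) • (‖q‖⁻¹ • q)) := rfl

theorem unit_norm {n : ℕ} {q : En n} (hq : q ≠ 0) : ‖‖q‖⁻¹ • q‖ = 1 := by
  rw [norm_smul, norm_inv, norm_norm, inv_mul_cancel₀ (norm_ne_zero_iff.2 hq)]

theorem sg_lower {n : ℕ} (γ κ m : ℝ) (q v : En n) (hq : q ≠ 0) (hm : m ≤ 1) (hm' : m ≤ 1 + κ) :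
    ‖q‖ ^ (γ / 2) * m * ‖v‖ ^ 2 ≤ ⟪sg γ κ q v, v⟫ := by
  have hs : 0 ≤ ‖q‖ ^ (γ / 2) := by positivity
  have hu := unit_norm hq
  rw [sg_apply]
  obtain ⟨u, hu'⟩ : ∃ u, u = ‖q‖⁻¹ • q := ⟨_, rfl⟩
  rw [← hu'] at hu ⊢
  rw [inner_smul_left, inner_add_left, inner_smul_left, real_inner_self_eq_norm_sq, mul_assoc]
  simp only [conj_trivial]
  apply mul_le_mul_of_nonneg_left _ hs
  have h1 : ⟪u, v⟫ ^ 2 ≤ ‖v‖ ^ 2 := by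
    have := abs_real_inner_le_norm u v
    rw [hu, one_mul] at this
    calc ⟪u, v⟫ ^ 2 = |⟪u, v⟫| ^ 2 := (sq_abs _).symm
      _ ≤ _ := by gcongr
  have h0 := sq_nonneg ⟪u, v⟫
  rcases le_total 0 κ with h | h
  · nlinarith [mul_nonneg h h0, mul_nonneg (sub_nonneg.2 hm) (sq_nonneg ‖v‖)]
  · nlinarith [mul_nonneg (neg_nonneg.2 h) (sub_nonneg.2 h1), mul_nonneg (sub_nonneg.2 hm') (sq_nonneg ‖v‖)]

theorem sg_upper {n : ℕ} (γ κ : ℝ) (q v : En n) (hq : q ≠ 0) :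
    ‖sg γ κ q v‖ ≤ ‖q‖ ^ (γ / 2) * (1 + |κ|) * ‖v‖ := by
  have hs : 0 ≤ ‖q‖ ^ (γ / 2) := by positivity
  have hu := unit_norm hq
  rw [sg_apply]
  obtain ⟨u, hu'⟩ : ∃ u, u = ‖q‖⁻¹ • q := ⟨_, rfl⟩
  rw [← hu'] at hu ⊢
  have := abs_real_inner_le_norm u v
  rw [hu, one_mul] at this
  rw [norm_smul, norm_eq_abs, abs_of_nonneg hs, mul_assoc]
  apply mul_le_mul_of_nonneg_left _ hs
  refine (norm_add_le _ _).trans ?_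
  rw [norm_smul, hu, mul_one, norm_eq_abs, abs_mul]
  nlinarith [mul_le_mul_of_nonneg_left this (abs_nonneg κ)]

theorem rpow_lip {a L s t : ℝ} (ha : -1 ≤ a) (ha' : a ≤ 0) (hL : 0 < L) (hs : L ≤ s) (hst : s ≤ t) :
    |s ^ a - t ^ a| ≤ L ^ a / L * (t - s) := by
  have hs0 : 0 < s := hL.trans_le hs
  have ht0 : 0 < t := hs0.trans_le hst
  have h1 : t ^ a ≤ s ^ a := Real.rpow_le_rpow_of_nonpos hs0 hst ha'
  have h2 : s ^ a ≤ L ^ a := Real.rpow_le_rpow_of_nonpos hL hs ha'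
  rw [abs_of_nonneg (by linarith)]
  have h3 : s / t ≤ (t / s) ^ a := by
    have : s / t = (t / s) ^ (-1 : ℝ) := by rw [Real.rpow_neg_one, inv_div]
    rw [this]
    exact Real.rpow_le_rpow_of_exponent_le ((one_le_div hs0).2 hst) ha
  have h4 : t ^ a = s ^ a * (t / s) ^ a := by
    rw [← Real.mul_rpow hs0.le (by positivity)]; congr 1; field_simp
  have hsa : 0 < s ^ a := Real.rpow_pos_of_pos hs0 _
  calc s ^ a - t ^ a = s ^ a * (1 - (t / s) ^ a) := by rw [h4]; ring
    _ ≤ s ^ a * (1 - s / t) := by gcongr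
    _ = s ^ a * ((t - s) / t) := by field_simp
    _ ≤ L ^ a * ((t - s) / L) := by
      have : 0 ≤ t - s := by linarith
      gcongr
      linarith
    _ = _ := by ring

theorem rpow_lip' {a L s t : ℝ} (ha : -1 ≤ a) (ha' : a ≤ 0) (hL : 0 < L) (hs : L ≤ s) (ht : L ≤ t) :
    |s ^ a - t ^ a| ≤ L ^ a / L * |s - t| := by
  rcases le_total s t with h | h
  · have := rpow_lip ha ha' hL hs h
    rwa [abs_sub_comm s t, abs_of_nonneg (by linarith : 0 ≤ t - s)]
  · have := rpow_lip ha ha' hL ht h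
    rwa [abs_sub_comm (s ^ a), abs_of_nonneg (by linarith : 0 ≤ s - t)]

theorem unit_diff {n : ℕ} {q₁ q₂ : En n} {L : ℝ} (hL : 0 < L) (h1 : L ≤ ‖q₁‖) (h2 : L ≤ ‖q₂‖) :
    ‖‖q₁‖⁻¹ • q₁ - ‖q₂‖⁻¹ • q₂‖ ≤ 2 / L * ‖q₁ - q₂‖ := by
  have p1 : 0 < ‖q₁‖ := hL.trans_le h1
  have p2 : 0 < ‖q₂‖ := hL.trans_le h2
  have e : ‖q₁‖⁻¹ • q₁ - ‖q₂‖⁻¹ • q₂ = ‖q₁‖⁻¹ • (q₁ - q₂) + (‖q₁‖⁻¹ - ‖q₂‖⁻¹) • q₂ := by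
    rw [smul_sub, sub_smul]; abel
  rw [e]
  refine (norm_add_le _ _).trans ?_
  rw [norm_smul, norm_smul, norm_inv, norm_norm, norm_eq_abs]
  have e2 : |‖q₁‖⁻¹ - ‖q₂‖⁻¹| * ‖q₂‖ = |‖q₂‖ - ‖q₁‖| * ‖q₁‖⁻¹ := by
    have : ‖q₁‖⁻¹ - ‖q₂‖⁻¹ = (‖q₂‖ - ‖q₁‖) * (‖q₁‖⁻¹ * ‖q₂‖⁻¹) := by field_simp
    rw [this, abs_mul, abs_of_pos (by positivity : 0 < ‖q₁‖⁻¹ * ‖q₂‖⁻¹)]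
    field_simp
  rw [e2]
  have e3 : |‖q₂‖ - ‖q₁‖| ≤ ‖q₁ - q₂‖ := by
    rw [norm_sub_rev]; exact abs_norm_sub_norm_le _ _
  have e4 : ‖q₁‖⁻¹ ≤ L⁻¹ := inv_anti₀ hL h1
  calc ‖q₁‖⁻¹ * ‖q₁ - q₂‖ + |‖q₂‖ - ‖q₁‖| * ‖q₁‖⁻¹ ≤ L⁻¹ * ‖q₁ - q₂‖ + ‖q₁ - q₂‖ * L⁻¹ := by gcongr
    _ = _ := by ring

theorem sg_lip {n : ℕ} {γ κ L : ℝ} (hγ : γ ∈ Ioo (-1 : ℝ) 0) {q₁ q₂ : En n} (hL : 0 < L)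
    (h1 : L ≤ ‖q₁‖) (h2 : L ≤ ‖q₂‖) (v : En n) :
    ‖sg γ κ q₁ v - sg γ κ q₂ v‖ ≤ L ^ (γ / 2) / L * (1 + 5 * |κ|) * ‖q₁ - q₂‖ * ‖v‖ := by
  have p1 : 0 < ‖q₁‖ := hL.trans_le h1
  have p2 : 0 < ‖q₂‖ := hL.trans_le h2
  have u1 := unit_norm (norm_pos_iff.1 p1)
  have u2 := unit_norm (norm_pos_iff.1 p2)
  have ud := unit_diff hL h1 h2
  have hl := rpow_lip' (a := γ / 2) (by linarith [hγ.1]) (by linarith [hγ.2]) hL h1 h2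
  have hs2 : ‖q₂‖ ^ (γ / 2) ≤ L ^ (γ / 2) :=
    Real.rpow_le_rpow_of_nonpos hL h2 (by linarith [hγ.2])
  have e3 : |‖q₁‖ - ‖q₂‖| ≤ ‖q₁ - q₂‖ := abs_norm_sub_norm_le _ _
  have hs0 : 0 ≤ ‖q₂‖ ^ (γ / 2) := by positivity
  have hLa : 0 ≤ L ^ (γ / 2) := by positivity
  rw [sg_apply, sg_apply]
  generalize ‖q₁‖ ^ (γ / 2) = s₁ at *
  generalize ‖q₂‖ ^ (γ / 2) = s₂ at *
  generalize ‖q₁‖⁻¹ • q₁ = a at *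
  generalize ‖q₂‖⁻¹ • q₂ = b at *
  generalize L ^ (γ / 2) = Λ at *
  have e : s₁ • (v + (κ * ⟪a, v⟫) • a) - s₂ • (v + (κ * ⟪b, v⟫) • b)
      = (s₁ - s₂) • (v + (κ * ⟪a, v⟫) • a) + (s₂ * κ) • (⟪a, v⟫ • (a - b) + ⟪a - b, v⟫ • b) := by
    rw [inner_sub_left]
    module
  rw [e]
  have i1 : |⟪a, v⟫| ≤ ‖v‖ := by have := abs_real_inner_le_norm a v; rwa [u1, one_mul] at this
  have i2 : |⟪a - b, v⟫| ≤ ‖a - b‖ * ‖v‖ := abs_real_inner_le_norm _ v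
  have n1 : ‖v + (κ * ⟪a, v⟫) • a‖ ≤ (1 + |κ|) * ‖v‖ := by
    refine (norm_add_le _ _).trans ?_
    rw [norm_smul, u1, mul_one, norm_eq_abs, abs_mul]
    nlinarith [mul_le_mul_of_nonneg_left i1 (abs_nonneg κ)]
  have n2 : ‖⟪a, v⟫ • (a - b) + ⟪a - b, v⟫ • b‖ ≤ 2 * ‖a - b‖ * ‖v‖ := by
    refine (norm_add_le _ _).trans ?_
    rw [norm_smul, norm_smul, u2, mul_one, norm_eq_abs, norm_eq_abs]
    nlinarith [mul_le_mul_of_nonneg_right i1 (norm_nonneg (a - b))]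
  refine (norm_add_le _ _).trans ?_
  rw [norm_smul, norm_smul, norm_eq_abs, norm_eq_abs, abs_mul, abs_of_nonneg hs0]
  calc |s₁ - s₂| * ‖v + (κ * ⟪a, v⟫) • a‖ + s₂ * |κ| * ‖⟪a, v⟫ • (a - b) + ⟪a - b, v⟫ • b‖
      ≤ (Λ / L * ‖q₁ - q₂‖) * ((1 + |κ|) * ‖v‖)
        + Λ * |κ| * (2 * (2 / L * ‖q₁ - q₂‖) * ‖v‖) := by
        gcongr
        · exact hl.trans (by gcongr)
        · exact n2.trans (by gcongr)
    _ = _ := by ring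

theorem opVal_sum {n : ℕ} {γ p κ : ℝ} (hκ : (1 + κ) ^ 2 = p - 1) {q : En n} (hq : q ≠ 0)
    (X : En n →L[ℝ] En n) (b : OrthonormalBasis (Fin n) ℝ (En n)) :
    opVal γ p q X = ∑ i, ⟪X (sg γ κ q (b i)), sg γ κ q (b i)⟫ := by
  have hu := unit_norm hq
  have hqq : 0 < ‖q‖ := norm_pos_iff.2 hq
  have hs : ‖q‖ ^ γ = ‖q‖ ^ (γ / 2) * ‖q‖ ^ (γ / 2) := by
    rw [← Real.rpow_add hqq]; congr 1; ring
  have hXq : (p - 2) * ⟪X q, q⟫ / ‖q‖ ^ 2 = (p - 2) * ⟪X (‖q‖⁻¹ • q), ‖q‖⁻¹ • q⟫ := by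
    rw [map_smul, inner_smul_left, inner_smul_right]; simp only [conj_trivial]; field_simp
  unfold opVal
  rw [hs, hXq, LinearMap.trace_eq_sum_inner _ b]
  simp only [sg_apply]
  generalize ‖q‖ ^ (γ / 2) = s
  generalize ‖q‖⁻¹ • q = u at *
  have hterm : ∀ i, ⟪X (s • (b i + (κ * ⟪u, b i⟫) • u)), s • (b i + (κ * ⟪u, b i⟫) • u)⟫
      = s * s * (⟪b i, X (b i)⟫ + κ * (⟪u, b i⟫ * ⟪b i, X.adjoint u⟫) + κ * (⟪u, b i⟫ * ⟪b i, X u⟫)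
        + κ ^ 2 * ⟪X u, u⟫ * (⟪u, b i⟫ * ⟪b i, u⟫)) := by
    intro i
    rw [map_smul, map_add, map_smul, inner_smul_left, inner_smul_right, inner_add_left,
      inner_add_right, inner_add_right, inner_smul_left, inner_smul_right, inner_smul_left,
      inner_smul_right, ContinuousLinearMap.adjoint_inner_right, real_inner_comm (b i) (X (b i)),
      real_inner_comm (b i) (X u), real_inner_comm (b i) u]
    simp only [conj_trivial]
    ring
  simp only [hterm]
  rw [← Finset.mul_sum, Finset.sum_add_distrib, Finset.sum_add_distrib, Finset.sum_add_distrib,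
    ← Finset.mul_sum, ← Finset.mul_sum, ← Finset.mul_sum, b.sum_inner_mul_inner,
    b.sum_inner_mul_inner, b.sum_inner_mul_inner, ContinuousLinearMap.adjoint_inner_right,
    real_inner_self_eq_norm_sq, hu, real_inner_comm (X u) u]
  have : p - 2 = 2 * κ + κ ^ 2 := by linarith
  rw [this]
  simp only [ContinuousLinearMap.coe_coe]
  ring

theorem op_diff {n : ℕ} (hn : 1 ≤ n) {γ p κ m L U g A ψ r : ℝ} (hγ : γ ∈ Ioo (-1 : ℝ) 0)
    (hκ : (1 + κ) ^ 2 = p - 1) (hm0 : 0 < m) (hm : m ≤ 1) (hm' : m ≤ 1 + κ)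
    (hL : 0 < L) {q₁ q₂ : En n} (h1 : L ≤ ‖q₁‖) (h2 : L ≤ ‖q₂‖) (h1' : ‖q₁‖ ≤ U) (h2' : ‖q₂‖ ≤ U)
    (hg : 0 ≤ g) (hA : 0 ≤ A) (hψ : ψ ≤ 0) {v : En n} (hr : 0 < r) (hv : ‖v‖ = r) {X Y : En n →L[ℝ] En n}
    (H1 : ∀ a b, ⟪X a, a⟫ - ⟪Y b, b⟫ ≤ g / r * ‖a - b‖ ^ 2 + A * ‖a‖ ^ 2)
    (H2 : ∀ a b, ∀ c : ℝ, a - b = c • v →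
        ⟪X a, a⟫ - ⟪Y b, b⟫ ≤ ψ * (c * r) ^ 2 + A * ‖a‖ ^ 2) :
    opVal γ p q₁ X - opVal γ p q₂ Y ≤ 4 * m ^ 2 * U ^ γ * ψ
      + n * (L ^ γ * (1 + 5 * |κ|) ^ 2 * (g / r * (‖q₁ - q₂‖ / L) ^ 2 + A)) := by
  have p1 : 0 < ‖q₁‖ := hL.trans_le h1
  have p2 : 0 < ‖q₂‖ := hL.trans_le h2
  have hq1 := norm_pos_iff.1 p1
  have hq2 := norm_pos_iff.1 p2
  have hU : 0 < U := p1.trans_le h1'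
  have hv0 : v ≠ 0 := by rw [← norm_pos_iff, hv]; exact hr
  have hμ : 0 < U ^ (γ / 2) * m := mul_pos (Real.rpow_pos_of_pos hU _) hm0
  have hlow : ∀ z : En n, 2 * (U ^ (γ / 2) * m) * ‖z‖ ^ 2 ≤ ⟪(sg γ κ q₁ + sg γ κ q₂) z, z⟫ := by
    intro z
    rw [LinearMap.add_apply, inner_add_left]
    have l1 := sg_lower γ κ m q₁ z hq1 hm hm'
    have l2 := sg_lower γ κ m q₂ z hq2 hm hm'
    have k1 : U ^ (γ / 2) * m * ‖z‖ ^ 2 ≤ ‖q₁‖ ^ (γ / 2) * m * ‖z‖ ^ 2 := by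
      have hh : U ^ (γ / 2) ≤ ‖q₁‖ ^ (γ / 2) :=
        Real.rpow_le_rpow_of_nonpos p1 h1' (by linarith [hγ.2])
      exact mul_le_mul_of_nonneg_right (mul_le_mul_of_nonneg_right hh hm0.le) (sq_nonneg _)
    have k2 : U ^ (γ / 2) * m * ‖z‖ ^ 2 ≤ ‖q₂‖ ^ (γ / 2) * m * ‖z‖ ^ 2 := by
      have hh : U ^ (γ / 2) ≤ ‖q₂‖ ^ (γ / 2) :=
        Real.rpow_le_rpow_of_nonpos p2 h2' (by linarith [hγ.2])
      exact mul_le_mul_of_nonneg_right (mul_le_mul_of_nonneg_right hh hm0.le) (sq_nonneg _)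
    linarith
  have hinj : Function.Injective (sg γ κ q₁ + sg γ κ q₂) := by
    rw [injective_iff_map_eq_zero]
    intro z hz
    have := hlow z
    rw [hz, inner_zero_left] at this
    by_contra hne
    have : 0 < ‖z‖ := norm_pos_iff.2 hne
    have : 0 < 2 * (U ^ (γ / 2) * m) * ‖z‖ ^ 2 := by positivity
    linarith
  obtain ⟨z, hz⟩ := (LinearMap.injective_iff_surjective.1 hinj) v
  have hz0 : z ≠ 0 := by
    rintro rfl
    rw [map_zero] at hz
    exact hv0 hz.symm
  have hzz := unit_norm hz0
  obtain ⟨ν, hν⟩ : ∃ ν, ν = ‖z‖⁻¹ • z := ⟨_, rfl⟩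
  rw [← hν] at hzz
  have hSν : (sg γ κ q₁ + sg γ κ q₂) ν = ‖z‖⁻¹ • v := by rw [hν, map_smul, hz]
  have i₀ : Fin n := ⟨0, hn⟩
  obtain ⟨b, hb⟩ := Orthonormal.exists_orthonormalBasis_extension_of_card_eq (𝕜 := ℝ) (E := En n)
    (ι := Fin n) (by simp) (v := fun _ => ν) (s := {i₀}) (by
      rw [orthonormal_iff_ite]
      rintro ⟨i, hi⟩ ⟨j, hj⟩
      simp only [mem_singleton_iff] at hi hj
      subst hi; subst hj
      simp [real_inner_self_eq_norm_sq, hzz])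
  have hbi : b i₀ = ν := hb i₀ rfl
  rw [opVal_sum hκ hq1 X b, opVal_sum hκ hq2 Y b, ← Finset.sum_sub_distrib]
  have hC : 1 + |κ| ≤ 1 + 5 * |κ| := by linarith [abs_nonneg κ]
  have hLγ : L ^ γ = L ^ (γ / 2) * L ^ (γ / 2) := by
    rw [← Real.rpow_add hL]; congr 1; ring
  have hUγ : U ^ γ = U ^ (γ / 2) * U ^ (γ / 2) := by
    rw [← Real.rpow_add hU]; congr 1; ring
  have hup : ∀ i, A * ‖sg γ κ q₁ (b i)‖ ^ 2 ≤ A * (L ^ γ * (1 + 5 * |κ|) ^ 2) := by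
    intro i
    have := sg_upper γ κ q₁ (b i) hq1
    rw [b.norm_eq_one, mul_one] at this
    have k : ‖sg γ κ q₁ (b i)‖ ≤ L ^ (γ / 2) * (1 + 5 * |κ|) := by
      refine this.trans ?_
      have hh : ‖q₁‖ ^ (γ / 2) ≤ L ^ (γ / 2) :=
        Real.rpow_le_rpow_of_nonpos hL h1 (by linarith [hγ.2])
      exact mul_le_mul hh hC (by positivity) (by positivity)
    gcongr
    calc _ ≤ (L ^ (γ / 2) * (1 + 5 * |κ|)) ^ 2 := by gcongr
      _ = _ := by rw [hLγ]; ring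
  have hT0 : 0 ≤ L ^ γ * (1 + 5 * |κ|) ^ 2 * (g / r * (‖q₁ - q₂‖ / L) ^ 2) := by positivity
  have hterm : ∀ i, ⟪X (sg γ κ q₁ (b i)), sg γ κ q₁ (b i)⟫ - ⟪Y (sg γ κ q₂ (b i)), sg γ κ q₂ (b i)⟫
      ≤ (if i = i₀ then 4 * m ^ 2 * U ^ γ * ψ else 0)
        + L ^ γ * (1 + 5 * |κ|) ^ 2 * (g / r * (‖q₁ - q₂‖ / L) ^ 2 + A) := by
    intro i
    split_ifs with hi
    · rw [hi, hbi]
      have hh := H2 (sg γ κ q₁ ν) (- sg γ κ q₂ ν) ‖z‖⁻¹ (by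
        rw [sub_neg_eq_add, ← hSν, LinearMap.add_apply])
      rw [map_neg, inner_neg_neg] at hh
      have hu := hup i₀
      rw [hbi] at hu
      have hl := hlow ν
      rw [hzz, hSν] at hl
      have hcs := real_inner_le_norm (‖z‖⁻¹ • v) ν
      rw [hzz, norm_smul, norm_inv, norm_norm, hv] at hcs
      have hsq : (2 * (U ^ (γ / 2) * m)) ^ 2 ≤ (‖z‖⁻¹ * r) ^ 2 := by
        apply pow_le_pow_left₀ (by positivity)
        linarith
      have e : (2 * (U ^ (γ / 2) * m)) ^ 2 = 4 * m ^ 2 * U ^ γ := by rw [hUγ]; ring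
      rw [e] at hsq
      have := mul_le_mul_of_nonpos_left hsq hψ
      linarith
    · have hh := H1 (sg γ κ q₁ (b i)) (sg γ κ q₂ (b i))
      have hu := hup i
      have hl := sg_lip (κ := κ) hγ hL h1 h2 (b i)
      rw [b.norm_eq_one, mul_one] at hl
      have hl2 : g / r * ‖sg γ κ q₁ (b i) - sg γ κ q₂ (b i)‖ ^ 2
          ≤ L ^ γ * (1 + 5 * |κ|) ^ 2 * (g / r * (‖q₁ - q₂‖ / L) ^ 2) := by
        calc _ ≤ g / r * (L ^ (γ / 2) / L * (1 + 5 * |κ|) * ‖q₁ - q₂‖) ^ 2 := by gcongr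
          _ = _ := by rw [hLγ]; ring
      linarith
  refine (Finset.sum_le_sum fun i _ => hterm i).trans (le_of_eq ?_)
  rw [Finset.sum_add_distrib, Finset.sum_ite_eq' Finset.univ i₀]
  simp


theorem sqrt_sec {r x : ℝ} (hr : 0 < r) (hx : |x| ≤ r) :
    √(r + x) + √(r - x) - 2 * √r ≤ -1 / (4 * (r * √r)) * x ^ 2 := by
  obtain ⟨h1, h2⟩ := abs_le.1 hx
  have ha := Real.sqrt_nonneg (r + x)
  have hb := Real.sqrt_nonneg (r - x)
  have hs := Real.sqrt_pos.2 hr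
  have ha2 := Real.sq_sqrt (show 0 ≤ r + x by linarith)
  have hb2 := Real.sq_sqrt (show 0 ≤ r - x by linarith)
  have hs2 := Real.sq_sqrt hr.le
  generalize √(r + x) = a at *
  generalize √(r - x) = b at *
  generalize √r = s at *
  have hrs : r = s ^ 2 := hs2.symm
  obtain ⟨P, hP⟩ : ∃ P, P = a * b := ⟨_, rfl⟩
  have hP0 : 0 ≤ P := by rw [hP]; positivity
  have hx2 : x ^ 2 = s ^ 4 - P ^ 2 := by
    have : P ^ 2 = (r + x) * (r - x) := by rw [hP, mul_pow, ha2, hb2]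
    rw [this, hrs]; ring
  have hPs : P ≤ s ^ 2 := by
    apply abs_le_of_sq_le_sq' _ (by positivity) |>.2
    nlinarith [sq_nonneg x]
  have hT2 : (a + b) ^ 2 = 2 * s ^ 2 + 2 * P := by nlinarith
  have hT : (a + b) * s ≤ (3 * s ^ 2 + P) / 2 := by
    apply abs_le_of_sq_le_sq' _ (by positivity) |>.2
    rw [mul_pow, hT2]
    nlinarith [sq_nonneg (s ^ 2 - P)]
  rw [hx2, hrs, div_mul_eq_mul_div, le_div_iff₀ (by positivity)]
  have : (a + b - 2 * s) * s ≤ -(s ^ 2 - P) / 2 := by nlinarith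
  have h3 := mul_le_mul_of_nonneg_right this (show 0 ≤ 4 * s ^ 2 by positivity)
  nlinarith [mul_nonneg (sub_nonneg.2 hPs) (sub_nonneg.2 hPs)]

theorem cube_sec {r x : ℝ} (hr : 0 < r) (hx : |x| ≤ r) :
    2 * (r * √r) + x ^ 2 / (2 * √r) ≤ (r + x) * √(r + x) + (r - x) * √(r - x) := by
  obtain ⟨h1, h2⟩ := abs_le.1 hx
  have ha := Real.sqrt_nonneg (r + x)
  have hb := Real.sqrt_nonneg (r - x)
  have hs := Real.sqrt_pos.2 hr
  have ha2 := Real.sq_sqrt (show 0 ≤ r + x by linarith)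
  have hb2 := Real.sq_sqrt (show 0 ≤ r - x by linarith)
  have hs2 := Real.sq_sqrt hr.le
  generalize √(r + x) = a at *
  generalize √(r - x) = b at *
  generalize √r = s at *
  have hrs : r = s ^ 2 := hs2.symm
  obtain ⟨P, hP⟩ : ∃ P, P = a * b := ⟨_, rfl⟩
  have hP0 : 0 ≤ P := by rw [hP]; positivity
  have hx2 : x ^ 2 = s ^ 4 - P ^ 2 := by
    have : P ^ 2 = (r + x) * (r - x) := by rw [hP, mul_pow, ha2, hb2]
    rw [this, hrs]; ring
  have hPs : P ≤ s ^ 2 := by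
    apply abs_le_of_sq_le_sq' _ (by positivity) |>.2
    nlinarith [sq_nonneg x]
  have hT2 : (a + b) ^ 2 = 2 * s ^ 2 + 2 * P := by nlinarith
  have hT : (7 * s ^ 2 + 3 * P) / 5 ≤ (a + b) * s := by
    apply abs_le_of_sq_le_sq' _ (by positivity) |>.2
    rw [mul_pow, hT2]
    nlinarith [mul_nonneg (sub_nonneg.2 hPs) hP0, mul_nonneg (sub_nonneg.2 hPs) (sq_nonneg s)]
  have e : (r + x) * a + (r - x) * b = (a + b) * (2 * s ^ 2 - P) := by
    have e1 : r + x = a ^ 2 := ha2.symm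
    have e2 : r - x = b ^ 2 := hb2.symm
    have e3 : 2 * s ^ 2 = a ^ 2 + b ^ 2 := by linarith
    rw [e1, e2, e3, hP]; ring
  rw [e, hx2, hrs, ← le_sub_iff_add_le', div_le_iff₀ (by positivity)]
  have h3 := mul_le_mul_of_nonneg_right hT (show 0 ≤ 2 * s ^ 2 - P by linarith [sq_nonneg s])
  nlinarith [mul_nonneg (sub_nonneg.2 hPs) hP0, mul_nonneg (sub_nonneg.2 hPs) (sq_nonneg s)]

theorem sqrt_tan {r r' : ℝ} (hr : 0 < r) (hr' : 0 ≤ r') : √r' ≤ √r + 1 / (2 * √r) * (r' - r) := by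
  have ha2 := Real.sq_sqrt hr'
  have hs2 := Real.sq_sqrt hr.le
  have hs := Real.sqrt_pos.2 hr
  generalize √r' = a at *
  generalize √r = s at *
  rw [← sub_nonneg]
  have : s + 1 / (2 * s) * (r' - r) - a = (a - s) ^ 2 / (2 * s) := by
    rw [← ha2, ← hs2]; field_simp; ring
  rw [this]; positivity

theorem cube_tan {r r' : ℝ} (hr : 0 < r) (hr' : 0 ≤ r') :
    r * √r + 3 / 2 * √r * (r' - r) ≤ r' * √r' := by
  have ha2 := Real.sq_sqrt hr'
  have hs2 := Real.sq_sqrt hr.le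
  have hs := Real.sqrt_pos.2 hr
  have ha := Real.sqrt_nonneg r'
  generalize √r' = a at *
  generalize √r = s at *
  rw [← ha2, ← hs2]
  nlinarith [mul_nonneg (sq_nonneg (a - s)) (show 0 ≤ a + s / 2 by linarith)]


theorem q_bounds {n : ℕ} {q₁ q₂ K u a : En n} {r : ℝ} (h1 : ‖q₁ - (K + u + a)‖ ≤ r)
    (h2 : ‖q₂ - (K + u)‖ ≤ r) : ‖q₁ - q₂‖ ≤ 2 * r + ‖a‖ ∧
    ‖u‖ - ‖K‖ - r - ‖a‖ ≤ ‖q₁‖ ∧ ‖u‖ - ‖K‖ - r - ‖a‖ ≤ ‖q₂‖ ∧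
    ‖K‖ - ‖u‖ - r - ‖a‖ ≤ ‖q₁‖ ∧ ‖K‖ - ‖u‖ - r - ‖a‖ ≤ ‖q₂‖ ∧
    ‖q₁‖ ≤ ‖K‖ + ‖u‖ + r + ‖a‖ ∧ ‖q₂‖ ≤ ‖K‖ + ‖u‖ + r + ‖a‖ := by
  obtain ⟨d₁, hd₁⟩ : ∃ d, d = q₁ - (K + u + a) := ⟨_, rfl⟩
  obtain ⟨d₂, hd₂⟩ : ∃ d, d = q₂ - (K + u) := ⟨_, rfl⟩
  rw [← hd₁] at h1
  rw [← hd₂] at h2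
  have ha := norm_nonneg a
  refine ⟨?_, ?_, ?_, ?_, ?_, ?_, ?_⟩
  · have : q₁ - q₂ = d₁ - d₂ + a := by rw [hd₁, hd₂]; abel
    rw [this]
    linarith [norm_add_le (d₁ - d₂) a, norm_sub_le d₁ d₂]
  · have : u = q₁ - K - a - d₁ := by rw [hd₁]; abel
    have h := congrArg norm this
    linarith [norm_sub_le (q₁ - K - a) d₁, norm_sub_le (q₁ - K) a, norm_sub_le q₁ K]
  · have : u = q₂ - K - d₂ := by rw [hd₂]; abel
    have h := congrArg norm this
    linarith [norm_sub_le (q₂ - K) d₂, norm_sub_le q₂ K]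
  · have : K = q₁ - u - a - d₁ := by rw [hd₁]; abel
    have h := congrArg norm this
    linarith [norm_sub_le (q₁ - u - a) d₁, norm_sub_le (q₁ - u) a, norm_sub_le q₁ u]
  · have : K = q₂ - u - d₂ := by rw [hd₂]; abel
    have h := congrArg norm this
    linarith [norm_sub_le (q₂ - u) d₂, norm_sub_le q₂ u]
  · have : q₁ = d₁ + K + u + a := by rw [hd₁]; abel
    have h := congrArg norm this
    linarith [norm_add_le (d₁ + K + u) a, norm_add_le (d₁ + K) u, norm_add_le d₁ K]
  · have : q₂ = d₂ + K + u := by rw [hd₂]; abel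
    have h := congrArg norm this
    linarith [norm_add_le (d₂ + K) u, norm_add_le d₂ K]

theorem in_cyl {n : ℕ} {R₀ R : ℝ} (hR₀ : R₀ ≤ 7 / 8) (hR : R₀ + 1 / 16 ≤ R) (hR' : R₀ ^ 2 + 1 / 32 ≤ R ^ 2)
    {x y x₀ : En n} {t t₀ : ℝ} (hx₀ : (x₀, t₀) ∈ pCyl n R₀) (h1 : ‖x - y‖ < 1 / 32)
    (h2 : ‖x - x₀‖ < 1 / 32) (h3 : t₀ - 1 / 32 < t) (h4 : t < 0) :
    (x, t) ∈ pCyl n R ∧ (y, t) ∈ pCyl n R := by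
  obtain ⟨hx1, hx2, hx3⟩ := hx₀
  simp only at hx1 hx2 hx3
  have e1 := norm_le_insert' x x₀
  have e2 := norm_le_insert x y
  exact ⟨⟨show ‖x‖ < R by linarith, show -R ^ 2 < t by linarith, h4⟩,
    ⟨show ‖y‖ < R by linarith, show -R ^ 2 < t by linarith, h4⟩⟩

/-- Final algebra of the first step. -/
theorem contra1 {N C m γ g δ A η : ℝ} (hγ : γ ∈ Ioo (-1 : ℝ) 0) (hN : 0 ≤ N)
    (hg : 1 ≤ g) (hδ : 0 ≤ δ) (hδ1 : δ ≤ 1) (hA1 : A ≤ 1)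
    (hη : 9000 * η ≤ 1) (hbig : 34 * (N * C ^ 2) + 1 < 4 * m ^ 2 * g)
    (h : -(9000 * η) ≤ 4 * m ^ 2 * (2 * g) ^ γ * (-(2 * g ^ 3))
      + N * ((g / 2) ^ γ * C ^ 2 * (4 * g ^ 3 * (δ / (g / 2)) ^ 2 + A))) : False := by
  have hg0 : 0 < g := by linarith
  have e1 : (2 * g) ^ γ = 2 ^ γ * g ^ γ := Real.mul_rpow (by norm_num) hg0.le
  have e2 : (g / 2) ^ γ = g ^ γ / 2 ^ γ := Real.div_rpow hg0.le (by norm_num) _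
  have t1 : (1 / 2 : ℝ) ≤ 2 ^ γ := by
    calc (1 / 2 : ℝ) = 2 ^ (-1 : ℝ) := by rw [Real.rpow_neg_one]; norm_num
      _ ≤ _ := Real.rpow_le_rpow_of_exponent_le (by norm_num) hγ.1.le
  have t2 : 1 ≤ g ^ γ * g := by
    calc (1 : ℝ) = g ^ (-1 : ℝ) * g := by rw [Real.rpow_neg_one]; field_simp
      _ ≤ _ := by
        gcongr ?_ * g
        exact Real.rpow_le_rpow_of_exponent_le hg hγ.1.le
  have hG : 0 < g ^ γ := Real.rpow_pos_of_pos hg0 _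
  rw [e1, e2] at h
  have e3 : 4 * g ^ 3 * (δ / (g / 2)) ^ 2 = 16 * g * δ ^ 2 := by field_simp; ring
  rw [e3] at h
  generalize (2 : ℝ) ^ γ = T at *
  generalize g ^ γ = G at *
  have hT0 : 0 < T := by linarith
  have b1 : G / T ≤ 2 * G := by
    rw [div_le_iff₀ hT0]; nlinarith
  have hd2 : δ ^ 2 ≤ 1 := by nlinarith
  have b2 : 16 * g * δ ^ 2 + A ≤ 17 * g := by nlinarith
  have b3 : N * (G / T * C ^ 2 * (16 * g * δ ^ 2 + A)) ≤ N * (2 * G * C ^ 2 * (17 * g)) := by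
    apply mul_le_mul_of_nonneg_left _ hN
    calc G / T * C ^ 2 * (16 * g * δ ^ 2 + A) ≤ G / T * C ^ 2 * (17 * g) := by gcongr
      _ ≤ _ := by gcongr
  have b4 : 4 * m ^ 2 * (1 / 2 * G) * (2 * g ^ 3) ≤ 4 * m ^ 2 * (T * G) * (2 * g ^ 3) := by gcongr
  have b5 : (34 * (N * C ^ 2) + 1) * (G * g) < 4 * m ^ 2 * g * (G * g) := by gcongr
  have b6 : 4 * m ^ 2 * g * (G * g) ≤ 4 * m ^ 2 * g * (G * g) * g :=
    le_mul_of_one_le_right (by positivity) hg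
  have b7 : 4 * m ^ 2 * (1 / 2 * G) * (2 * g ^ 3) = 4 * m ^ 2 * g * (G * g) * g := by ring
  have b8 : N * (2 * G * C ^ 2 * (17 * g)) = 34 * (N * C ^ 2) * (G * g) := by ring
  linarith

theorem holder_step {n : ℕ} (hn : 1 ≤ n) {γ p κ m M η : ℝ} (hγ : γ ∈ Ioo (-1 : ℝ) 0)
    (hκ : (1 + κ) ^ 2 = p - 1) (hm0 : 0 < m) (hm : m ≤ 1) (hm' : m ≤ 1 + κ)
    (hM : 2 ≤ M) (hη : 0 < η) (hη1 : η ≤ 1 / 10 ^ 6) (hη2 : M + 1 ≤ 1 / (4 * η) / 2)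
    (hη3 : 34 * (n * (1 + 5 * |κ|) ^ 2) + 1 < 4 * m ^ 2 * (1 / (4 * η)))
    {K : En n} {w f : En n × ℝ → ℝ} (hK : ‖K‖ ≤ M) (hsol : IsDevSol γ p K f w (pCyl n 1))
    (hw : ∀ z ∈ pCyl n 1, |w z| ≤ η) (hf : ∀ z ∈ pCyl n 1, |f z| ≤ η)
    (x₀ y₀ : En n) (t₀ : ℝ) (hx₀ : (x₀, t₀) ∈ pCyl n (7 / 8)) (hy₀ : (y₀, t₀) ∈ pCyl n (7 / 8)) :
    w (x₀, t₀) - w (y₀, t₀) ≤ √‖x₀ - y₀‖ := by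
  by_contra! hcon
  obtain ⟨x, y, t, q₁, q₂, X, Y, hr, hr1, hx, ht, ht0, hval, hq1, hq2, H1, H2, H3⟩ :=
    doubling_pde hη le_rfl hsol hw hf (fun s => √s) (fun r => 1 / (2 * √r)) (fun r => -1 / (4 * (r * √r)))
      Real.continuous_sqrt.continuousOn (fun s _ => Real.sqrt_nonneg s)
      (by
        intro s hs h
        have h2 := Real.sq_sqrt hs.1
        have h0 := Real.sqrt_nonneg s
        try simp only at h
        have : √s < 1 / 100 := by linarith
        nlinarith)
      (fun r hr r' hr' => sqrt_tan hr.1 hr'.1)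
      (fun r hr => by positivity)
      (by
        intro a ha b hb hab
        have : 0 < √a := Real.sqrt_pos.2 ha.1
        have h2 := Real.sqrt_le_sqrt hab
        try simp only
        gcongr)
      (fun r hr x hx => sqrt_sec hr.1 hx) x₀ y₀ t₀ hx₀ hy₀ hcon
  try simp only at hval hq1 hq2 H1 H2
  obtain ⟨c1, c2⟩ := in_cyl (R := 1) le_rfl (by norm_num) (by norm_num) hx₀ hr1 hx ht ht0
  have w1 := abs_le.1 (hw _ c1)
  have w2 := abs_le.1 (hw _ c2)
  obtain ⟨v, hv⟩ : ∃ v, v = x - y := ⟨_, rfl⟩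
  rw [← hv] at hr hr1 hval hq1 hq2 H1 H2
  obtain ⟨r, hrv⟩ : ∃ r, r = ‖v‖ := ⟨_, rfl⟩
  rw [← hrv] at hr hr1 hval hq1 hq2 H1 H2
  have hs := Real.sqrt_pos.2 hr
  have hs2 := Real.sq_sqrt hr.le
  generalize √r = s at *
  obtain ⟨g, hg⟩ : ∃ g, g = 1 / (2 * s) := ⟨_, rfl⟩
  rw [← hg] at hq1 hq2 H1
  have hx0 : 0 ≤ 4096 * η / 2 * ‖x - x₀‖ ^ 2 := by positivity
  have hsη : s < 2 * η := by linarith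
  have hgg : 1 / (4 * η) ≤ g := by
    rw [hg]; apply one_div_le_one_div_of_le (by positivity); linarith
  have hg1 : 2 * (M + 1) ≤ g := by linarith
  have hg0 : 0 < g := by linarith
  have hsg : s = 1 / (2 * g) := by rw [hg]; field_simp
  have hrg : r = 1 / (4 * g ^ 2) := by rw [← hs2, hsg]; field_simp; norm_num
  have hu : ‖(g / r) • v‖ = g := by
    rw [norm_smul, ← hrv, norm_eq_abs, abs_of_pos (by positivity)]; field_simp
  have ha : ‖(4096 * η) • (x - x₀)‖ ≤ 1 / 4 := by
    rw [norm_smul, norm_eq_abs, abs_of_pos (by positivity)]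
    calc 4096 * η * ‖x - x₀‖ ≤ 4096 * (1 / 10 ^ 6) * (1 / 32) := by gcongr
      _ ≤ _ := by norm_num
  obtain ⟨k1, k2, k3, -, -, k6, k7⟩ := q_bounds hq1 hq2
  rw [hu] at k2 k3 k6 k7
  have l1 : g / 2 ≤ ‖q₁‖ := by linarith
  have l2 : g / 2 ≤ ‖q₂‖ := by linarith
  have l3 : ‖q₁‖ ≤ 2 * g := by linarith
  have l4 : ‖q₂‖ ≤ 2 * g := by linarith
  have hψ : -1 / (4 * (r * s)) = -(2 * g ^ 3) := by
    rw [hrg, hsg]; field_simp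
  rw [hψ] at H2
  have hop := op_diff hn hγ hκ hm0 hm hm' (half_pos hg0) l1 l2 l3 l4 hg0.le
    (show 0 ≤ 4096 * η by positivity) (by have : 0 < g ^ 3 := by positivity
                                          linarith) hr hrv.symm H1 H2
  have hq10 : q₁ ≠ 0 := norm_pos_iff.1 ((half_pos hg0).trans_le l1)
  have hq20 : q₂ ≠ 0 := norm_pos_iff.1 ((half_pos hg0).trans_le l2)
  have hop2 := (H3 hq10 hq20).trans hop
  have hgr : g / r = 4 * g ^ 3 := by rw [hrg]; field_simp
  rw [hgr] at hop2
  refine contra1 hγ (Nat.cast_nonneg n) (by linarith) (norm_nonneg (q₁ - q₂)) (by linarith)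
    (by linarith) (by linarith) (hη3.trans_le ?_) hop2
  gcongr

set_option maxHeartbeats 1000000 in
theorem lip_step {n : ℕ} (hn : 1 ≤ n) {γ p κ m M η : ℝ} (hγ : γ ∈ Ioo (-1 : ℝ) 0)
    (hκ : (1 + κ) ^ 2 = p - 1) (hm0 : 0 < m) (hm : m ≤ 1) (hm' : m ≤ 1 + κ)
    (hM : 2 ≤ M) (hη : 0 < η) (hη1 : η ≤ 1 / 10 ^ 6)
    (hη4 : η * (n * (1 + 5 * |κ|) ^ 2 * 12320 + 9000) < m ^ 2 * (M + 2) ^ γ / 4)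
    {K : En n} {w f : En n × ℝ → ℝ} (hK2 : 2 ≤ ‖K‖) (hK : ‖K‖ ≤ M) (hsol : IsDevSol γ p K f w (pCyl n 1))
    (hw : ∀ z ∈ pCyl n 1, |w z| ≤ η) (hf : ∀ z ∈ pCyl n 1, |f z| ≤ η)
    (hhold : ∀ (x y : En n) (t : ℝ), (x, t) ∈ pCyl n (7 / 8) → (y, t) ∈ pCyl n (7 / 8) →
      w (x, t) - w (y, t) ≤ √‖x - y‖)
    (x₀ y₀ : En n) (t₀ : ℝ) (hx₀ : (x₀, t₀) ∈ pCyl n (3 / 4)) (hy₀ : (y₀, t₀) ∈ pCyl n (3 / 4)) :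
    w (x₀, t₀) - w (y₀, t₀) ≤ ‖x₀ - y₀‖ := by
  by_contra! hcon'
  have hcon : ‖x₀ - y₀‖ / 2 - ‖x₀ - y₀‖ * √‖x₀ - y₀‖ / 8 < w (x₀, t₀) - w (y₀, t₀) := by
    have : 0 ≤ ‖x₀ - y₀‖ * √‖x₀ - y₀‖ := by positivity
    linarith [norm_nonneg (x₀ - y₀)]
  have hsq2 : ∀ s ∈ Icc (0:ℝ) 2, √s ≤ 3 / 2 := by
    intro s hs
    rw [Real.sqrt_le_left (by norm_num)]
    linarith [hs.2]
  have hlow : ∀ s ∈ Icc (0:ℝ) 2, s / 4 ≤ s / 2 - s * √s / 8 := by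
    intro s hs
    nlinarith [mul_le_mul_of_nonneg_left (hsq2 s hs) hs.1, hs.1]
  obtain ⟨x, y, t, q₁, q₂, X, Y, hr, hr1, hx, ht, ht0, hval, hq1, hq2, H1, H2, H3⟩ :=
    doubling_pde hη (by norm_num) hsol hw hf (fun s => s / 2 - s * √s / 8) (fun r => 1 / 2 - 3 / 16 * √r)
      (fun r => -(1 / (16 * √r)))
      (by fun_prop) (fun s hs => le_trans (by linarith [hs.1]) (hlow s hs))
      (by
        intro s hs h
        have := hlow s hs
        try simp only at h
        linarith)
      (fun r hr r' hr' => by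
        have := cube_tan hr.1 hr'.1
        try simp only
        linarith)
      (fun r hr => by
        have := hsq2 r ⟨hr.1.le, hr.2⟩
        try simp only
        linarith)
      (by
        intro a ha b hb hab
        have h2 := Real.sqrt_le_sqrt hab
        try simp only
        linarith)
      (fun r hr x hx => by
        have := cube_sec hr.1 hx
        have e : x ^ 2 / (2 * √r) = 8 * (1 / (16 * √r) * x ^ 2) := by ring
        rw [e] at this
        try simp only
        linarith) x₀ y₀ t₀ hx₀ hy₀ hcon
  try simp only at hval hq1 hq2 H1 H2
  obtain ⟨c1, c2⟩ := in_cyl (R := 1) (by norm_num) (by norm_num) (by norm_num) hx₀ hr1 hx ht ht0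
  obtain ⟨c3, c4⟩ := in_cyl (R := 7 / 8) (by norm_num) (by norm_num) (by norm_num) hx₀ hr1 hx ht ht0
  have w1 := abs_le.1 (hw _ c1)
  have w2 := abs_le.1 (hw _ c2)
  have w3 := hhold _ _ _ c3 c4
  obtain ⟨v, hv⟩ : ∃ v, v = x - y := ⟨_, rfl⟩
  rw [← hv] at hr hr1 hval hq1 hq2 H1 H2 w3
  obtain ⟨r, hrv⟩ : ∃ r, r = ‖v‖ := ⟨_, rfl⟩
  rw [← hrv] at hr hr1 hval hq1 hq2 H1 H2 w3
  have hlr := hlow r ⟨hr.le, by linarith⟩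
  have hs := Real.sqrt_pos.2 hr
  have hs2 := Real.sq_sqrt hr.le
  have hs1 := hsq2 r ⟨hr.le, by linarith⟩
  generalize √r = s at *
  obtain ⟨g, hg⟩ : ∃ g, g = 1 / 2 - 3 / 16 * s := ⟨_, rfl⟩
  rw [← hg] at hq1 hq2 H1
  have hg0 : 0 < g := by linarith
  have hg1 : g ≤ 1 / 2 := by linarith
  have hx0 : 0 ≤ 4096 * η / 2 * ‖x - x₀‖ ^ 2 := by positivity
  have hrη : r < 8 * η := by linarith
  have hxs : 4096 * η / 2 * ‖x - x₀‖ ^ 2 ≤ s := by linarith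
  have hu : ‖(g / r) • v‖ = g := by
    rw [norm_smul, ← hrv, norm_eq_abs, abs_of_pos (by positivity)]; field_simp
  have hae : ‖(4096 * η) • (x - x₀)‖ = 4096 * η * ‖x - x₀‖ := by
    rw [norm_smul, norm_eq_abs, abs_of_pos (by positivity)]
  have ha : ‖(4096 * η) • (x - x₀)‖ ≤ 1 / 4 := by
    rw [hae]
    calc 4096 * η * ‖x - x₀‖ ≤ 4096 * (1 / 10 ^ 6) * (1 / 32) := by gcongr
      _ ≤ _ := by norm_num
  obtain ⟨k1, -, -, k2, k3, k6, k7⟩ := q_bounds hq1 hq2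
  rw [hu] at k2 k3 k6 k7
  have l1 : 1 ≤ ‖q₁‖ := by linarith
  have l2 : 1 ≤ ‖q₂‖ := by linarith
  have l3 : ‖q₁‖ ≤ M + 2 := by linarith
  have l4 : ‖q₂‖ ≤ M + 2 := by linarith
  have hop := op_diff hn hγ hκ hm0 hm hm' one_pos l1 l2 l3 l4 hg0.le
    (show 0 ≤ 4096 * η by positivity) (show -(1 / (16 * s)) ≤ 0 by
      rw [neg_nonpos]; positivity) hr hrv.symm H1 H2
  have hq10 : q₁ ≠ 0 := norm_pos_iff.1 (one_pos.trans_le l1)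
  have hq20 : q₂ ≠ 0 := norm_pos_iff.1 (one_pos.trans_le l2)
  have hop2 := (H3 hq10 hq20).trans hop
  rw [Real.one_rpow, one_mul, div_one] at hop2
  have hδ : ‖q₁ - q₂‖ ^ 2 ≤ 16384 * η * s + 8 * r ^ 2 := by
    rw [hae] at k1
    have e1 : ‖q₁ - q₂‖ ^ 2 ≤ (2 * r + 4096 * η * ‖x - x₀‖) ^ 2 := by gcongr
    have e2 := mul_le_mul_of_nonneg_left hxs (show 0 ≤ 16384 * η by positivity)
    have e3 := sq_nonneg (2 * r - 4096 * η * ‖x - x₀‖)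
    linarith
  clear H1 H2 H3 hop hhold hsol hw hf hcon hcon' hlow hsq2 k1 k2 k3 k6 k7 hq1 hq2 w1 w2 w3 c1 c2 c3 c4
  have hs1' : s ≤ 1 := by nlinarith
  have hr1' : r ≤ 1 := by linarith
  have hb : g / r * ‖q₁ - q₂‖ ^ 2 + 4096 * η ≤ 12320 * η / s := by
    rw [le_div_iff₀ hs]
    have e1 : g / r * ‖q₁ - q₂‖ ^ 2 ≤ 1 / 2 / r * (16384 * η * s + 8 * r ^ 2) := by gcongr
    have e2 : 1 / 2 / r * (16384 * η * s + 8 * r ^ 2) * s = 8192 * η + 4 * r * s := by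
      rw [← hs2]; field_simp; ring
    have e3 := mul_le_mul_of_nonneg_right e1 hs.le
    rw [e2] at e3
    nlinarith [mul_le_mul_of_nonneg_left hs1' hr.le, mul_le_mul_of_nonneg_left hs1' hη.le]
  have hb2 : (n:ℝ) * ((1 + 5 * |κ|) ^ 2 * (g / r * ‖q₁ - q₂‖ ^ 2 + 4096 * η))
      ≤ (n:ℝ) * ((1 + 5 * |κ|) ^ 2 * (12320 * η / s)) := by gcongr
  have hfin := hop2.trans (add_le_add_right hb2 _)
  have hfin2 := mul_le_mul_of_nonneg_right hfin hs.le
  have e4 : (4 * m ^ 2 * (M + 2) ^ γ * -(1 / (16 * s))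
      + (n:ℝ) * ((1 + 5 * |κ|) ^ 2 * (12320 * η / s))) * s
      = -(m ^ 2 * (M + 2) ^ γ / 4) + η * (n * (1 + 5 * |κ|) ^ 2 * 12320) := by
    field_simp; ring
  rw [e4] at hfin2
  have e5 : 9000 * η * s ≤ 9000 * η := by nlinarith
  linarith

theorem main_aux (n : ℕ) (hn : 1 ≤ n) (γ p M : ℝ) (hγ : γ ∈ Set.Ioo (-1 : ℝ) 0) (hp : 1 < p)
    (hM : 2 ≤ M) :
    ∃ η₁ : ℝ, 0 < η₁ ∧
      ∀ (K : En n) (w f : En n × ℝ → ℝ),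
        2 ≤ ‖K‖ → ‖K‖ ≤ M →
        IsDevSol γ p K f w (pCyl n 1) →
        (∀ z ∈ pCyl n 1, |w z| ≤ η₁) →
        (∀ z ∈ pCyl n 1, |f z| ≤ η₁) →
        ∀ (x y : En n) (t : ℝ), (x, t) ∈ pCyl n (3/4) → (y, t) ∈ pCyl n (3/4) →
          |w (x, t) - w (y, t)| ≤ ‖x - y‖ := by
  obtain ⟨κ, hκd⟩ : ∃ κ, κ = √(p - 1) - 1 := ⟨_, rfl⟩
  have hκ : (1 + κ) ^ 2 = p - 1 := by
    rw [hκd, add_sub_cancel, Real.sq_sqrt (by linarith)]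
  have hsp : 0 < √(p - 1) := Real.sqrt_pos.2 (by linarith)
  obtain ⟨m, hmd⟩ : ∃ m, m = min 1 (1 + κ) := ⟨_, rfl⟩
  have hm0 : 0 < m := by rw [hmd]; exact lt_min one_pos (by rw [hκd]; linarith)
  have hm : m ≤ 1 := by rw [hmd]; exact min_le_left _ _
  have hm' : m ≤ 1 + κ := by rw [hmd]; exact min_le_right _ _
  obtain ⟨a, had⟩ : ∃ a : ℝ, a = 34 * (n * (1 + 5 * |κ|) ^ 2) + 1 := ⟨_, rfl⟩
  obtain ⟨b, hbd⟩ : ∃ b : ℝ, b = n * (1 + 5 * |κ|) ^ 2 * 12320 + 9000 := ⟨_, rfl⟩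
  obtain ⟨c, hcd⟩ : ∃ c : ℝ, c = m ^ 2 * (M + 2) ^ γ / 4 := ⟨_, rfl⟩
  have ha0 : 0 < a := by rw [had]; positivity
  have hb0 : 0 < b := by rw [hbd]; positivity
  have hc0 : 0 < c := by
    have : 0 < (M + 2) ^ γ := Real.rpow_pos_of_pos (by linarith) _
    rw [hcd]; positivity
  obtain ⟨η, hη⟩ : ∃ η, η = min (min (1 / 10 ^ 6) (1 / (8 * (M + 1)))) (min (m ^ 2 / (2 * a)) (c / (2 * b))) := ⟨_, rfl⟩
  have h0 : 0 < η := by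
    have : 0 < M + 1 := by linarith
    rw [hη]; refine lt_min (lt_min ?_ ?_) (lt_min ?_ ?_) <;> positivity
  have h1 : η ≤ 1 / 10 ^ 6 := by rw [hη]; exact (min_le_left _ _).trans (min_le_left _ _)
  have h2 : η ≤ 1 / (8 * (M + 1)) := by rw [hη]; exact (min_le_left _ _).trans (min_le_right _ _)
  have h3 : η ≤ m ^ 2 / (2 * a) := by rw [hη]; exact (min_le_right _ _).trans (min_le_left _ _)
  have h4 : η ≤ c / (2 * b) := by rw [hη]; exact (min_le_right _ _).trans (min_le_right _ _)
  clear hη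
  have h2' : M + 1 ≤ 1 / (4 * η) / 2 := by
    rw [le_div_iff₀ (by linarith)] at h2
    rw [div_div, le_div_iff₀ (by positivity)]
    linarith
  have h3' : a < 4 * m ^ 2 * (1 / (4 * η)) := by
    rw [le_div_iff₀ (by positivity)] at h3
    have : 4 * m ^ 2 * (1 / (4 * η)) = m ^ 2 / η := by field_simp
    rw [this, lt_div_iff₀ h0]
    nlinarith [mul_pos h0 ha0]
  have h4' : η * b < c := by
    rw [le_div_iff₀ (by positivity)] at h4
    nlinarith [mul_pos h0 hb0]
  rw [had] at h3'
  rw [hbd, hcd] at h4'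
  refine ⟨η, h0, fun K w f hK2 hK hsol hw hf x y t hx hy => ?_⟩
  have step1 := holder_step hn hγ hκ hm0 hm hm' hM h0 h1 h2' h3' hK hsol hw hf
  have step2 := lip_step hn hγ hκ hm0 hm hm' hM h0 h1 h4' hK2 hK hsol hw hf step1
  rw [abs_le]
  have s1 := step2 x y t hx hy
  have s2 := step2 y x t hy hx
  rw [norm_sub_rev] at s2
  constructor <;> linarith

/-- **Lemma 2.3.** For `-1 < γ < 0`, `1 < p < ∞`, `M ≥ 2` and `K ∈ ℝⁿ` with `2 ≤ |K| ≤ M`,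
and `w` a viscosity solution of the deviation equation in `Q₁` with `w(0,0) = 0`, there is
`η₁ = η₁(p,n,γ,M) > 0` such that if `‖w‖_{L^∞(Q₁)} ≤ η₁` and `‖f̃‖_{L^∞(Q₁)} ≤ η₁` then
`w` is `1`-Lipschitz in space in `Q_{3/4}`. -/
theorem deviation_unit_lipschitz
    (n : ℕ) (hn : 1 ≤ n) (γ p M : ℝ) (hγ : γ ∈ Set.Ioo (-1 : ℝ) 0) (hp : 1 < p)
    (hM : 2 ≤ M) :
    ∃ η₁ : ℝ, 0 < η₁ ∧
      ∀ (K : En n) (w f : En n × ℝ → ℝ),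
        2 ≤ ‖K‖ → ‖K‖ ≤ M →
        IsDevSol γ p K f w (pCyl n 1) →
        w (0, 0) = 0 →
        (∀ z ∈ pCyl n 1, |w z| ≤ η₁) →
        (∀ z ∈ pCyl n 1, |f z| ≤ η₁) →
        ∀ (x y : En n) (t : ℝ), (x, t) ∈ pCyl n (3/4) → (y, t) ∈ pCyl n (3/4) →
          |w (x, t) - w (y, t)| ≤ ‖x - y‖ := by
  obtain ⟨η, h0, h⟩ := main_aux n hn γ p M hγ hp hM
  exact ⟨η, h0, fun K w f h1 h2 h3 _ h5 h6 => h K w f h1 h2 h3 h5 h6⟩
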